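/- Let Ω ⊂ ℝⁿ be a bounded open set, μ a Borel measure with finite total mass on ℝⁿ, g ∈ W^{s,p}_loc(ℝⁿ) ∩ L^{p−1}_{sp}(ℝⁿ), and let u be a SOLA of the Dirichlet problem −L_Φ u = μ in Ω, u = g on ℝⁿ∖Ω. Assume that for a ball B_r(x₀) ⊂ Ω the Wolff potential W^μ_{s,p}(x₀,r) is finite. Then x₀ is a Lebesgue point of u in the sense that the limit u(x₀) := lim_{ρ→0} (u)_{B_ρ(x₀)} of the integral averages exists, and there is a constant c depending only on n, s, p, Λ such that |u(x₀)| ≤ c·W^μ_{s,p}(x₀,r) + c·(⨍_{B_r(x₀)} |u|^{q_*} dx)^{1/q_*} + c·Tail(u; x₀, r), where q_* := max{1, p−1}. -/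

import Mathlib

noncomputable section

open MeasureTheory Metric Set Filter Topology
open scoped ENNReal NNReal

/-- Euclidean space `ℝⁿ`. -/
abbrev Rn (n : ℕ) : Type := EuclideanSpace ℝ (Fin n)

/-- `q_* = max {1, p-1}`. -/
def qStar (p : ℝ) : ℝ := max 1 (p - 1)

/-- `q̄ = min {n(p-1)/(n-s), p}`. -/
def qBar (n : ℕ) (s p : ℝ) : ℝ := min ((n : ℝ) * (p - 1) / ((n : ℝ) - s)) p

/-- Gagliardo seminorm raised to the power `p`, as an `ℝ≥0∞`-valued double integral. -/
def gagliardo (n : ℕ) (s p : ℝ) (O : Set (Rn n)) (v : Rn n → ℝ) : ℝ≥0∞ :=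
  ∫⁻ x in O, ∫⁻ y in O, ENNReal.ofReal (|v x - v y| ^ p / ‖x - y‖ ^ ((n : ℝ) + s * p))

/-- `v ∈ W^{s,p}(O)`. -/
def memWsp (n : ℕ) (s p : ℝ) (O : Set (Rn n)) (v : Rn n → ℝ) : Prop :=
  AEMeasurable v (volume.restrict O) ∧
    (∫⁻ x in O, ENNReal.ofReal (|v x| ^ p)) < ⊤ ∧ gagliardo n s p O v < ⊤

/-- `Tail(v; x₀, r)`. -/
def tailFn (n : ℕ) (s p : ℝ) (v : Rn n → ℝ) (x₀ : Rn n) (r : ℝ) : ℝ≥0∞ :=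
  (ENNReal.ofReal (r ^ (s * p)) *
      ∫⁻ x in (ball x₀ r)ᶜ,
        ENNReal.ofReal (|v x| ^ (p - 1) / ‖x - x₀‖ ^ ((n : ℝ) + s * p))) ^ (1 / (p - 1))

/-- `v ∈ L^{p-1}_{sp}(ℝⁿ)`. -/
def memTailSpace (n : ℕ) (s p : ℝ) (v : Rn n → ℝ) : Prop :=
  AEMeasurable v (volume : Measure (Rn n)) ∧
    (∀ R : ℝ, (∫⁻ x in ball (0 : Rn n) R, ENNReal.ofReal (|v x| ^ (p - 1))) < ⊤) ∧
    ∀ z : Rn n, ∀ r : ℝ, 0 < r → tailFn n s p v z r < ⊤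

/-- `φ ∈ C_0^∞(O)`. -/
def IsTestFun (n : ℕ) (O : Set (Rn n)) (φ : Rn n → ℝ) : Prop :=
  ContDiff ℝ (⊤ : ℕ∞) φ ∧ HasCompactSupport φ ∧ tsupport φ ⊆ O

/-- The nonlocal form `⟨-L_Φ u, φ⟩`. -/
def nonlocalForm (n : ℕ) (Φ : ℝ → ℝ) (K : Rn n → Rn n → ℝ) (u φ : Rn n → ℝ) : ℝ :=
  ∫ x : Rn n, ∫ y : Rn n, Φ (u x - u y) * (φ x - φ y) * K x y

/-- Ellipticity/coercivity bounds on the kernel `K`. -/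
def KernelBounds (n : ℕ) (Λ s p : ℝ) (K : Rn n → Rn n → ℝ) : Prop :=
  Measurable (Function.uncurry K) ∧
    ∀ x y : Rn n, x ≠ y →
      1 / (Λ * ‖x - y‖ ^ ((n : ℝ) + s * p)) ≤ K x y ∧
        K x y ≤ Λ / ‖x - y‖ ^ ((n : ℝ) + s * p)

/-- Structure conditions on `Φ`. -/
def PhiBounds (Λ p : ℝ) (Φ : ℝ → ℝ) : Prop :=
  Continuous Φ ∧ Φ 0 = 0 ∧
    ∀ t : ℝ, |t| ^ p / Λ ≤ Φ t * t ∧ Φ t * t ≤ Λ * |t| ^ p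

/-- `∫ φ dμ` for a signed measure `μ`. -/
def sintegral (n : ℕ) (μ : MeasureTheory.SignedMeasure (Rn n)) (φ : Rn n → ℝ) : ℝ :=
  (∫ x, φ x ∂μ.toJordanDecomposition.posPart) -
    ∫ x, φ x ∂μ.toJordanDecomposition.negPart

/-- Weak (energy) solution of `-L_Φ u = f` in `Ω`, `u = g` on `ℝⁿ ∖ Ω`. -/
def WeakSol (n : ℕ) (Φ : ℝ → ℝ) (K : Rn n → Rn n → ℝ) (s p : ℝ)
    (Ω : Set (Rn n)) (f g u : Rn n → ℝ) : Prop :=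
  memWsp n s p univ u ∧ (∀ᵐ x : Rn n, x ∉ Ω → u x = g x) ∧
    ∀ φ : Rn n → ℝ, IsTestFun n Ω φ → nonlocalForm n Φ K u φ = ∫ x : Rn n, φ x * f x

/-- Weak subsolution of the homogeneous equation `-L_Φ w = 0` in `Ω`. -/
def WeakSubSol (n : ℕ) (Φ : ℝ → ℝ) (K : Rn n → Rn n → ℝ) (s p : ℝ)
    (Ω : Set (Rn n)) (w : Rn n → ℝ) : Prop :=
  memWsp n s p univ w ∧
    ∀ φ : Rn n → ℝ, IsTestFun n Ω φ → (∀ x, 0 ≤ φ x) → nonlocalForm n Φ K w φ ≤ 0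

/-- The approximation properties required of a SOLA. -/
def SOLAApprox (n : ℕ) (Φ : ℝ → ℝ) (K : Rn n → Rn n → ℝ) (s p : ℝ)
    (Ω : Set (Rn n)) (μ : MeasureTheory.SignedMeasure (Rn n)) (g u : Rn n → ℝ)
    (uj μj gj : ℕ → Rn n → ℝ) : Prop :=
  (∀ j, ContDiff ℝ (⊤ : ℕ∞) (μj j) ∧ HasCompactSupport (μj j)) ∧
  (∀ j, ContDiff ℝ (⊤ : ℕ∞) (gj j) ∧ HasCompactSupport (gj j)) ∧
  (∀ j, WeakSol n Φ K s p Ω (μj j) (gj j) (uj j)) ∧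
  (∀ᵐ x : Rn n, Tendsto (fun j => uj j x) atTop (𝓝 (u x))) ∧
  (∀ q : ℝ, qStar p ≤ q → q < qBar n s p → ∀ z : Rn n, ∀ r : ℝ, 0 < r →
    Tendsto (fun j => ∫⁻ x in ball z r, ENNReal.ofReal (|uj j x - u x| ^ q)) atTop (𝓝 0)) ∧
  (∀ φ : Rn n → ℝ, Continuous φ → HasCompactSupport φ → tsupport φ ⊆ Ω →
    Tendsto (fun j => ∫ x : Rn n, φ x * μj j x) atTop (𝓝 (sintegral n μ φ))) ∧
  (∀ z : Rn n, ∀ r : ℝ, 0 < r →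
    Filter.limsup (fun j => ∫⁻ x in ball z r, ENNReal.ofReal |μj j x|) atTop
      ≤ μ.totalVariation (closedBall z r)) ∧
  (∀ z : Rn n, ∀ r : ℝ, 0 < r →
    Tendsto (fun j =>
        (∫⁻ x in ball z r, ENNReal.ofReal (|gj j x - g x| ^ p)) +
          gagliardo n s p (ball z r) (fun x => gj j x - g x)) atTop (𝓝 0) ∧
      Tendsto (fun j => tailFn n s p (fun x => gj j x - g x) z r) atTop (𝓝 0))

/-- SOLA of the Dirichlet problem `-L_Φ u = μ` in `Ω`, `u = g` on `ℝⁿ ∖ Ω`. -/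
def IsSOLA (n : ℕ) (Φ : ℝ → ℝ) (K : Rn n → Rn n → ℝ) (s p : ℝ)
    (Ω : Set (Rn n)) (μ : MeasureTheory.SignedMeasure (Rn n)) (g u : Rn n → ℝ) : Prop :=
  (∀ h q : ℝ, 0 < h → h < s → qStar p ≤ q → q < qBar n s p → memWsp n h q Ω u) ∧
  (∀ φ : Rn n → ℝ, IsTestFun n Ω φ → nonlocalForm n Φ K u φ = sintegral n μ φ) ∧
  (∀ᵐ x : Rn n, x ∉ Ω → u x = g x) ∧
  ∃ uj μj gj : ℕ → Rn n → ℝ, SOLAApprox n Φ K s p Ω μ g u uj μj gj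

/-- Truncated Wolff potential `W^ν_{s,p}(x₀, r)`. -/
def wolff (n : ℕ) (s p : ℝ) (ν : Measure (Rn n)) (x₀ : Rn n) (r : ℝ) : ℝ≥0∞ :=
  ∫⁻ ρ in Ioc (0 : ℝ) r,
    (ν (ball x₀ ρ) / ENNReal.ofReal (ρ ^ ((n : ℝ) - s * p))) ^ (1 / (p - 1)) /
      ENNReal.ofReal ρ

/-- Integral average of `u` over `B_r(x₀)`. -/
def ballAvg (n : ℕ) (u : Rn n → ℝ) (x₀ : Rn n) (r : ℝ) : ℝ :=
  ⨍ x in ball x₀ r, u x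

/-- Local excess `A(f; x₀, r)`. -/
def locExcess (n : ℕ) (p : ℝ) (f : Rn n → ℝ) (x₀ : Rn n) (r : ℝ) : ℝ≥0∞ :=
  ((volume (ball x₀ r))⁻¹ *
      ∫⁻ x in ball x₀ r, ENNReal.ofReal (|f x - ballAvg n f x₀ r| ^ qStar p)) ^ (1 / qStar p)

/-- Global excess `E(f; x₀, r)`. -/
def excess (n : ℕ) (s p : ℝ) (f : Rn n → ℝ) (x₀ : Rn n) (r : ℝ) : ℝ≥0∞ :=
  locExcess n p f x₀ r + tailFn n s p (fun x => f x - ballAvg n f x₀ r) x₀ r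

/-- `g ∈ W^{s,p}_loc(ℝⁿ) ∩ L^{p-1}_{sp}(ℝⁿ)`. -/
def BoundaryDatum (n : ℕ) (s p : ℝ) (g : Rn n → ℝ) : Prop :=
  (∀ z : Rn n, ∀ r : ℝ, 0 < r → memWsp n s p (ball z r) g) ∧ memTailSpace n s p g

/-- Symmetric measurable kernel with ellipticity bounds. -/
def SymKernel (n : ℕ) (Λ s p : ℝ) (Kt : Rn n → Rn n → ℝ) : Prop :=
  KernelBounds n Λ s p Kt ∧ ∀ x y : Rn n, Kt x y = Kt y x

/-- Weak solution of the kernel-`Kt` fractional `p`-Laplace equation with datum `f` in `O`. -/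
def WeakSolP (n : ℕ) (Kt : Rn n → Rn n → ℝ) (s p : ℝ) (O : Set (Rn n))
    (f u : Rn n → ℝ) : Prop :=
  memWsp n s p univ u ∧
    ∀ φ : Rn n → ℝ, IsTestFun n O φ →
      (∫ x : Rn n, ∫ y : Rn n,
          |u x - u y| ^ (p - 2) * (u x - u y) * (φ x - φ y) * Kt x y) =
        ∫ x : Rn n, φ x * f x

section Kernel

variable {n : ℕ}

lemma lintegral_affine (f : Rn n → ℝ≥0∞) (x₀ : Rn n) {r : ℝ} (hr : 0 < r) :
    ∫⁻ x, f x = ENNReal.ofReal (r ^ n) * ∫⁻ x, f (x₀ + r • x) := by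
  have h1 : ∫⁻ x, f (x₀ + r • x) = ENNReal.ofReal ((r ^ n)⁻¹) * ∫⁻ x, f x := by
    have e : MeasurableEmbedding (fun x : Rn n => r • x) :=
      (Homeomorph.smulOfNeZero r hr.ne').measurableEmbedding
    have := e.lintegral_map (μ := volume) (fun x => f (x₀ + x))
    rw [← this, Measure.map_addHaar_smul _ hr.ne', lintegral_smul_measure,
      lintegral_add_left_eq_self f x₀, finrank_euclideanSpace_fin, abs_of_pos (by positivity),
      smul_eq_mul]
  rw [h1, ← mul_assoc, ← ENNReal.ofReal_mul (by positivity), mul_inv_cancel₀ (by positivity)]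
  simp

lemma setLIntegral_affine (f : Rn n → ℝ≥0∞) (x₀ : Rn n) {r : ℝ} (hr : 0 < r)
    {S : Set (Rn n)} (hS : MeasurableSet S) :
    ∫⁻ x in S, f x =
      ENNReal.ofReal (r ^ n) * ∫⁻ x in (fun x => x₀ + r • x) ⁻¹' S, f (x₀ + r • x) := by
  have hm : Measurable (fun x : Rn n => x₀ + r • x) := by fun_prop
  rw [← lintegral_indicator hS, ← lintegral_indicator (hm hS), lintegral_affine _ x₀ hr]
  rfl

lemma preimage_affine_ball (x₀ : Rn n) {r : ℝ} (hr : 0 < r) (R : ℝ) :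
    (fun x : Rn n => x₀ + r • x) ⁻¹' ball x₀ (r * R) = ball 0 R := by
  ext x
  simp [norm_smul, abs_of_pos hr, hr]

lemma lintegral_ball_affine (f : Rn n → ℝ≥0∞) (x₀ : Rn n) {r : ℝ} (hr : 0 < r) (R : ℝ) :
    ∫⁻ x in ball x₀ (r * R), f x =
      ENNReal.ofReal (r ^ n) * ∫⁻ x in ball 0 R, f (x₀ + r • x) := by
  rw [setLIntegral_affine f x₀ hr measurableSet_ball, preimage_affine_ball x₀ hr]

lemma lintegral_compl_ball_affine (f : Rn n → ℝ≥0∞) (x₀ : Rn n) {r : ℝ} (hr : 0 < r) (R : ℝ) :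
    ∫⁻ x in (ball x₀ (r * R))ᶜ, f x =
      ENNReal.ofReal (r ^ n) * ∫⁻ x in (ball 0 R)ᶜ, f (x₀ + r • x) := by
  rw [setLIntegral_affine f x₀ hr measurableSet_ball.compl, preimage_compl,
    preimage_affine_ball x₀ hr]

lemma exists_lintegral_ball_norm_rpow (hn : 2 ≤ n) {a : ℝ} (ha : a < n) :
    ∃ C : ℝ, 0 < C ∧ ∀ (x : Rn n) (R : ℝ), 0 < R →
      ∫⁻ y in ball x R, ENNReal.ofReal (‖x - y‖ ^ (-a)) ≤ ENNReal.ofReal (C * R ^ (n - a)) := by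
  have hfin : ∫⁻ y in ball (0 : Rn n) 1, ENNReal.ofReal (‖y‖ ^ (-a)) < ⊤ := by
    have : IntegrableOn (fun y : Rn n => ‖y‖ ^ (-a)) (ball 0 1) := by
      refine integrableOn_ball_of_norm_le_rpow (C := 1) (α := a) ?_ ?_ ?_ ?_
      · rw [finrank_euclideanSpace_fin]; omega
      · rw [finrank_euclideanSpace_fin]; exact ha
      · refine Eventually.of_forall fun y => ?_
        rw [Real.norm_of_nonneg (by positivity), one_mul]
      · exact (measurable_norm.pow_const _).aestronglyMeasurable
    have h := this.2
    rw [hasFiniteIntegral_iff_norm] at h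
    refine lt_of_eq_of_lt (lintegral_congr fun y => ?_) h
    rw [Real.norm_of_nonneg (by positivity)]
  set I := ∫⁻ y in ball (0 : Rn n) 1, ENNReal.ofReal (‖y‖ ^ (-a)) with hI
  refine ⟨I.toReal + 1, by positivity, fun x R hR => ?_⟩
  have := lintegral_ball_affine (fun y => ENNReal.ofReal (‖x - y‖ ^ (-a))) x hR 1
  rw [mul_one] at this
  rw [this]
  have e : ∀ y : Rn n, ENNReal.ofReal (‖x - (x + R • y)‖ ^ (-a)) =
      ENNReal.ofReal (R ^ (-a)) * ENNReal.ofReal (‖y‖ ^ (-a)) := fun y => by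
    rw [← ENNReal.ofReal_mul (by positivity), ← Real.mul_rpow hR.le (norm_nonneg _)]
    congr 2
    simp [norm_smul, abs_of_pos hR]
  simp_rw [e]
  rw [lintegral_const_mul' _ _ ENNReal.ofReal_ne_top, ← mul_assoc,
    ← ENNReal.ofReal_mul (by positivity), ← Real.rpow_natCast, ← Real.rpow_add hR, ← hI,
    ← ENNReal.ofReal_toReal hfin.ne, ← ENNReal.ofReal_mul (by positivity)]
  apply ENNReal.ofReal_le_ofReal
  rw [mul_comm, ENNReal.toReal_ofReal ENNReal.toReal_nonneg, ← sub_eq_add_neg]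
  gcongr
  linarith

lemma exists_lintegral_compl_ball_norm_rpow {a : ℝ} (ha : (n : ℝ) < a) :
    ∃ C : ℝ, 0 < C ∧ ∀ (x : Rn n) (R : ℝ), 0 < R →
      ∫⁻ y in (ball x R)ᶜ, ENNReal.ofReal (‖x - y‖ ^ (-a)) ≤ ENNReal.ofReal (C * R ^ (n - a)) := by
  have ha0 : 0 < a := lt_of_le_of_lt (Nat.cast_nonneg n) ha
  have hfin : ∫⁻ y in (ball (0 : Rn n) 1)ᶜ, ENNReal.ofReal (‖y‖ ^ (-a)) < ⊤ := by
    have hi : Integrable (fun y : Rn n => (1 + ‖y‖) ^ (-a)) := by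
      apply integrable_one_add_norm
      rw [finrank_euclideanSpace_fin]; exact ha
    have h := (hi.const_mul (2 ^ a)).2
    rw [hasFiniteIntegral_iff_norm] at h
    refine lt_of_le_of_lt ?_ h
    refine le_trans (setLIntegral_mono' measurableSet_ball.compl fun y hy => ?_)
      (setLIntegral_le_lintegral _ _)
    have hy1 : 1 ≤ ‖y‖ := by simpa using hy
    apply ENNReal.ofReal_le_ofReal
    rw [Real.norm_of_nonneg (by positivity)]
    have : (2 * ‖y‖) ^ (-a) ≤ (1 + ‖y‖) ^ (-a) :=
      Real.rpow_le_rpow_of_nonpos (by positivity) (by linarith) (by linarith)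
    rw [Real.mul_rpow (by positivity) (by positivity)] at this
    calc ‖y‖ ^ (-a) = 2 ^ a * (2 ^ (-a) * ‖y‖ ^ (-a)) := by
          rw [← mul_assoc, ← Real.rpow_add (by norm_num)]; simp
      _ ≤ _ := by gcongr
  set I := ∫⁻ y in (ball (0 : Rn n) 1)ᶜ, ENNReal.ofReal (‖y‖ ^ (-a)) with hI
  refine ⟨I.toReal + 1, by positivity, fun x R hR => ?_⟩
  have := lintegral_compl_ball_affine (fun y => ENNReal.ofReal (‖x - y‖ ^ (-a))) x hR 1
  rw [mul_one] at this
  rw [this]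
  have e : ∀ y : Rn n, ENNReal.ofReal (‖x - (x + R • y)‖ ^ (-a)) =
      ENNReal.ofReal (R ^ (-a)) * ENNReal.ofReal (‖y‖ ^ (-a)) := fun y => by
    rw [← ENNReal.ofReal_mul (by positivity), ← Real.mul_rpow hR.le (norm_nonneg _)]
    congr 2
    simp [norm_smul, abs_of_pos hR]
  simp_rw [e]
  rw [lintegral_const_mul' _ _ ENNReal.ofReal_ne_top, ← mul_assoc,
    ← ENNReal.ofReal_mul (by positivity), ← Real.rpow_natCast, ← Real.rpow_add hR, ← hI,
    ← ENNReal.ofReal_toReal hfin.ne, ← ENNReal.ofReal_mul (by positivity)]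
  apply ENNReal.ofReal_le_ofReal
  rw [mul_comm, ENNReal.toReal_ofReal ENNReal.toReal_nonneg, ← sub_eq_add_neg]
  gcongr
  linarith

end Kernel

section Mollify

variable {n : ℕ} {E : Type*} [NormedAddCommGroup E] [NormedSpace ℝ E] [FiniteDimensional ℝ E]
  [MeasurableSpace E] [BorelSpace E] {μ : Measure E} [μ.IsAddHaarMeasure]

lemma tendsto_integral_mul_translate {p q : ℝ} (hpq : p.HolderConjugate q) {P Q : E → ℝ}
    (hP : MemLp P (ENNReal.ofReal p) μ) (hQ : MemLp Q (ENNReal.ofReal q) μ)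
    {L : Rn n → E} (hL : Continuous L) (hL0 : L 0 = 0) :
    Tendsto (fun z => ∫ w, Q w * P (w - L z) ∂μ) (𝓝 0) (𝓝 (∫ w, Q w * P w ∂μ)) := by
  have : Fact (1 ≤ ENNReal.ofReal p) := ⟨by simpa using hpq.lt.le⟩
  have : ENNReal.HolderTriple (ENNReal.ofReal q) (ENNReal.ofReal p) 1 :=
    (Real.HolderConjugate.ennrealOfReal hpq).symm
  have mp : ∀ z : Rn n, MeasurePreserving (fun w => w - L z) μ μ := fun z =>
    measurePreserving_sub_right μ (L z)
  let g : Rn n → C(E, E) := fun z => ⟨fun w => w - L z, by fun_prop⟩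
  have hg : Continuous g := by
    refine ContinuousMap.continuous_of_continuous_uncurry _ ?_
    change Continuous fun x : Rn n × E => x.2 - L x.1
    fun_prop
  have key := ContinuousAt.compMeasurePreservingLp (z := (0 : Rn n)) (μ := μ) (ν := μ)
    (f := fun _ => hP.toLp P) continuousAt_const hg.continuousAt mp ENNReal.ofReal_ne_top
  have k0 : Lp.compMeasurePreserving (g 0) (mp 0) (hP.toLp P) = hP.toLp P := by
    apply Lp.ext
    refine (Lp.coeFn_compMeasurePreserving _ (mp 0)).trans ?_
    refine Eventually.of_forall fun w => ?_
    simp [hL0]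
  have key2 : Tendsto (fun z => eLpNorm (fun w => P (w - L z) - P w) (ENNReal.ofReal p) μ)
      (𝓝 0) (𝓝 0) := by
    have h1 : Tendsto (fun z => Lp.compMeasurePreserving (g z) (mp z) (hP.toLp P)) (𝓝 0)
        (𝓝 (hP.toLp P)) := by
      have := key.tendsto; rwa [k0] at this
    rw [Lp.tendsto_Lp_iff_tendsto_eLpNorm'] at h1
    refine h1.congr fun z => eLpNorm_congr_ae ?_
    have e1 := Lp.coeFn_compMeasurePreserving (hP.toLp P) (mp z)
    have e2 : (fun w => (hP.toLp P) (w - L z)) =ᵐ[μ] fun w => P (w - L z) :=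
      (mp z).quasiMeasurePreserving.ae_eq hP.coeFn_toLp
    filter_upwards [e1, e2, hP.coeFn_toLp] with w h1 h2 h3
    rw [Pi.sub_apply, h3, ← h2]
    congr 1
  have hPz : ∀ z, MemLp (fun w => P (w - L z)) (ENNReal.ofReal p) μ := fun z =>
    hP.comp_measurePreserving (mp z)
  have i1 : ∀ z, Integrable (fun w => Q w * P (w - L z)) μ := fun z =>
    (memLp_one_iff_integrable.1 ((hPz z).smul hQ))
  have i0 : Integrable (fun w => Q w * P w) μ := memLp_one_iff_integrable.1 (hP.smul hQ)
  have b : Tendsto (fun z => eLpNorm Q (ENNReal.ofReal q) μ *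
      eLpNorm (fun w => P (w - L z) - P w) (ENNReal.ofReal p) μ) (𝓝 0) (𝓝 0) := by
    have := ENNReal.Tendsto.const_mul key2 (Or.inr hQ.2.ne)
    simpa using this
  rw [tendsto_iff_edist_tendsto_0]
  refine tendsto_of_tendsto_of_tendsto_of_le_of_le tendsto_const_nhds b (fun _ => zero_le)
    fun z => ?_
  have hs := eLpNorm_smul_le_mul_eLpNorm (p := ENNReal.ofReal q)
    (q := ENNReal.ofReal p) (r := 1) ((hPz z).sub hP).1 hQ.1
  refine le_trans ?_ hs
  rw [eLpNorm_one_eq_lintegral_enorm, edist_eq_enorm_sub, ← integral_sub (i1 z) i0]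
  refine (enorm_integral_le_lintegral_enorm _).trans (le_of_eq ?_)
  refine lintegral_congr fun w => ?_
  simp [mul_sub]

lemma integrable_mollify {p q : ℝ} (hpq : p.HolderConjugate q) {P Q : E → ℝ}
    (hP : MemLp P (ENNReal.ofReal p) μ) (hQ : MemLp Q (ENNReal.ofReal q) μ)
    {L : Rn n → E} (hL : Continuous L) {η : Rn n → ℝ} (hη : Integrable η) :
    Integrable (fun a : Rn n × E => η a.1 * (Q a.2 * P (a.2 - L a.1))) (volume.prod μ) := by
  have mp : MeasurePreserving (fun a : Rn n × E => (a.1, a.2 - L a.1))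
      (volume.prod μ) (volume.prod μ) := by
    refine (MeasurePreserving.id volume).skew_product (g := fun z w => w - L z) ?_ ?_
    · have := hL.measurable
      exact Continuous.measurable (by fun_prop)
    · exact Eventually.of_forall fun z => (measurePreserving_sub_right μ (L z)).map_eq
  have iQ : Integrable (fun w => |Q w| ^ q) μ := by
    have := hQ.integrable_norm_rpow (by simp [hpq.symm.pos]) ENNReal.ofReal_ne_top
    simpa [ENNReal.toReal_ofReal hpq.symm.nonneg] using this
  have iP : Integrable (fun w => |P w| ^ p) μ := by
    have := hP.integrable_norm_rpow (by simp [hpq.pos]) ENNReal.ofReal_ne_top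
    simpa [ENNReal.toReal_ofReal hpq.nonneg] using this
  have j1 : Integrable (fun a : Rn n × E => |η a.1| * |Q a.2| ^ q) (volume.prod μ) :=
    hη.abs.mul_prod iQ
  have j2 : Integrable (fun a : Rn n × E => |η a.1| * |P (a.2 - L a.1)| ^ p) (volume.prod μ) :=
    mp.integrable_comp_of_integrable (hη.abs.mul_prod iP)
  have m1 : AEStronglyMeasurable (fun a : Rn n × E => P (a.2 - L a.1)) (volume.prod μ) :=
    hP.1.comp_snd.comp_measurePreserving mp
  refine (j1.add j2).mono' (hη.1.comp_fst.mul (hQ.1.comp_snd.mul m1))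
    (Eventually.of_forall fun a => ?_)
  rw [norm_mul, norm_mul, Pi.add_apply, ← mul_add]
  refine mul_le_mul_of_nonneg_left ?_ (norm_nonneg _)
  have y := Real.young_inequality_of_nonneg (norm_nonneg (Q a.2)) (norm_nonneg (P (a.2 - L a.1)))
    hpq.symm
  refine y.trans (add_le_add ?_ ?_)
  · exact div_le_self (by positivity) hpq.symm.lt.le
  · exact div_le_self (by positivity) hpq.lt.le

lemma exists_mollify_close {p q : ℝ} (hpq : p.HolderConjugate q) {P Q : E → ℝ}
    (hP : MemLp P (ENNReal.ofReal p) μ) (hQ : MemLp Q (ENNReal.ofReal q) μ)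
    {L : Rn n → E} (hL : Continuous L) (hL0 : L 0 = 0) {θ : ℝ} (hθ : 0 < θ) :
    ∃ ε > 0, ∀ η : ContDiffBump (0 : Rn n), η.rOut ≤ ε →
      |(∫ w, Q w * (∫ z, η.normed volume z * P (w - L z)) ∂μ) - ∫ w, Q w * P w ∂μ| ≤ θ := by
  have ht := tendsto_integral_mul_translate hpq hP hQ hL hL0
  obtain ⟨ε, hε, h⟩ := Metric.tendsto_nhds_nhds.1 ht θ hθ
  refine ⟨ε, hε, fun η hη => ?_⟩
  have hηi : Integrable (η.normed volume) := η.integrable_normed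
  have hi := integrable_mollify hpq hP hQ hL hηi
  have e : (∫ w, Q w * (∫ z, η.normed volume z * P (w - L z)) ∂μ) =
      ∫ z, η.normed volume z * (∫ w, Q w * P (w - L z) ∂μ) := by
    have := integral_integral_swap
      (f := fun z w => η.normed volume z * (Q w * P (w - L z))) hi
    simp_rw [← integral_const_mul]
    rw [this]
    refine integral_congr_ae (Eventually.of_forall fun w => ?_)
    refine integral_congr_ae (Eventually.of_forall fun z => ?_)
    simp only []
    ring
  have hi2 : Integrable (fun z => η.normed volume z * ∫ w, Q w * P (w - L z) ∂μ) := by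
    have := hi.integral_prod_left
    simpa only [integral_const_mul] using this
  have e2 : (∫ w, Q w * P w ∂μ) = ∫ z, η.normed volume z * (∫ w, Q w * P w ∂μ) := by
    rw [integral_mul_const, η.integral_normed, one_mul]
  rw [e, e2, ← integral_sub hi2 (hηi.mul_const _)]
  have hb : ∀ z, ‖η.normed volume z * (∫ w, Q w * P (w - L z) ∂μ) -
      η.normed volume z * ∫ w, Q w * P w ∂μ‖ ≤ η.normed volume z * θ := fun z => by
    rw [← mul_sub, norm_mul, Real.norm_of_nonneg (η.nonneg_normed z)]
    by_cases hz : z ∈ Function.support (η.normed volume)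
    · rw [η.support_normed_eq] at hz
      refine mul_le_mul_of_nonneg_left ?_ (η.nonneg_normed z)
      have hz' : dist z 0 < ε := lt_of_lt_of_le hz hη
      exact (h hz').le
    · rw [Function.notMem_support.1 hz]; simp
  have := norm_integral_le_of_norm_le (hηi.mul_const θ) (Eventually.of_forall hb)
  rwa [integral_mul_const, η.integral_normed, one_mul] at this

end Mollify

section Test

variable {n : ℕ} {s p Λ : ℝ} {Φ : ℝ → ℝ} {K : Rn n → Rn n → ℝ}

lemma PhiBounds.mul_nonneg (hΛ : 1 ≤ Λ) (hΦ : PhiBounds Λ p Φ) (t : ℝ) : 0 ≤ Φ t * t :=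
  le_trans (by positivity) (hΦ.2.2 t).1

lemma PhiBounds.abs_le (hΛ : 1 ≤ Λ) (hp : 1 < p) (hΦ : PhiBounds Λ p Φ) (t : ℝ) :
    |Φ t| ≤ Λ * |t| ^ (p - 1) := by
  rcases eq_or_ne t 0 with rfl | ht
  · rw [hΦ.2.1]; simp [Real.zero_rpow (by linarith : p - 1 ≠ 0)]
  · have h := (hΦ.2.2 t).2
    have ht' := abs_pos.2 ht
    rw [← abs_of_nonneg (hΦ.mul_nonneg hΛ t), abs_mul] at h
    rw [Real.rpow_sub_one ht'.ne', ← mul_div_assoc, le_div_iff₀ ht']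
    exact h

lemma PhiBounds.le_of_pos (hΦ : PhiBounds Λ p Φ) {t : ℝ} (ht : 0 < t) :
    t ^ (p - 1) / Λ ≤ Φ t := by
  have h := (hΦ.2.2 t).1
  rw [abs_of_pos ht] at h
  rw [Real.rpow_sub_one ht.ne', div_right_comm, div_le_iff₀ ht]
  exact h

lemma KernelBounds.le (hK : KernelBounds n Λ s p K) {x y : Rn n} (h : x ≠ y) :
    K x y ≤ Λ * ‖x - y‖ ^ (-((n : ℝ) + s * p)) := by
  rw [Real.rpow_neg (norm_nonneg _), ← div_eq_mul_inv]
  exact (hK.2 x y h).2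

lemma KernelBounds.ge (hK : KernelBounds n Λ s p K) {x y : Rn n} (h : x ≠ y) :
    Λ⁻¹ * ‖x - y‖ ^ (-((n : ℝ) + s * p)) ≤ K x y := by
  rw [Real.rpow_neg (norm_nonneg _), ← mul_inv, ← one_div]
  exact (hK.2 x y h).1

lemma integrable_gagliardo {v : Rn n → ℝ} (hv : Measurable v)
    (h : gagliardo n s p univ v < ⊤) :
    Integrable (fun w : Rn n × Rn n =>
      |v w.1 - v w.2| ^ p * ‖w.1 - w.2‖ ^ (-((n : ℝ) + s * p))) := by
  have hm : Measurable (fun w : Rn n × Rn n =>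
      |v w.1 - v w.2| ^ p * ‖w.1 - w.2‖ ^ (-((n : ℝ) + s * p))) := by fun_prop
  refine ⟨hm.aestronglyMeasurable, ?_⟩
  rw [hasFiniteIntegral_iff_ofReal (Eventually.of_forall fun w => by positivity),
    Measure.volume_eq_prod, lintegral_prod _ hm.ennreal_ofReal.aemeasurable]
  refine lt_of_le_of_lt (le_of_eq ?_) h
  simp only [gagliardo, Measure.restrict_univ]
  refine lintegral_congr fun x => lintegral_congr fun y => ?_
  rw [Real.rpow_neg (norm_nonneg _), ← div_eq_mul_inv]

lemma memLp_quotient (hp : 1 < p) {v : Rn n → ℝ} (hv : Measurable v)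
    (h : gagliardo n s p univ v < ⊤) :
    MemLp (fun w : Rn n × Rn n =>
      (v w.1 - v w.2) * ‖w.1 - w.2‖ ^ (-((n : ℝ) + s * p) / p)) (ENNReal.ofReal p) := by
  rw [← integrable_norm_rpow_iff (by fun_prop) (by simp; linarith) (by simp)]
  refine (integrable_gagliardo hv h).congr (Eventually.of_forall fun w => ?_)
  simp only
  rw [ENNReal.toReal_ofReal (by linarith), norm_mul, Real.norm_eq_abs, Real.norm_eq_abs,
    Real.mul_rpow (by positivity) (by positivity),
    abs_of_nonneg (Real.rpow_nonneg (norm_nonneg (w.1 - w.2)) _), ← Real.rpow_mul (by positivity), div_mul_cancel₀ _ (by linarith)]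

lemma memLp_flux (hs : 0 < s) (hΛ : 1 ≤ Λ) {q : ℝ} (hpq : p.HolderConjugate q)
    (hK : KernelBounds n Λ s p K)
    (hΦ : PhiBounds Λ p Φ) {u : Rn n → ℝ} (hu : Measurable u) (h : gagliardo n s p univ u < ⊤) :
    MemLp (fun w : Rn n × Rn n =>
      Φ (u w.1 - u w.2) * K w.1 w.2 * ‖w.1 - w.2‖ ^ (((n : ℝ) + s * p) / p))
      (ENNReal.ofReal q) := by
  have hΦm := hΦ.1.measurable
  have hKm : Measurable fun w : Rn n × Rn n => K w.1 w.2 := hK.1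
  have hm : Measurable (fun w : Rn n × Rn n =>
      Φ (u w.1 - u w.2) * K w.1 w.2 * ‖w.1 - w.2‖ ^ (((n : ℝ) + s * p) / p)) := by fun_prop
  have hq := hpq.symm.pos
  have hp := hpq.pos
  have hp1 := hpq.lt
  rw [← integrable_norm_rpow_iff hm.aestronglyMeasurable (by simpa using hq) (by simp)]
  refine ((integrable_gagliardo hu h).const_mul ((Λ * Λ) ^ q)).mono'
    (hm.norm.pow_const _).aestronglyMeasurable (Eventually.of_forall fun w => ?_)
  rw [ENNReal.toReal_ofReal hq.le, Real.norm_of_nonneg (by positivity)]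
  have ha : 0 < (n : ℝ) + s * p := by positivity
  rcases eq_or_ne w.1 w.2 with e | e
  · simp [e, Real.zero_rpow (div_pos ha hp).ne', Real.zero_rpow hq.ne', hp.ne']
  have hd : 0 < ‖w.1 - w.2‖ := norm_pos_iff.2 (sub_ne_zero.2 e)
  have hK0 : 0 ≤ K w.1 w.2 := le_trans (by positivity) (hK.ge e)
  have b : ‖Φ (u w.1 - u w.2) * K w.1 w.2 * ‖w.1 - w.2‖ ^ (((n : ℝ) + s * p) / p)‖ ≤
      Λ * Λ * (|u w.1 - u w.2| ^ (p - 1) * ‖w.1 - w.2‖ ^ (-((n : ℝ) + s * p) / q)) := by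
    rw [norm_mul, norm_mul, Real.norm_of_nonneg hK0, Real.norm_of_nonneg (Real.rpow_nonneg hd.le _),
      Real.norm_eq_abs]
    have e1 : ‖w.1 - w.2‖ ^ (-((n : ℝ) + s * p) / q) =
        ‖w.1 - w.2‖ ^ (-((n : ℝ) + s * p)) * ‖w.1 - w.2‖ ^ (((n : ℝ) + s * p) / p) := by
      rw [← Real.rpow_add hd]
      congr 1
      have := hpq.inv_add_inv_eq_one
      rw [div_eq_mul_inv, div_eq_mul_inv, show q⁻¹ = 1 - p⁻¹ by linarith]
      ring
    rw [e1]
    calc _ ≤ Λ * |u w.1 - u w.2| ^ (p - 1) * (Λ * ‖w.1 - w.2‖ ^ (-((n : ℝ) + s * p))) *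
          ‖w.1 - w.2‖ ^ (((n : ℝ) + s * p) / p) := by
          gcongr
          · exact hΦ.abs_le hΛ hp1 _
          · exact hK.le e
      _ = _ := by ring
  refine (Real.rpow_le_rpow (norm_nonneg _) b hq.le).trans (le_of_eq ?_)
  rw [Real.mul_rpow (by positivity) (by positivity),
    Real.mul_rpow (Real.rpow_nonneg (abs_nonneg _) _) (Real.rpow_nonneg hd.le _),
    ← Real.rpow_mul (abs_nonneg _), ← Real.rpow_mul hd.le, div_mul_cancel₀ _ hq.ne',
    hpq.sub_one_mul_conj]

lemma memLp_of_bounded_support {ψ : Rn n → ℝ} (hψ : Measurable ψ) {B : ℝ} (hB : ∀ x, |ψ x| ≤ B)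
    {x₀ : Rn n} {R : ℝ} (hsupp : ∀ x ∉ closedBall x₀ R, ψ x = 0) (q : ℝ≥0∞) : MemLp ψ q := by
  have h := memLp_indicator_const (μ := volume) q (isClosed_closedBall (x := x₀) (ε := R)).measurableSet
    B (Or.inr (isCompact_closedBall x₀ R).measure_lt_top.ne)
  refine h.mono' hψ.aestronglyMeasurable (Eventually.of_forall fun x => ?_)
  by_cases hx : x ∈ closedBall x₀ R
  · rw [indicator_of_mem hx]; exact hB x
  · rw [indicator_of_notMem hx, hsupp x hx]; simp

lemma isTestFun_mollify {Ω : Set (Rn n)} {ψ : Rn n → ℝ} (hψ : Measurable ψ) {B : ℝ}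
    (hB : ∀ x, |ψ x| ≤ B) {x₀ : Rn n} {R R' : ℝ} (hsupp : ∀ x ∉ closedBall x₀ R, ψ x = 0)
    (hΩ : closedBall x₀ R' ⊆ Ω) (η : ContDiffBump (0 : Rn n)) (hη : η.rOut ≤ R' - R) :
    IsTestFun n Ω fun x => ∫ z, η.normed volume z * ψ (x - z) := by
  have hz : ∀ x ∉ closedBall x₀ R', (∫ z, η.normed volume z * ψ (x - z)) = 0 := fun x hx => by
    refine integral_eq_zero_of_ae (Eventually.of_forall fun z => ?_)
    by_cases h : z ∈ Function.support (η.normed (volume : Measure (Rn n)))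
    · rw [η.support_normed_eq, mem_ball_zero_iff] at h
      have : x - z ∉ closedBall x₀ R := fun h' => hx <| by
        rw [mem_closedBall, dist_eq_norm] at *
        calc ‖x - x₀‖ = ‖(x - z - x₀) + z‖ := by congr 1; abel
          _ ≤ ‖x - z - x₀‖ + ‖z‖ := norm_add_le _ _
          _ ≤ R' := by linarith
      simp [hsupp _ this]
    · simp [Function.notMem_support.1 h]
  have hcl : tsupport (fun x => ∫ z, η.normed volume z * ψ (x - z)) ⊆ closedBall x₀ R' := by
    refine closure_minimal (fun x hx => ?_) isClosed_closedBall
    by_contra h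
    exact hx (hz x h)
  refine ⟨?_, ?_, hcl.trans hΩ⟩
  · have := (η.hasCompactSupport_normed (μ := volume)).contDiff_convolution_left (μ := volume) (n := ⊤)
      (ContinuousLinearMap.lsmul ℝ ℝ) η.contDiff_normed
      (memLp_one_iff_integrable.1 (memLp_of_bounded_support hψ hB hsupp 1)).locallyIntegrable
    exact this
  · exact (isCompact_closedBall x₀ R').of_isClosed_subset (isClosed_tsupport _) hcl

/-- Bounded functions of finite energy supported well inside `Ω` are admissible test functions. -/
lemma form_eq_of_energy (hs : 0 < s) (hp : 1 < p) (hΛ : 1 ≤ Λ) (hK : KernelBounds n Λ s p K)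
    (hΦ : PhiBounds Λ p Φ) {Ω : Set (Rn n)} {u f : Rn n → ℝ} (hu : Measurable u)
    (hgu : gagliardo n s p univ u < ⊤) (hf : Continuous f) (hfc : HasCompactSupport f)
    (hw : ∀ φ : Rn n → ℝ, IsTestFun n Ω φ → nonlocalForm n Φ K u φ = ∫ x : Rn n, φ x * f x)
    {ψ : Rn n → ℝ} (hψ : Measurable ψ) {B : ℝ} (hB : ∀ x, |ψ x| ≤ B) {x₀ : Rn n} {R R' : ℝ}
    (hR : R < R') (hsupp : ∀ x ∉ closedBall x₀ R, ψ x = 0) (hΩ : closedBall x₀ R' ⊆ Ω)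
    (hgψ : gagliardo n s p univ ψ < ⊤) :
    Integrable (fun w : Rn n × Rn n => Φ (u w.1 - u w.2) * (ψ w.1 - ψ w.2) * K w.1 w.2) ∧
      ∫ w : Rn n × Rn n, Φ (u w.1 - u w.2) * (ψ w.1 - ψ w.2) * K w.1 w.2 =
        ∫ x, ψ x * f x := by
  obtain ⟨q, hpq⟩ : ∃ q, p.HolderConjugate q := ⟨_, Real.HolderConjugate.conjExponent hp⟩
  set a := ((n : ℝ) + s * p) / p with ha
  have ha' : -((n : ℝ) + s * p) / p = -a := by rw [ha]; ring
  set P : (Rn n → ℝ) → Rn n × Rn n → ℝ := fun v w => (v w.1 - v w.2) * ‖w.1 - w.2‖ ^ (-a) with hPdef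
  set Q : Rn n × Rn n → ℝ := fun w => Φ (u w.1 - u w.2) * K w.1 w.2 * ‖w.1 - w.2‖ ^ a with hQdef
  have hQ : MemLp Q (ENNReal.ofReal q) (volume.prod volume) :=
    memLp_flux hs hΛ hpq hK hΦ hu hgu
  have hP : MemLp (P ψ) (ENNReal.ofReal p) (volume.prod volume) := by
    have := memLp_quotient hp hψ hgψ
    rwa [ha'] at this
  have hQP : ∀ (v : Rn n → ℝ) w, Q w * P v w =
      Φ (u w.1 - u w.2) * (v w.1 - v w.2) * K w.1 w.2 := fun v w => by
    rcases eq_or_ne w.1 w.2 with e | e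
    · simp [hPdef, e]
    · have hd : 0 < ‖w.1 - w.2‖ := norm_pos_iff.2 (sub_ne_zero.2 e)
      have : ‖w.1 - w.2‖ ^ a * ‖w.1 - w.2‖ ^ (-a) = 1 := by
        rw [← Real.rpow_add hd]; simp
      simp only [hPdef, hQdef]
      linear_combination Φ (u w.1 - u w.2) * (v w.1 - v w.2) * K w.1 w.2 * this
  have : Fact (1 ≤ ENNReal.ofReal p) := ⟨by simpa using hp.le⟩
  have : ENNReal.HolderTriple (ENNReal.ofReal q) (ENNReal.ofReal p) 1 :=
    (Real.HolderConjugate.ennrealOfReal hpq).symm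
  have hi : Integrable (fun w => Q w * P ψ w) (volume.prod volume) :=
    memLp_one_iff_integrable.1 (hP.smul hQ)
  have hint : Integrable (fun w : Rn n × Rn n =>
      Φ (u w.1 - u w.2) * (ψ w.1 - ψ w.2) * K w.1 w.2) := by
    simp only [hQP] at hi
    exact hi
  refine ⟨hint, ?_⟩
  have hψL : MemLp ψ (ENNReal.ofReal p) := memLp_of_bounded_support hψ hB hsupp _
  have hfL : MemLp f (ENNReal.ofReal q) := hf.memLp_of_hasCompactSupport hfc
  have hψi : Integrable ψ := memLp_one_iff_integrable.1 (memLp_of_bounded_support hψ hB hsupp 1)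
  have hL : Continuous fun z : Rn n => ((z, z) : Rn n × Rn n) := by fun_prop
  refine eq_of_abs_sub_le_all fun θ hθ => ?_
  obtain ⟨ε₁, hε₁, h₁⟩ := exists_mollify_close hpq hP hQ hL (by simp) (half_pos hθ)
  obtain ⟨ε₂, hε₂, h₂⟩ := exists_mollify_close hpq hψL hfL (L := fun z => z) continuous_id rfl
    (half_pos hθ)
  set ε := min (R' - R) (min ε₁ ε₂)
  have hε : 0 < ε := lt_min (by linarith) (lt_min hε₁ hε₂)
  let η : ContDiffBump (0 : Rn n) := ⟨ε / 2, ε, half_pos hε, half_lt_self hε⟩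
  have hη : η.rOut = ε := rfl
  have k₁ := h₁ η (hη.le.trans ((min_le_right _ _).trans (min_le_left _ _)))
  have k₂ := h₂ η (hη.le.trans ((min_le_right _ _).trans (min_le_right _ _)))
  have hφ := isTestFun_mollify hψ hB hsupp hΩ η (hη.le.trans (min_le_left _ _))
  have hform := hw _ hφ
  have hηi : Integrable (η.normed volume) := η.integrable_normed
  have hint2 : ∀ x, Integrable fun z => η.normed volume z * ψ (x - z) := fun x =>
    hηi.mul_bdd (c := B) (hψ.comp (measurable_const.sub measurable_id)).aestronglyMeasurable
      (Eventually.of_forall fun z => by simpa using hB (x - z))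
  have hmoll : ∀ w : Rn n × Rn n, (∫ z, η.normed volume z * P ψ (w - (z, z))) =
      P (fun x => ∫ z, η.normed volume z * ψ (x - z)) w := fun w => by
    simp only [hPdef]
    rw [← integral_sub (hint2 _) (hint2 _), ← integral_mul_const]
    refine integral_congr_ae (Eventually.of_forall fun z => ?_)
    simp only [Prod.fst_sub, Prod.snd_sub, sub_sub_sub_cancel_right]
    ring
  simp only [hmoll, hQP] at k₁
  have hint3 := (integrable_mollify hpq hP hQ hL hηi).integral_prod_right
  simp only [mul_left_comm _ (Q _), integral_const_mul, hmoll, hQP] at hint3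
  rw [integral_prod _ hint3] at k₁
  have e3 : nonlocalForm n Φ K u (fun x => ∫ z, η.normed volume z * ψ (x - z)) =
    ∫ x, ∫ y, Φ (u x - u y) * ((∫ z, η.normed volume z * ψ (x - z)) -
      ∫ z, η.normed volume z * ψ (y - z)) * K x y := rfl
  rw [← e3, hform] at k₁
  have e4 : ∀ g : Rn n → ℝ, (∫ x, g x * f x) = ∫ x, f x * g x := fun g => by simp only [mul_comm]
  rw [e4] at k₁
  rw [e4]
  rw [Measure.volume_eq_prod]
  rw [abs_le] at *
  constructor <;> linarith [k₁.1, k₁.2, k₂.1, k₂.2]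

end Test

section Trunc

/-- A bounded increasing function, concave on the positive half-line and zero elsewhere. -/
def Tt (τ t : ℝ) : ℝ := 1 - (1 + max t 0) ^ (1 - τ)

lemma tangent_rpow {τ x y : ℝ} (hτ : 1 < τ) (hx : 0 < x) (hy : 0 < y) :
    y ^ (1 - τ) + (1 - τ) * y ^ (-τ) * (x - y) ≤ x ^ (1 - τ) := by
  have hz : 0 < x / y := div_pos hx hy
  have h1 : 1 + (1 - τ) * (x / y - 1) ≤ (x / y) ^ (1 - τ) := by
    rw [Real.rpow_def_of_pos hz]
    have := Real.add_one_le_exp (Real.log (x / y) * (1 - τ))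
    have := Real.log_le_sub_one_of_pos hz
    nlinarith
  have h2 : x ^ (1 - τ) = y ^ (1 - τ) * (x / y) ^ (1 - τ) := by
    rw [← Real.mul_rpow hy.le hz.le, mul_div_cancel₀ _ hy.ne']
  have h3 : y ^ (1 - τ) = y * y ^ (-τ) := by
    rw [sub_eq_add_neg, Real.rpow_add hy, Real.rpow_one]
  rw [h2]
  refine le_trans (le_of_eq ?_) (mul_le_mul_of_nonneg_left h1 (by positivity))
  rw [h3]; field_simp

variable {τ : ℝ}

lemma Tt_of_nonpos {t : ℝ} (ht : t ≤ 0) : Tt τ t = 0 := by simp [Tt, max_eq_right ht]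

lemma Tt_mono (hτ : 1 < τ) : Monotone (Tt τ) := fun a b h => by
  unfold Tt
  have : (1 + max b 0) ^ (1 - τ) ≤ (1 + max a 0) ^ (1 - τ) :=
    Real.rpow_le_rpow_of_nonpos (by positivity) (by gcongr) (by linarith)
  linarith

lemma Tt_nonneg (hτ : 1 < τ) (t : ℝ) : 0 ≤ Tt τ t := by
  rcases le_total t 0 with h | h
  · rw [Tt_of_nonpos h]
  · rw [← Tt_of_nonpos (τ := τ) le_rfl]; exact Tt_mono hτ h

lemma Tt_le_one (t : ℝ) : Tt τ t ≤ 1 := by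
  unfold Tt
  have : 0 ≤ (1 + max t 0) ^ (1 - τ) := by positivity
  linarith

lemma Tt_concave (hτ : 1 < τ) {v w : ℝ} (hv : 0 ≤ v) (h : v ≤ w) :
    (τ - 1) * (1 + w) ^ (-τ) * (w - v) ≤ Tt τ w - Tt τ v := by
  have := tangent_rpow hτ (by linarith : 0 < 1 + v) (by linarith : 0 < 1 + w)
  unfold Tt
  rw [max_eq_left hv, max_eq_left (hv.trans h)]
  linarith

lemma Tt_lipschitz (hτ : 1 < τ) (v w : ℝ) : |Tt τ w - Tt τ v| ≤ (τ - 1) * |w - v| := by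
  wlog h : v ≤ w generalizing v w
  · rw [abs_sub_comm, abs_sub_comm w]; exact this w v (le_of_not_ge h)
  rw [abs_of_nonneg (sub_nonneg.2 (Tt_mono hτ h))]
  have hm : max v 0 ≤ max w 0 := max_le_max_right _ h
  have h1 := tangent_rpow hτ (by positivity : 0 < 1 + max w 0) (by positivity : 0 < 1 + max v 0)
  have h2 : (1 + max v 0) ^ (-τ) ≤ 1 :=
    Real.rpow_le_one_of_one_le_of_nonpos (by simp) (by linarith)
  have h3 : max w 0 - max v 0 ≤ |w - v| := (le_abs_self _).trans (abs_max_sub_max_le_abs _ _ _)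
  unfold Tt
  calc _ ≤ (τ - 1) * (1 + max v 0) ^ (-τ) * (max w 0 - max v 0) := by linarith
    _ ≤ (τ - 1) * 1 * (max w 0 - max v 0) := by gcongr
    _ ≤ _ := by rw [mul_one]; gcongr

lemma measurable_Tt : Measurable (Tt τ) := by unfold Tt; fun_prop

lemma rpow_sub_rpow_le {p x y : ℝ} (hp : 1 < p) (hx : 0 ≤ x) (hxy : x ≤ y) :
    y ^ p - x ^ p ≤ p * y ^ (p - 1) * (y - x) := by
  rcases hx.eq_or_lt with rfl | hx'
  · rcases hxy.eq_or_lt with rfl | hy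
    · simp
    · rw [Real.zero_rpow (by linarith), Real.rpow_sub_one hy.ne']
      have : 0 ≤ y ^ p := by positivity
      have e : p * (y ^ p / y) * (y - 0) = p * y ^ p := by field_simp; ring
      rw [e]; nlinarith
  have hy : 0 < y := hx'.trans_le hxy
  have h := one_add_mul_self_le_rpow_one_add (s := x / y - 1) (by have := div_pos hx' hy; linarith)
    hp.le
  rw [add_sub_cancel, Real.div_rpow hx hy.le, le_div_iff₀ (by positivity)] at h
  have e : p * y ^ (p - 1) * (y - x) = - (p * (x / y - 1)) * y ^ p := by
    rw [Real.rpow_sub_one hy.ne']; field_simp; ring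
  rw [e]; linarith

lemma young_elem {p X D ε : ℝ} (hp : 1 < p) (hX : 0 ≤ X) (hD : 0 ≤ D) (hε : 0 < ε) :
    X ^ (p - 1) * D ≤ ε * X ^ p + ε ^ (1 - p) * D ^ p := by
  rcases le_or_gt D (ε * X) with h | h
  · have : X ^ (p - 1) * D ≤ ε * X ^ p := by
      calc X ^ (p - 1) * D ≤ X ^ (p - 1) * (ε * X) := by gcongr
        _ = ε * (X ^ (p - 1) * X ^ (1 : ℝ)) := by rw [Real.rpow_one]; ring
        _ = ε * X ^ p := by rw [← Real.rpow_add' hX (by linarith)]; ring_nf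
    have : 0 ≤ ε ^ (1 - p) * D ^ p := by positivity
    linarith
  · have hXD : X ≤ ε⁻¹ * D := by rw [inv_mul_eq_div, le_div_iff₀ hε]; linarith
    have : X ^ (p - 1) * D ≤ ε ^ (1 - p) * D ^ p := by
      calc X ^ (p - 1) * D ≤ (ε⁻¹ * D) ^ (p - 1) * D :=
            mul_le_mul_of_nonneg_right (Real.rpow_le_rpow hX hXD (by linarith)) hD
        _ = ε ^ (1 - p) * (D ^ (p - 1) * D ^ (1 : ℝ)) := by
            rw [Real.mul_rpow (by positivity) hD, Real.inv_rpow hε.le, ← Real.rpow_neg hε.le,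
              Real.rpow_one]; ring_nf
        _ = _ := by rw [← Real.rpow_add' hD (by linarith)]; ring_nf
    have : 0 ≤ ε * X ^ p := by positivity
    linarith

lemma exists_absorb {p Λ : ℝ} (hp : 1 < p) (hτ : 1 < τ) (hΛ : 1 ≤ Λ) :
    ∃ C > 0, ∀ a b k d X Y : ℝ, b ≤ a → k ≤ b → 0 < d → 0 ≤ X → X ≤ Y →
      Λ ^ 2 * (a - b) ^ (p - 1) * (Y ^ p - X ^ p) ≤
        (Λ ^ 2)⁻¹ / 2 * (a - b) ^ (p - 1) * (Tt τ ((a - k) / d) - Tt τ ((b - k) / d)) * X ^ p +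
          C * ((Y - X) ^ p * (d ^ (p - 1) * (1 + (a - k) / d) ^ (τ * (p - 1)))) := by
  set c₁ := Λ ^ 2 * (p * 2 ^ (p - 1)) with hc₁
  have hΛ0 : 0 < Λ := by linarith
  have hp0 : 0 < p := by linarith
  have hc₁p : 0 < c₁ := by positivity
  set c := (Λ ^ 2)⁻¹ / 2 / c₁ with hc
  have hcp : 0 < c := by positivity
  have hτ0 : 0 < τ - 1 := by linarith
  refine ⟨Λ ^ 2 * 2 ^ p + c₁ * (c * (τ - 1)) ^ (1 - p), by positivity, ?_⟩
  intro a b k d X Y hba hkb hd hX hXY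
  set w := (a - k) / d with hw
  have hw0 : 0 ≤ w := div_nonneg (by linarith) hd.le
  set t := a - b with ht
  have ht0 : 0 ≤ t := by linarith
  have htw : t ≤ d * w := by rw [hw, mul_div_cancel₀ _ hd.ne']; linarith
  have hY : 0 ≤ Y := hX.trans hXY
  set Δ := Y - X with hΔ
  have hΔ0 : 0 ≤ Δ := by linarith
  set M := d ^ (p - 1) * (1 + w) ^ (τ * (p - 1)) with hM
  have hM0 : 0 ≤ M := by positivity
  have hT0 : 0 ≤ Tt τ w - Tt τ ((b - k) / d) :=
    sub_nonneg.2 (Tt_mono hτ (by rw [hw]; gcongr))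
  have hTc : (τ - 1) * (1 + w) ^ (-τ) * (t / d) ≤ Tt τ w - Tt τ ((b - k) / d) := by
    have := Tt_concave hτ (v := (b - k) / d) (w := w) (div_nonneg (by linarith) hd.le)
      (by rw [hw]; gcongr)
    rwa [show w - (b - k) / d = t / d by rw [hw, ht]; ring] at this
  rcases le_or_gt Y (2 * X) with h | h
  · set m := (τ - 1) / d * (1 + w) ^ (-τ) with hm
    have hm0 : 0 < m := by positivity
    have h1 : Y ^ p - X ^ p ≤ p * 2 ^ (p - 1) * X ^ (p - 1) * Δ := by
      refine (rpow_sub_rpow_le hp hX hXY).trans ?_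
      have : Y ^ (p - 1) ≤ 2 ^ (p - 1) * X ^ (p - 1) := by
        rw [← Real.mul_rpow (by norm_num) hX]
        exact Real.rpow_le_rpow hY h (by linarith)
      calc p * Y ^ (p - 1) * (Y - X) ≤ p * (2 ^ (p - 1) * X ^ (p - 1)) * (Y - X) := by gcongr
        _ = _ := by ring
    have h2 := young_elem hp (mul_nonneg ht0 hX) hΔ0 (mul_pos hcp hm0)
    have h3 : (c * m) ^ (1 - p) = (c * (τ - 1)) ^ (1 - p) * M := by
      have : c * m = (c * (τ - 1)) * (d⁻¹ * (1 + w) ^ (-τ)) := by rw [hm]; ring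
      rw [this, Real.mul_rpow (mul_pos hcp hτ0).le (by positivity),
        Real.mul_rpow (inv_nonneg.2 hd.le) (by positivity), Real.inv_rpow hd.le,
        ← Real.rpow_neg hd.le, ← Real.rpow_mul (by positivity), hM]
      ring_nf
    have h4 : t ^ (p - 1) * (m * t) ≤ t ^ (p - 1) * (Tt τ w - Tt τ ((b - k) / d)) := by
      gcongr
      refine le_trans (le_of_eq ?_) hTc
      rw [hm]; ring
    have h5 : (t * X) ^ p = t ^ (p - 1) * t * X ^ p := by
      rw [Real.mul_rpow ht0 hX]
      congr 1
      nth_rw 3 [← Real.rpow_one t]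
      rw [← Real.rpow_add' ht0 (by linarith)]; ring_nf
    calc Λ ^ 2 * t ^ (p - 1) * (Y ^ p - X ^ p)
        ≤ Λ ^ 2 * t ^ (p - 1) * (p * 2 ^ (p - 1) * X ^ (p - 1) * Δ) := by gcongr
      _ = c₁ * ((t * X) ^ (p - 1) * Δ) := by rw [Real.mul_rpow ht0 hX]; ring
      _ ≤ c₁ * (c * m * (t * X) ^ p + (c * m) ^ (1 - p) * Δ ^ p) := by gcongr
      _ = c₁ * c * (t ^ (p - 1) * (m * t)) * X ^ p +
          c₁ * (c * (τ - 1)) ^ (1 - p) * (Δ ^ p * M) := by rw [h5, h3]; ring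
      _ ≤ c₁ * c * (t ^ (p - 1) * (Tt τ w - Tt τ ((b - k) / d))) * X ^ p +
          (Λ ^ 2 * 2 ^ p + c₁ * (c * (τ - 1)) ^ (1 - p)) * (Δ ^ p * M) := by
          gcongr
          have : 0 < Λ ^ 2 * 2 ^ p := by positivity
          linarith
      _ = _ := by
          have : c₁ * c = (Λ ^ 2)⁻¹ / 2 := by rw [hc]; field_simp
          rw [this]; ring
  · have h1 : Y ^ p - X ^ p ≤ 2 ^ p * Δ ^ p := by
      rw [← Real.mul_rpow (by norm_num) hΔ0]
      have : Y ^ p ≤ (2 * Δ) ^ p := Real.rpow_le_rpow hY (by linarith) hp0.le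
      have : 0 ≤ X ^ p := by positivity
      linarith
    have h2 : t ^ (p - 1) ≤ M := by
      have h3 : t ^ (p - 1) ≤ (d * w) ^ (p - 1) := Real.rpow_le_rpow ht0 htw (by linarith)
      rw [Real.mul_rpow hd.le hw0] at h3
      refine h3.trans ?_
      rw [hM]
      gcongr
      calc w ^ (p - 1) ≤ (1 + w) ^ (p - 1) := Real.rpow_le_rpow hw0 (by linarith) (by linarith)
        _ ≤ _ := Real.rpow_le_rpow_of_exponent_le (by linarith) (by nlinarith)
    have h6 : 0 ≤ Y ^ p - X ^ p := sub_nonneg.2 (Real.rpow_le_rpow hX hXY hp0.le)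
    calc Λ ^ 2 * t ^ (p - 1) * (Y ^ p - X ^ p) ≤ Λ ^ 2 * M * (2 ^ p * Δ ^ p) := by gcongr
      _ = Λ ^ 2 * 2 ^ p * (Δ ^ p * M) := by ring
      _ ≤ (Λ ^ 2 * 2 ^ p + c₁ * (c * (τ - 1)) ^ (1 - p)) * (Δ ^ p * M) := by
          gcongr
          have : 0 < c₁ * (c * (τ - 1)) ^ (1 - p) := by positivity
          linarith
      _ ≤ _ := by
          have : 0 ≤ (Λ ^ 2)⁻¹ / 2 * t ^ (p - 1) * (Tt τ w - Tt τ ((b - k) / d)) * X ^ p := by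
            positivity
          linarith

end Trunc

section Cutoff

variable {n : ℕ} {s p : ℝ}

/-- A Lipschitz cutoff equal to `1` on `ball x₀ ρ` and supported in the ball of radius
`(ρ + R) / 2`. -/
def cutoff (x₀ : Rn n) (ρ R : ℝ) (x : Rn n) : ℝ :=
  max 0 (min 1 (((ρ + R) / 2 - ‖x - x₀‖) / ((R - ρ) / 2)))

variable {x₀ : Rn n} {ρ R : ℝ}

lemma cutoff_nonneg (x : Rn n) : 0 ≤ cutoff x₀ ρ R x := le_max_left _ _

lemma cutoff_le_one (x : Rn n) : cutoff x₀ ρ R x ≤ 1 :=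
  max_le zero_le_one (min_le_left _ _)

lemma cutoff_eq_one (h : ρ < R) {x : Rn n} (hx : x ∈ ball x₀ ρ) : cutoff x₀ ρ R x = 1 := by
  rw [mem_ball, dist_eq_norm] at hx
  have : 1 ≤ ((ρ + R) / 2 - ‖x - x₀‖) / ((R - ρ) / 2) := by
    rw [le_div_iff₀ (by linarith)]; linarith
  simp [cutoff, min_eq_left this]

lemma cutoff_eq_zero (h : ρ < R) {x : Rn n} (hx : (ρ + R) / 2 ≤ ‖x - x₀‖) :
    cutoff x₀ ρ R x = 0 := by
  have : ((ρ + R) / 2 - ‖x - x₀‖) / ((R - ρ) / 2) ≤ 0 :=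
    div_nonpos_of_nonpos_of_nonneg (by linarith) (by linarith)
  exact max_eq_left ((min_le_right _ _).trans this)

lemma measurable_cutoff : Measurable (cutoff x₀ ρ R) := by unfold cutoff; fun_prop

lemma abs_cutoff_sub_le (h : ρ < R) (x y : Rn n) :
    |cutoff x₀ ρ R x - cutoff x₀ ρ R y| ≤ 2 / (R - ρ) * ‖x - y‖ := by
  have hd : 0 < (R - ρ) / 2 := by linarith
  unfold cutoff
  refine (abs_max_sub_max_le_max _ _ _ _).trans (max_le (by simp; positivity) ?_)
  refine (abs_min_sub_min_le_max _ _ _ _).trans (max_le (by simp; positivity) ?_)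
  rw [← sub_div, abs_div, abs_of_pos hd, div_le_iff₀ hd, sub_sub_sub_cancel_left]
  have e : 2 / (R - ρ) * ‖x - y‖ * ((R - ρ) / 2) = ‖x - y‖ := by
    have : R - ρ ≠ 0 := by linarith
    field_simp
  rw [e]
  refine (abs_norm_sub_norm_le _ _).trans (le_of_eq ?_)
  rw [norm_sub_rev]; congr 1; abel

lemma exists_cutoff_energy (hn : 2 ≤ n) (hs : 0 < s) (hs1 : s < 1) (hp : 1 < p) :
    ∃ C > 0, ∀ (x₀ : Rn n) (ρ R : ℝ), 0 < ρ → ρ < R → ∀ x : Rn n,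
      ∫⁻ y, ENNReal.ofReal (|cutoff x₀ ρ R x - cutoff x₀ ρ R y| ^ p *
        ‖x - y‖ ^ (-((n : ℝ) + s * p))) ≤
      ENNReal.ofReal (C * (R / (R - ρ)) ^ p * R ^ (-(s * p))) := by
  obtain ⟨C₁, hC₁, h₁⟩ := exists_lintegral_ball_norm_rpow hn (a := (n : ℝ) + s * p - p)
    (by nlinarith)
  obtain ⟨C₂, hC₂, h₂⟩ := exists_lintegral_compl_ball_norm_rpow (n := n) (a := (n : ℝ) + s * p)
    (by nlinarith)
  refine ⟨2 ^ p * C₁ + C₂, by positivity, fun x₀ ρ R hρ hR x => ?_⟩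
  have hR0 : 0 < R := hρ.trans hR
  have hd : 0 < R - ρ := by linarith
  rw [← lintegral_add_compl _ (measurableSet_ball (x := x) (ε := R))]
  have b1 : ∫⁻ y in ball x R, ENNReal.ofReal (|cutoff x₀ ρ R x - cutoff x₀ ρ R y| ^ p *
      ‖x - y‖ ^ (-((n : ℝ) + s * p))) ≤
      ENNReal.ofReal (2 ^ p * C₁ * (R / (R - ρ)) ^ p * R ^ (-(s * p))) := by
    calc _ ≤ ∫⁻ y in ball x R, ENNReal.ofReal ((2 / (R - ρ)) ^ p) *
          ENNReal.ofReal (‖x - y‖ ^ (-((n : ℝ) + s * p - p))) := by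
          refine lintegral_mono fun y => ?_
          rw [← ENNReal.ofReal_mul (by positivity)]
          refine ENNReal.ofReal_le_ofReal ?_
          rcases eq_or_ne x y with rfl | hxy
          · rw [sub_self, abs_zero, Real.zero_rpow (by linarith), zero_mul]; positivity
          have hpos : 0 < ‖x - y‖ := norm_pos_iff.2 (sub_ne_zero.2 hxy)
          calc _ ≤ (2 / (R - ρ) * ‖x - y‖) ^ p * ‖x - y‖ ^ (-((n : ℝ) + s * p)) := by
                gcongr
                exact abs_cutoff_sub_le hR x y
            _ = _ := by
                rw [Real.mul_rpow (by positivity) hpos.le, mul_assoc, ← Real.rpow_add hpos]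
                ring_nf
      _ ≤ ENNReal.ofReal ((2 / (R - ρ)) ^ p) *
          ENNReal.ofReal (C₁ * R ^ ((n : ℝ) - ((n : ℝ) + s * p - p))) := by
          rw [lintegral_const_mul' _ _ ENNReal.ofReal_ne_top]
          gcongr
          exact h₁ x R hR0
      _ = _ := by
          rw [← ENNReal.ofReal_mul (by positivity)]
          congr 1
          rw [Real.div_rpow (by norm_num) hd.le, Real.div_rpow hR0.le hd.le,
            show (n : ℝ) - ((n : ℝ) + s * p - p) = p + -(s * p) by ring, Real.rpow_add hR0]
          ring
  have b2 : ∫⁻ y in (ball x R)ᶜ, ENNReal.ofReal (|cutoff x₀ ρ R x - cutoff x₀ ρ R y| ^ p *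
      ‖x - y‖ ^ (-((n : ℝ) + s * p))) ≤
      ENNReal.ofReal (C₂ * (R / (R - ρ)) ^ p * R ^ (-(s * p))) := by
    calc _ ≤ ∫⁻ y in (ball x R)ᶜ, ENNReal.ofReal (‖x - y‖ ^ (-((n : ℝ) + s * p))) := by
          refine lintegral_mono fun y => ENNReal.ofReal_le_ofReal ?_
          refine mul_le_of_le_one_left (by positivity) ?_
          refine Real.rpow_le_one (abs_nonneg _) ?_ (by linarith)
          rw [abs_le]
          have h1 := cutoff_nonneg (x₀ := x₀) (ρ := ρ) (R := R) x
          have h2 := cutoff_nonneg (x₀ := x₀) (ρ := ρ) (R := R) y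
          have h3 := cutoff_le_one (x₀ := x₀) (ρ := ρ) (R := R) x
          have h4 := cutoff_le_one (x₀ := x₀) (ρ := ρ) (R := R) y
          constructor <;> linarith
      _ ≤ ENNReal.ofReal (C₂ * R ^ ((n : ℝ) - ((n : ℝ) + s * p))) := h₂ x R hR0
      _ ≤ _ := by
          refine ENNReal.ofReal_le_ofReal ?_
          rw [show (n : ℝ) - ((n : ℝ) + s * p) = -(s * p) by ring]
          gcongr
          refine le_mul_of_one_le_right hC₂.le (Real.one_le_rpow ?_ (by linarith))
          rw [one_le_div hd]; linarith
  refine (add_le_add b1 b2).trans (le_of_eq ?_)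
  rw [← ENNReal.ofReal_add (by positivity) (by positivity)]
  ring_nf

lemma lintegral_lintegral_le_of_symm {F : Rn n → Rn n → ℝ≥0∞}
    (hF : Measurable fun w : Rn n × Rn n => F w.1 w.2) (hsymm : ∀ x y, F x y = F y x)
    {S : Set (Rn n)} (hS : MeasurableSet S) (hz : ∀ x y, x ∉ S → y ∉ S → F x y = 0) {c : ℝ≥0∞}
    (hc : ∀ x, ∫⁻ y, F x y ≤ c) : ∫⁻ x, ∫⁻ y, F x y ≤ 2 * (c * volume S) := by
  have hS' : MeasurableSet {w : Rn n × Rn n | w.2 ∈ S} := measurable_snd hS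
  have h1 : ∫⁻ x in S, ∫⁻ y, F x y ≤ c * volume S := by
    rw [← setLIntegral_const]
    exact lintegral_mono fun x => hc x
  have h2 : ∫⁻ x in Sᶜ, ∫⁻ y, F x y ≤ ∫⁻ x, ∫⁻ y in S, F x y := by
    calc ∫⁻ x in Sᶜ, ∫⁻ y, F x y = ∫⁻ x in Sᶜ, ∫⁻ y in S, F x y := by
          refine setLIntegral_congr_fun hS.compl fun x hx => ?_
          rw [← lintegral_indicator hS]
          refine lintegral_congr fun y => ?_
          by_cases hy : y ∈ S
          · rw [indicator_of_mem hy]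
          · rw [indicator_of_notMem hy, hz x y hx hy]
      _ ≤ _ := setLIntegral_le_lintegral _ _
  have h3 : ∫⁻ x, ∫⁻ y in S, F x y = ∫⁻ y in S, ∫⁻ x, F x y :=
    lintegral_lintegral_swap hF.aemeasurable
  rw [← lintegral_add_compl _ hS, two_mul]
  refine add_le_add h1 (h2.trans ?_)
  rw [h3]
  refine le_trans (le_of_eq ?_) h1
  refine lintegral_congr fun y => lintegral_congr fun x => hsymm _ _

/-- The truncation test function has finite energy. -/
lemma gagliardo_test_lt_top (hn : 2 ≤ n) (hs : 0 < s) (hs1 : s < 1) (hp : 1 < p) {τ : ℝ}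
    (hτ : 1 < τ) {u : Rn n → ℝ} (hgu : gagliardo n s p univ u < ⊤)
    (hρ : 0 < ρ) (hR : ρ < R) (k : ℝ) {d : ℝ} (hd : 0 < d) :
    gagliardo n s p univ (fun x => Tt τ ((u x - k) / d) * cutoff x₀ ρ R x ^ p) < ⊤ := by
  obtain ⟨C, hC, h⟩ := exists_cutoff_energy (n := n) hn hs hs1 hp
  have hmc := measurable_cutoff (x₀ := x₀) (ρ := ρ) (R := R)
  set η := cutoff x₀ ρ R with hη
  have hpt : ∀ x y, |Tt τ ((u x - k) / d) * η x ^ p - Tt τ ((u y - k) / d) * η y ^ p| ^ p /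
      ‖x - y‖ ^ ((n : ℝ) + s * p) ≤
      (2 * ((τ - 1) / d)) ^ p * (|u x - u y| ^ p / ‖x - y‖ ^ ((n : ℝ) + s * p)) +
      (2 * p) ^ p * (|η x - η y| ^ p * ‖x - y‖ ^ (-((n : ℝ) + s * p))) := by
    intro x y
    have h1 : |Tt τ ((u x - k) / d) * η x ^ p - Tt τ ((u y - k) / d) * η y ^ p| ≤
        (τ - 1) / d * |u x - u y| + p * |η x - η y| := by
      have e : Tt τ ((u x - k) / d) * η x ^ p - Tt τ ((u y - k) / d) * η y ^ p =
        (Tt τ ((u x - k) / d) - Tt τ ((u y - k) / d)) * η x ^ p +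
          Tt τ ((u y - k) / d) * (η x ^ p - η y ^ p) := by ring
      rw [e]
      refine (abs_add_le _ _).trans (add_le_add ?_ ?_)
      · rw [abs_mul, abs_of_nonneg (Real.rpow_nonneg (cutoff_nonneg x) p)]
        have a1 := Tt_lipschitz hτ ((u y - k) / d) ((u x - k) / d)
        rw [← sub_div, abs_div, abs_of_pos hd, sub_sub_sub_cancel_right] at a1
        have a2 : η x ^ p ≤ 1 :=
          Real.rpow_le_one (cutoff_nonneg x) (cutoff_le_one x) (by linarith)
        have a3 : 0 ≤ (τ - 1) * (|u x - u y| / d) := mul_nonneg (by linarith) (by positivity)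
        refine (mul_le_mul a1 a2 (Real.rpow_nonneg (cutoff_nonneg x) p) a3).trans (le_of_eq ?_)
        ring
      · rw [abs_mul, abs_of_nonneg (Tt_nonneg hτ _)]
        refine (mul_le_of_le_one_left (abs_nonneg _) (Tt_le_one _)).trans ?_
        have aux : ∀ a b : ℝ, 0 ≤ a → a ≤ b → b ≤ 1 → b ^ p - a ^ p ≤ p * (b - a) :=
          fun a b ha hab hb => (rpow_sub_rpow_le hp ha hab).trans <| by
            have : b ^ (p - 1) ≤ 1 := Real.rpow_le_one (ha.trans hab) hb (by linarith)
            have : p * b ^ (p - 1) * (b - a) ≤ p * 1 * (b - a) := by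
              gcongr
            linarith
        rcases le_total (η x) (η y) with hxy | hxy
        · rw [abs_sub_comm, abs_sub_comm (η x), abs_of_nonneg (sub_nonneg.2 hxy), abs_of_nonneg
            (sub_nonneg.2 (Real.rpow_le_rpow (cutoff_nonneg x) hxy (by linarith)))]
          exact aux _ _ (cutoff_nonneg x) hxy (cutoff_le_one y)
        · rw [abs_of_nonneg (sub_nonneg.2 hxy), abs_of_nonneg
            (sub_nonneg.2 (Real.rpow_le_rpow (cutoff_nonneg y) hxy (by linarith)))]
          exact aux _ _ (cutoff_nonneg y) hxy (cutoff_le_one x)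
    have h2 : ∀ a b : ℝ, 0 ≤ a → 0 ≤ b → (a + b) ^ p ≤ (2 * a) ^ p + (2 * b) ^ p := by
      intro a b ha hb
      rcases le_total a b with hab | hab
      · have : (a + b) ^ p ≤ (2 * b) ^ p := Real.rpow_le_rpow (by linarith) (by linarith)
          (by linarith)
        have : 0 ≤ (2 * a) ^ p := by positivity
        linarith
      · have : (a + b) ^ p ≤ (2 * a) ^ p := Real.rpow_le_rpow (by linarith) (by linarith)
          (by linarith)
        have : 0 ≤ (2 * b) ^ p := by positivity
        linarith
    have hc : 0 ≤ (τ - 1) / d := div_nonneg (by linarith) hd.le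
    have h3 := (Real.rpow_le_rpow (abs_nonneg _) h1 (by linarith : (0 : ℝ) ≤ p)).trans
      (h2 _ _ (by positivity) (by positivity))
    rw [← mul_assoc, ← mul_assoc, Real.mul_rpow (by positivity) (abs_nonneg _),
      Real.mul_rpow (by positivity) (abs_nonneg _)] at h3
    rw [Real.rpow_neg (norm_nonneg _)]
    refine (div_le_div_of_nonneg_right h3 (by positivity)).trans (le_of_eq ?_)
    ring
  have hm3 : Measurable (fun w : Rn n × Rn n =>
      ENNReal.ofReal (|η w.1 - η w.2| ^ p * ‖w.1 - w.2‖ ^ (-((n : ℝ) + s * p)))) := by fun_prop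
  have hE : ∫⁻ x, ∫⁻ y, ENNReal.ofReal (|η x - η y| ^ p * ‖x - y‖ ^ (-((n : ℝ) + s * p))) < ⊤ := by
    refine lt_of_le_of_lt (lintegral_lintegral_le_of_symm (S := ball x₀ R) hm3 (fun x y => ?_)
      measurableSet_ball (fun x y hx hy => ?_) (fun x => h x₀ ρ R hρ hR x)) ?_
    · rw [abs_sub_comm, norm_sub_rev]
    · rw [mem_ball, dist_eq_norm, not_lt] at hx hy
      rw [hη, cutoff_eq_zero hR (x := x) (by linarith), cutoff_eq_zero hR (x := y) (by linarith)]
      simp [Real.zero_rpow (by linarith : p ≠ 0)]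
    · exact ENNReal.mul_lt_top (by simp) (ENNReal.mul_lt_top ENNReal.ofReal_lt_top
        measure_ball_lt_top)
  have hc : 0 ≤ (τ - 1) / d := div_nonneg (by linarith) hd.le
  simp only [gagliardo, Measure.restrict_univ] at hgu ⊢
  calc _ ≤ ∫⁻ x, ∫⁻ y, (ENNReal.ofReal ((2 * ((τ - 1) / d)) ^ p) *
        ENNReal.ofReal (|u x - u y| ^ p / ‖x - y‖ ^ ((n : ℝ) + s * p)) +
        ENNReal.ofReal ((2 * p) ^ p) *
        ENNReal.ofReal (|η x - η y| ^ p * ‖x - y‖ ^ (-((n : ℝ) + s * p)))) := by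
        refine lintegral_mono fun x => lintegral_mono fun y => ?_
        rw [← ENNReal.ofReal_mul (by positivity), ← ENNReal.ofReal_mul (by positivity),
          ← ENNReal.ofReal_add (by positivity) (by positivity)]
        exact ENNReal.ofReal_le_ofReal (hpt x y)
    _ = ENNReal.ofReal ((2 * ((τ - 1) / d)) ^ p) * (∫⁻ x, ∫⁻ y,
        ENNReal.ofReal (|u x - u y| ^ p / ‖x - y‖ ^ ((n : ℝ) + s * p))) +
        ENNReal.ofReal ((2 * p) ^ p) * ∫⁻ x, ∫⁻ y,
        ENNReal.ofReal (|η x - η y| ^ p * ‖x - y‖ ^ (-((n : ℝ) + s * p))) := by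
        rw [← lintegral_const_mul' _ _ ENNReal.ofReal_ne_top,
          ← lintegral_const_mul' _ _ ENNReal.ofReal_ne_top, ← lintegral_add_right]
        · refine lintegral_congr fun x => ?_
          rw [← lintegral_const_mul' _ _ ENNReal.ofReal_ne_top,
            ← lintegral_const_mul' _ _ ENNReal.ofReal_ne_top, ← lintegral_add_right]
          exact (hm3.comp measurable_prodMk_left).const_mul _
        · exact (Measurable.lintegral_prod_right' hm3).const_mul _
    _ < ⊤ := ENNReal.add_lt_top.2 ⟨ENNReal.mul_lt_top ENNReal.ofReal_lt_top hgu,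
        ENNReal.mul_lt_top ENNReal.ofReal_lt_top hE⟩

end Cutoff

section Caccioppoli

variable {n : ℕ} {s p τ γ C Λ : ℝ}

/-- Truncated energy inequality for superlevel sets of `u` on balls centred at `x₀` of radius at
most `r`, with datum of total mass `δ`. -/
def Cacc (n : ℕ) (s p τ γ C : ℝ) (u : Rn n → ℝ) (x₀ : Rn n) (r : ℝ) (δ : ℝ≥0∞) : Prop :=
  ∀ k d ρ R : ℝ, 0 < d → 0 < ρ → ρ < R → R ≤ r →
    ∫⁻ x in ball x₀ ρ, ∫⁻ y, ENNReal.ofReal (max (u x - u y) 0 ^ (p - 1) *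
        (Tt τ ((u x - k) / d) - Tt τ ((u y - k) / d)) * ‖x - y‖ ^ (-((n : ℝ) + s * p))) ≤
      ENNReal.ofReal (C * (R / (R - ρ)) ^ ((n : ℝ) + s * p + p)) *
        (ENNReal.ofReal (R ^ (-(s * p)) * d ^ (p - 1)) *
            (∫⁻ x in ball x₀ R ∩ {x | k < u x}, ENNReal.ofReal ((1 + (u x - k) / d) ^ γ)) +
          volume (ball x₀ R ∩ {x | k < u x}) *
            (∫⁻ y in (ball x₀ R)ᶜ, ENNReal.ofReal (max (u y - k) 0 ^ (p - 1) *
              ‖y - x₀‖ ^ (-((n : ℝ) + s * p)))) + δ)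

lemma form_pair_lower (hΛ : 1 ≤ Λ) {A B X Y F κ K bad t : ℝ}
    (hF : t / Λ ≤ F) (hF' : F ≤ Λ * t) (ht : 0 ≤ t) (hκ : 0 ≤ κ) (hK : Λ⁻¹ * κ ≤ K)
    (hK' : K ≤ Λ * κ) (hB : 0 ≤ B) (hB1 : B ≤ 1) (hAB : B ≤ A) (hX : 0 ≤ X) (hbad : 0 ≤ bad)
    (h : 0 < B → X < Y → Λ ^ 2 * t * (Y - X) ≤ (Λ ^ 2)⁻¹ / 2 * t * (A - B) * X + bad) :
    κ * ((Λ ^ 2)⁻¹ / 2 * t * (A - B) * X) ≤ F * (A * X - B * Y) * K + κ * bad := by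
  have hΛ0 : 0 < Λ := by linarith
  have hF0 : 0 ≤ F := le_trans (by positivity) hF
  have hK0 : 0 ≤ K := le_trans (by positivity) hK
  have hlo : (Λ ^ 2)⁻¹ * t * κ ≤ F * K := by
    calc (Λ ^ 2)⁻¹ * t * κ = (t / Λ) * (Λ⁻¹ * κ) := by field_simp
      _ ≤ F * K := by gcongr
  have hhi : F * K ≤ Λ ^ 2 * t * κ := by
    calc F * K ≤ (Λ * t) * (Λ * κ) := by gcongr
      _ = _ := by ring
  have hG : 0 ≤ (A - B) * X := mul_nonneg (by linarith) hX
  have hloG : (Λ ^ 2)⁻¹ * t * κ * ((A - B) * X) ≤ F * K * ((A - B) * X) :=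
    mul_le_mul_of_nonneg_right hlo hG
  have hpos : 0 ≤ (Λ ^ 2)⁻¹ * t * κ * ((A - B) * X) := by positivity
  have hκb : 0 ≤ κ * bad := by positivity
  have hFK : 0 ≤ F * K := by positivity
  by_cases hc : 0 < B ∧ X < Y
  · have h1 := h hc.1 hc.2
    have h2 : F * K * (B * (Y - X)) ≤ κ * (Λ ^ 2 * t * (Y - X)) := by
      have : B * (Y - X) ≤ 1 * (Y - X) := mul_le_mul_of_nonneg_right hB1 (by linarith [hc.2])
      have h3 : 0 ≤ Y - X := by linarith [hc.2]
      calc F * K * (B * (Y - X)) ≤ F * K * (1 * (Y - X)) := by gcongr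
        _ ≤ Λ ^ 2 * t * κ * (1 * (Y - X)) := by gcongr
        _ = _ := by ring
    have h4 := mul_le_mul_of_nonneg_left h1 hκ
    nlinarith
  · have h5 : 0 ≤ F * K * (B * (X - Y)) := by
      refine mul_nonneg hFK ?_
      rcases hB.eq_or_lt with e | e
      · rw [← e]; simp
      · exact mul_nonneg hB (by
          have := fun h' => hc ⟨e, h'⟩
          linarith [not_lt.1 this])
    nlinarith

lemma lintegral_ofReal_le_of_le_add {α : Type*} [MeasurableSpace α] {μ : Measure α}
    {G I B : α → ℝ} (hI : Integrable I μ) (hB : Measurable B) (hB0 : ∀ x, 0 ≤ B x)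
    (hG0 : ∀ x, 0 ≤ G x) (h : ∀ x, G x ≤ I x + B x) :
    ∫⁻ x, ENNReal.ofReal (G x) ∂μ ≤
      ENNReal.ofReal (∫ x, I x ∂μ) + ∫⁻ x, ENNReal.ofReal (B x) ∂μ := by
  rcases eq_or_ne (∫⁻ x, ENNReal.ofReal (B x) ∂μ) ⊤ with e | e
  · simp [e]
  have hBi : Integrable B μ := by
    refine ⟨hB.aestronglyMeasurable, ?_⟩
    rw [hasFiniteIntegral_iff_ofReal (Eventually.of_forall hB0)]
    exact e.lt_top
  calc _ ≤ ∫⁻ x, ENNReal.ofReal (I x + B x) ∂μ :=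
        lintegral_mono fun x => ENNReal.ofReal_le_ofReal (h x)
    _ = ENNReal.ofReal (∫ x, (I x + B x) ∂μ) :=
        (ofReal_integral_eq_lintegral_ofReal (hI.add hBi)
          (Eventually.of_forall fun x => (hG0 x).trans (h x))).symm
    _ ≤ ENNReal.ofReal (∫ x, I x ∂μ) + ENNReal.ofReal (∫ x, B x ∂μ) := by
        rw [integral_add hI hBi]; exact ENNReal.ofReal_add_le
    _ = _ := by
        rw [ofReal_integral_eq_lintegral_ofReal hBi (Eventually.of_forall hB0)]

/-- The part of the error near the boundary of the cutoff. -/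
def errNear (p γ : ℝ) (u : Rn n → ℝ) (x₀ : Rn n) (k d ρ R : ℝ) (x y : Rn n) : ℝ :=
  (ball x₀ R ∩ {x | k < u x}).indicator (fun x => (d ^ (p - 1) * (1 + (u x - k) / d) ^ γ)) x *
    |cutoff x₀ ρ R x - cutoff x₀ ρ R y| ^ p

/-- The part of the error coming from far away. -/
def errFar (p : ℝ) (u : Rn n → ℝ) (x₀ : Rn n) (k ρ R : ℝ) (x y : Rn n) : ℝ :=
  (ball x₀ R)ᶜ.indicator (fun x => max (u x - k) 0 ^ (p - 1)) x *
    (ball x₀ ((ρ + R) / 2) ∩ {y | k < u y}).indicator 1 y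

variable {u : Rn n → ℝ} {x₀ : Rn n} {k d ρ R : ℝ}

lemma errNear_nonneg (hd : 0 < d) (x y : Rn n) : 0 ≤ errNear p γ u x₀ k d ρ R x y := by
  refine mul_nonneg (indicator_nonneg (fun x hx => ?_) x) (by positivity)
  have : 0 ≤ (u x - k) / d := div_nonneg (sub_nonneg.2 (le_of_lt hx.2)) hd.le
  positivity

lemma errFar_nonneg (x y : Rn n) : 0 ≤ errFar p u x₀ k ρ R x y :=
  mul_nonneg (indicator_nonneg (fun x _ => by positivity) x)
    (indicator_nonneg (fun _ _ => zero_le_one) y)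

lemma measurable_errNear (hu : Measurable u) :
    Measurable fun w : Rn n × Rn n => errNear p γ u x₀ k d ρ R w.1 w.2 := by
  have h1 : MeasurableSet {x | k < u x} := measurableSet_lt measurable_const hu
  have h2 : Measurable ((ball x₀ R ∩ {x | k < u x}).indicator
      (fun x => (d ^ (p - 1) * (1 + (u x - k) / d) ^ γ))) :=
    Measurable.indicator (by fun_prop) (measurableSet_ball.inter h1)
  have h3 := measurable_cutoff (x₀ := x₀) (ρ := ρ) (R := R)
  unfold errNear
  exact (h2.comp measurable_fst).mul (by fun_prop)

lemma measurable_errFar (hu : Measurable u) :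
    Measurable fun w : Rn n × Rn n => errFar p u x₀ k ρ R w.1 w.2 := by
  have h1 : MeasurableSet {x | k < u x} := measurableSet_lt measurable_const hu
  have h2 : Measurable ((ball x₀ R)ᶜ.indicator (fun x => max (u x - k) 0 ^ (p - 1))) :=
    Measurable.indicator (by fun_prop) measurableSet_ball.compl
  have h3 : Measurable ((ball x₀ ((ρ + R) / 2) ∩ {y | k < u y}).indicator (1 : Rn n → ℝ)) :=
    Measurable.indicator measurable_const (measurableSet_ball.inter h1)
  unfold errFar
  exact (h2.comp measurable_fst).mul (h3.comp measurable_snd)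

/-- Pointwise lower bound when `u x` is the larger value. -/
lemma exists_pointwise (hp : 1 < p) (hτ : 1 < τ) (hγ : τ * (p - 1) ≤ γ) (hΛ : 1 ≤ Λ) :
    ∃ C₁ > 0, ∀ (u : Rn n → ℝ) (x₀ : Rn n) (k d ρ R : ℝ) (x y : Rn n) (F κ K : ℝ), 0 < d →
      ρ < R → u y ≤ u x →
      (u x - u y) ^ (p - 1) / Λ ≤ F → F ≤ Λ * (u x - u y) ^ (p - 1) → 0 ≤ κ →
      Λ⁻¹ * κ ≤ K → K ≤ Λ * κ →
      κ * ((Λ ^ 2)⁻¹ / 2 * (u x - u y) ^ (p - 1) *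
          (Tt τ ((u x - k) / d) - Tt τ ((u y - k) / d)) * cutoff x₀ ρ R x ^ p) ≤
        F * (Tt τ ((u x - k) / d) * cutoff x₀ ρ R x ^ p -
          Tt τ ((u y - k) / d) * cutoff x₀ ρ R y ^ p) * K +
        κ * (C₁ * (errNear p γ u x₀ k d ρ R x y + errFar p u x₀ k ρ R x y)) := by
  obtain ⟨C₀, hC₀, h₀⟩ := exists_absorb (τ := τ) hp hτ hΛ
  have hΛ0 : 0 < Λ := by linarith
  refine ⟨C₀ + Λ ^ 2, by positivity, fun u x₀ k d ρ R x y F κ K hd hR hxy hF hF' hκ hK hK' => ?_⟩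
  have ht : 0 ≤ u x - u y := by linarith
  have hn := errNear_nonneg (p := p) (γ := γ) (u := u) (x₀ := x₀) (k := k) (ρ := ρ) (R := R) hd x y
  have hf := errFar_nonneg (p := p) (u := u) (x₀ := x₀) (k := k) (ρ := ρ) (R := R) x y
  have hX := cutoff_nonneg (x₀ := x₀) (ρ := ρ) (R := R) x
  have hY := cutoff_nonneg (x₀ := x₀) (ρ := ρ) (R := R) y
  refine form_pair_lower hΛ hF hF' (by positivity) hκ hK hK' (Tt_nonneg hτ _)
    (Tt_le_one _) (Tt_mono hτ (by gcongr)) (Real.rpow_nonneg hX p) (by positivity) fun hB hlt => ?_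
  have hky : k < u y := by
    by_contra h
    rw [Tt_of_nonpos (div_nonpos_of_nonpos_of_nonneg (by linarith) hd.le)] at hB
    exact lt_irrefl _ hB
  have hXY : cutoff x₀ ρ R x < cutoff x₀ ρ R y := by
    by_contra h
    exact absurd (Real.rpow_le_rpow hY (not_lt.1 h) (by linarith)) (not_le.2 hlt)
  by_cases hxR : x ∈ ball x₀ R
  · refine (h₀ (u x) (u y) k d _ _ hxy hky.le hd hX hXY.le).trans ?_
    refine add_le_add le_rfl ?_
    have hw : 0 ≤ (u x - k) / d := div_nonneg (by linarith) hd.le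
    have e : (cutoff x₀ ρ R y - cutoff x₀ ρ R x) ^ p *
        (d ^ (p - 1) * (1 + (u x - k) / d) ^ (τ * (p - 1))) ≤ errNear p γ u x₀ k d ρ R x y := by
      rw [errNear, indicator_of_mem (show x ∈ ball x₀ R ∩ {x | k < u x} from
        ⟨hxR, lt_of_lt_of_le hky hxy⟩), abs_sub_comm, abs_of_nonneg (by linarith), mul_comm]
      have : (1 + (u x - k) / d) ^ (τ * (p - 1)) ≤ (1 + (u x - k) / d) ^ γ :=
        Real.rpow_le_rpow_of_exponent_le (by linarith) hγ
      have : 0 ≤ cutoff x₀ ρ R y - cutoff x₀ ρ R x := by linarith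
      gcongr
    have hΛ2 : 0 < Λ ^ 2 := by positivity
    nlinarith
  · have hyR : y ∈ ball x₀ ((ρ + R) / 2) := by
      rw [mem_ball, dist_eq_norm]
      by_contra h
      rw [cutoff_eq_zero hR (not_lt.1 h)] at hXY
      linarith
    have hx0 : cutoff x₀ ρ R x = 0 := by
      rw [mem_ball, dist_eq_norm, not_lt] at hxR
      exact cutoff_eq_zero hR (by linarith)
    have e : errFar p u x₀ k ρ R x y = max (u x - k) 0 ^ (p - 1) := by
      rw [errFar, indicator_of_mem (show x ∈ (ball x₀ R)ᶜ from hxR),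
        indicator_of_mem (show y ∈ ball x₀ ((ρ + R) / 2) ∩ {y | k < u y} from ⟨hyR, hky⟩)]
      simp
    rw [hx0, Real.zero_rpow (by linarith), sub_zero, mul_zero, zero_add, e]
    have h1 : cutoff x₀ ρ R y ^ p ≤ 1 := Real.rpow_le_one hY (cutoff_le_one y) (by linarith)
    have h2 : (u x - u y) ^ (p - 1) ≤ max (u x - k) 0 ^ (p - 1) :=
      Real.rpow_le_rpow ht (le_max_of_le_left (by linarith)) (by linarith)
    have h3 : 0 ≤ max (u x - k) 0 ^ (p - 1) := by positivity
    calc Λ ^ 2 * (u x - u y) ^ (p - 1) * cutoff x₀ ρ R y ^ p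
        ≤ Λ ^ 2 * max (u x - k) 0 ^ (p - 1) * 1 := by gcongr
      _ ≤ _ := by nlinarith

end Caccioppoli

section CaccioppoliProof

variable {n : ℕ} {s p τ γ C Λ : ℝ} {Φ : ℝ → ℝ} {K : Rn n → Rn n → ℝ} {Ω : Set (Rn n)}
variable {u : Rn n → ℝ} {x₀ : Rn n} {k d ρ R : ℝ}

lemma PhiBounds.neg (hΦ : PhiBounds Λ p Φ) : PhiBounds Λ p fun t => -Φ (-t) := by
  refine ⟨(hΦ.1.comp continuous_neg).neg, by simp [hΦ.2.1], fun t => ?_⟩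
  have := hΦ.2.2 (-t)
  rw [abs_neg] at this
  constructor <;> nlinarith

lemma lintegral_errNear_le (hu : Measurable u) (hd : 0 < d)
    (h : ∀ x : Rn n, ∫⁻ y, ENNReal.ofReal (|cutoff x₀ ρ R x - cutoff x₀ ρ R y| ^ p *
        ‖x - y‖ ^ (-((n : ℝ) + s * p))) ≤ ENNReal.ofReal C) :
    ∫⁻ x, ∫⁻ y, ENNReal.ofReal (‖x - y‖ ^ (-((n : ℝ) + s * p)) * errNear p γ u x₀ k d ρ R x y) ≤
      ENNReal.ofReal C * (ENNReal.ofReal (d ^ (p - 1)) *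
        ∫⁻ x in ball x₀ R ∩ {x | k < u x}, ENNReal.ofReal ((1 + (u x - k) / d) ^ γ)) := by
  have h1 : MeasurableSet (ball x₀ R ∩ {x | k < u x}) :=
    measurableSet_ball.inter (measurableSet_lt measurable_const hu)
  have hm := measurable_cutoff (x₀ := x₀) (ρ := ρ) (R := R)
  rw [← lintegral_const_mul _ (by fun_prop), ← lintegral_const_mul _ (by fun_prop),
    ← lintegral_indicator h1]
  refine lintegral_mono fun x => ?_
  by_cases hx : x ∈ ball x₀ R ∩ {x | k < u x}
  · have h0 : 0 ≤ (u x - k) / d := div_nonneg (sub_nonneg.2 (le_of_lt hx.2)) hd.le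
    rw [indicator_of_mem hx]
    calc ∫⁻ y, ENNReal.ofReal (‖x - y‖ ^ (-((n : ℝ) + s * p)) * errNear p γ u x₀ k d ρ R x y)
        = ∫⁻ y, ENNReal.ofReal (d ^ (p - 1) * (1 + (u x - k) / d) ^ γ) *
          ENNReal.ofReal (|cutoff x₀ ρ R x - cutoff x₀ ρ R y| ^ p *
            ‖x - y‖ ^ (-((n : ℝ) + s * p))) := by
          refine lintegral_congr fun y => ?_
          rw [← ENNReal.ofReal_mul (by positivity), errNear, indicator_of_mem hx]
          ring_nf
      _ ≤ ENNReal.ofReal (d ^ (p - 1) * (1 + (u x - k) / d) ^ γ) * ENNReal.ofReal C := by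
          rw [lintegral_const_mul _ (by fun_prop)]
          gcongr
          exact h x
      _ = _ := by
          rw [ENNReal.ofReal_mul (by positivity), mul_comm]
  · rw [indicator_of_notMem hx]
    simp [errNear, indicator_of_notMem hx]

lemma lintegral_errFar_le (hs : 0 < s) (hp : 1 < p) (hu : Measurable u) (hρ : 0 < ρ)
    (hR : ρ < R) :
    ∫⁻ x, ∫⁻ y, ENNReal.ofReal (‖x - y‖ ^ (-((n : ℝ) + s * p)) * errFar p u x₀ k ρ R x y) ≤
      ENNReal.ofReal ((2 * (R / (R - ρ))) ^ ((n : ℝ) + s * p)) *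
        (volume (ball x₀ R ∩ {x | k < u x}) * ∫⁻ y in (ball x₀ R)ᶜ,
          ENNReal.ofReal (max (u y - k) 0 ^ (p - 1) * ‖y - x₀‖ ^ (-((n : ℝ) + s * p)))) := by
  have hk : MeasurableSet {x | k < u x} := measurableSet_lt measurable_const hu
  have hR0 : 0 < R := hρ.trans hR
  have hRρ : 0 < R - ρ := by linarith
  set Q := (n : ℝ) + s * p with hQ
  have hQ0 : 0 ≤ Q := by positivity
  rw [← lintegral_const_mul _ (by fun_prop), ← lintegral_const_mul _ (by fun_prop),
    ← lintegral_indicator measurableSet_ball.compl]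
  refine lintegral_mono fun x => ?_
  by_cases hx : x ∈ (ball x₀ R)ᶜ
  · have hxR : R ≤ ‖x - x₀‖ := by simpa [mem_ball, dist_eq_norm] using hx
    rw [indicator_of_mem hx]
    set S := ball x₀ ((ρ + R) / 2) ∩ {y | k < u y} with hS
    have hSm : MeasurableSet S := measurableSet_ball.inter hk
    set b := (2 * (R / (R - ρ))) ^ Q * (max (u x - k) 0 ^ (p - 1) * ‖x - x₀‖ ^ (-Q)) with hb
    calc ∫⁻ y, ENNReal.ofReal (‖x - y‖ ^ (-Q) * errFar p u x₀ k ρ R x y)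
        ≤ ∫⁻ y, S.indicator (fun _ => ENNReal.ofReal b) y := by
          refine lintegral_mono fun y => ?_
          by_cases hy : y ∈ S
          · rw [indicator_of_mem hy, errFar, indicator_of_mem hx, indicator_of_mem hy]
            refine ENNReal.ofReal_le_ofReal ?_
            have hy' : ‖y - x₀‖ < (ρ + R) / 2 := by simpa [mem_ball, dist_eq_norm] using hy.1
            have h1 : ‖x - x₀‖ * ((R - ρ) / (2 * R)) ≤ ‖x - y‖ := by
              have h2 : ‖x - x₀‖ ≤ ‖x - y‖ + ‖y - x₀‖ := norm_sub_le_norm_sub_add_norm_sub _ _ _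
              rw [mul_div_assoc', div_le_iff₀ (by positivity)]
              nlinarith
            have h3 : ‖x - y‖ ^ (-Q) ≤ (2 * (R / (R - ρ))) ^ Q * ‖x - x₀‖ ^ (-Q) := by
              have hx0 : 0 < ‖x - x₀‖ := by linarith
              calc ‖x - y‖ ^ (-Q) ≤ (‖x - x₀‖ * ((R - ρ) / (2 * R))) ^ (-Q) :=
                    Real.rpow_le_rpow_of_nonpos (by positivity) h1 (by linarith)
                _ = _ := by
                    rw [Real.mul_rpow hx0.le (by positivity), Real.rpow_neg (x := (R - ρ) / (2 * R))
                      (by positivity), ← Real.inv_rpow (by positivity), inv_div, mul_div_assoc,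
                      mul_comm]
            simp only [Pi.one_apply, mul_one, hb]
            calc _ ≤ (2 * (R / (R - ρ))) ^ Q * ‖x - x₀‖ ^ (-Q) * max (u x - k) 0 ^ (p - 1) := by
                  gcongr
              _ = _ := by ring
          · rw [hS] at hy
            simp [errFar, indicator_of_notMem hy]
      _ = ENNReal.ofReal b * volume S := by rw [lintegral_indicator_const hSm]
      _ ≤ ENNReal.ofReal b * volume (ball x₀ R ∩ {x | k < u x}) := by
          gcongr
          exact inter_subset_inter_left _ (ball_subset_ball (by linarith))
      _ = _ := by
          rw [hb, ENNReal.ofReal_mul (by positivity)]; ring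
  · rw [indicator_of_notMem hx]
    simp [errFar, indicator_of_notMem hx]

lemma ofReal_integral_mul_le {ψ f : Rn n → ℝ} {S : Set (Rn n)} (hS : MeasurableSet S)
    (h1 : ∀ x, |ψ x| ≤ 1) (h0 : ∀ x ∉ S, ψ x = 0) :
    ENNReal.ofReal (∫ x, ψ x * f x) ≤ ∫⁻ x in S, ENNReal.ofReal |f x| := by
  refine (Real.ofReal_le_enorm _).trans ((enorm_integral_le_lintegral_enorm _).trans ?_)
  rw [← lintegral_indicator hS]
  refine lintegral_mono fun x => ?_
  by_cases hx : x ∈ S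
  · rw [indicator_of_mem hx, Real.enorm_eq_ofReal_abs, abs_mul]
    exact ENNReal.ofReal_le_ofReal (mul_le_of_le_one_left (abs_nonneg _) (h1 x))
  · simp [h0 x hx]

lemma lintegral_prod_add_swap {F : Rn n → Rn n → ℝ} (hF : Measurable fun w : Rn n × Rn n => F w.1 w.2)
    (h0 : ∀ x y, 0 ≤ F x y) :
    ∫⁻ w : Rn n × Rn n, ENNReal.ofReal (F w.1 w.2 + F w.2 w.1) =
      2 * ∫⁻ x, ∫⁻ y, ENNReal.ofReal (F x y) := by
  have hF' : Measurable fun w : Rn n × Rn n => F w.2 w.1 := hF.comp measurable_swap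
  simp_rw [fun w : Rn n × Rn n => ENNReal.ofReal_add (h0 w.1 w.2) (h0 w.2 w.1)]
  rw [lintegral_add_left hF.ennreal_ofReal, Measure.volume_eq_prod,
    lintegral_prod _ hF.ennreal_ofReal.aemeasurable,
    lintegral_prod _ hF'.ennreal_ofReal.aemeasurable, two_mul]
  congr 1
  exact lintegral_lintegral_swap (f := fun x y => ENNReal.ofReal (F y x))
    hF'.ennreal_ofReal.aemeasurable

lemma exists_energy_le (hp : 1 < p) (hτ : 1 < τ) (hγ : τ * (p - 1) ≤ γ) (hΛ : 1 ≤ Λ) :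
    ∃ C₁ > 0, ∀ (Φ : ℝ → ℝ) (K : Rn n → Rn n → ℝ) (u : Rn n → ℝ) (x₀ : Rn n) (k d ρ R : ℝ),
      KernelBounds n Λ s p K → PhiBounds Λ p Φ → 0 < d → ρ < R → ∀ x y : Rn n,
      ‖x - y‖ ^ (-((n : ℝ) + s * p)) * ((Λ ^ 2)⁻¹ / 2 * max (u x - u y) 0 ^ (p - 1) *
          (Tt τ ((u x - k) / d) - Tt τ ((u y - k) / d)) * cutoff x₀ ρ R x ^ p) ≤
        Φ (u x - u y) * (Tt τ ((u x - k) / d) * cutoff x₀ ρ R x ^ p -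
          Tt τ ((u y - k) / d) * cutoff x₀ ρ R y ^ p) * K x y +
        (C₁ * (‖x - y‖ ^ (-((n : ℝ) + s * p)) *
            (errNear p γ u x₀ k d ρ R x y + errFar p u x₀ k ρ R x y)) +
          C₁ * (‖y - x‖ ^ (-((n : ℝ) + s * p)) *
            (errNear p γ u x₀ k d ρ R y x + errFar p u x₀ k ρ R y x))) := by
  obtain ⟨C₁, hC₁, h⟩ := exists_pointwise (n := n) hp hτ hγ hΛ
  refine ⟨C₁, hC₁, fun Φ K u x₀ k d ρ R hK hΦ hd hR x y => ?_⟩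
  have e1 : ∀ a b : Rn n, 0 ≤ C₁ * (‖a - b‖ ^ (-((n : ℝ) + s * p)) *
      (errNear p γ u x₀ k d ρ R a b + errFar p u x₀ k ρ R a b)) := fun a b =>
    mul_nonneg hC₁.le (mul_nonneg (by positivity)
      (add_nonneg (errNear_nonneg hd a b) (errFar_nonneg a b)))
  rcases eq_or_ne x y with rfl | hxy
  · have := e1 x x
    simp only [sub_self, mul_zero, zero_mul, zero_add, max_self] at this ⊢
    exact add_nonneg this this
  have hP : ∀ Ψ : ℝ → ℝ, PhiBounds Λ p Ψ → ∀ t, 0 ≤ t → t ^ (p - 1) / Λ ≤ Ψ t ∧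
      Ψ t ≤ Λ * t ^ (p - 1) := by
    intro Ψ hΨ t ht
    rcases ht.eq_or_lt with rfl | ht
    · simp [hΨ.2.1, Real.zero_rpow (show p - 1 ≠ 0 by linarith)]
    · refine ⟨hΨ.le_of_pos ht, (le_abs_self _).trans ?_⟩
      simpa [abs_of_pos ht] using hΨ.abs_le hΛ hp t
  rcases le_or_gt (u y) (u x) with hle | hlt
  · have h1 := hP Φ hΦ (u x - u y) (by linarith)
    have := h u x₀ k d ρ R x y _ _ (K x y) hd hR hle h1.1 h1.2
      (by positivity : (0 : ℝ) ≤ ‖x - y‖ ^ (-((n : ℝ) + s * p))) (hK.ge hxy) (hK.le hxy)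
    rw [max_eq_left (by linarith)]
    have := e1 y x
    linarith
  · have h1 := hP _ hΦ.neg (u y - u x) (by linarith)
    rw [neg_sub] at h1
    have h2 := h u x₀ k d ρ R y x _ _ (K x y) hd hR hlt.le h1.1 h1.2
      (by positivity : (0 : ℝ) ≤ ‖x - y‖ ^ (-((n : ℝ) + s * p))) (hK.ge hxy) (hK.le hxy)
    rw [max_eq_right (by linarith), Real.zero_rpow (by linarith)]
    have h3 : 0 ≤ ‖x - y‖ ^ (-((n : ℝ) + s * p)) * ((Λ ^ 2)⁻¹ / 2 * (u y - u x) ^ (p - 1) *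
        (Tt τ ((u y - k) / d) - Tt τ ((u x - k) / d)) * cutoff x₀ ρ R y ^ p) := by
      have a1 : 0 ≤ Tt τ ((u y - k) / d) - Tt τ ((u x - k) / d) :=
        sub_nonneg.2 (Tt_mono hτ (by gcongr))
      have a2 : 0 ≤ u y - u x := by linarith
      have a3 := cutoff_nonneg (x₀ := x₀) (ρ := ρ) (R := R) y
      positivity
    have h4 := e1 x y
    rw [norm_sub_rev y x]
    simp only [mul_zero, zero_mul]
    linarith

lemma lintegral_lintegral_const_mul_add {C Q : ℝ} {F G : Rn n → Rn n → ℝ} (hC : 0 ≤ C)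
    (hF : Measurable fun w : Rn n × Rn n => F w.1 w.2)
    (hG : Measurable fun w : Rn n × Rn n => G w.1 w.2) (hF0 : ∀ x y, 0 ≤ F x y)
    (hG0 : ∀ x y, 0 ≤ G x y) :
    ∫⁻ x, ∫⁻ y, ENNReal.ofReal (C * (‖x - y‖ ^ (-Q) * (F x y + G x y))) = ENNReal.ofReal C *
      ((∫⁻ x, ∫⁻ y, ENNReal.ofReal (‖x - y‖ ^ (-Q) * F x y)) +
        ∫⁻ x, ∫⁻ y, ENNReal.ofReal (‖x - y‖ ^ (-Q) * G x y)) := by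
  have b1 : ∀ x, Measurable fun y => F x y := fun x =>
    hF.comp (measurable_const.prodMk measurable_id)
  have b2 : ∀ x, Measurable fun y => G x y := fun x =>
    hG.comp (measurable_const.prodMk measurable_id)
  have b3 : Measurable fun x => ∫⁻ y, ENNReal.ofReal (‖x - y‖ ^ (-Q) * F x y) :=
    Measurable.lintegral_prod_right' (f := fun w : Rn n × Rn n =>
      ENNReal.ofReal (‖w.1 - w.2‖ ^ (-Q) * F w.1 w.2)) (by fun_prop)
  have b4 : Measurable fun x => ∫⁻ y, ENNReal.ofReal (‖x - y‖ ^ (-Q) * G x y) :=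
    Measurable.lintegral_prod_right' (f := fun w : Rn n × Rn n =>
      ENNReal.ofReal (‖w.1 - w.2‖ ^ (-Q) * G w.1 w.2)) (by fun_prop)
  rw [← lintegral_add_left b3, ← lintegral_const_mul _ (by fun_prop)]
  refine lintegral_congr fun x => ?_
  have := b1 x
  have := b2 x
  rw [← lintegral_add_left (by fun_prop), ← lintegral_const_mul _ (by fun_prop)]
  refine lintegral_congr fun y => ?_
  have c1 := hF0 x y
  have c2 := hG0 x y
  rw [ENNReal.ofReal_mul hC, mul_add, ENNReal.ofReal_add (by positivity) (by positivity)]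

lemma caccioppoli_error_le {C₁ C₂ : ℝ} (hs : 0 < s) (hp : 1 < p) (hu : Measurable u) (hρ : 0 < ρ)
    (hR : ρ < R) (hd : 0 < d) (hC₁ : 0 ≤ C₁) (hC₂ : 0 ≤ C₂)
    (h : ∀ x : Rn n, ∫⁻ y, ENNReal.ofReal (|cutoff x₀ ρ R x - cutoff x₀ ρ R y| ^ p *
        ‖x - y‖ ^ (-((n : ℝ) + s * p))) ≤
      ENNReal.ofReal (C₂ * (R / (R - ρ)) ^ p * R ^ (-(s * p)))) :
    ∫⁻ w : Rn n × Rn n, ENNReal.ofReal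
        (C₁ * (‖w.1 - w.2‖ ^ (-((n : ℝ) + s * p)) *
            (errNear p γ u x₀ k d ρ R w.1 w.2 + errFar p u x₀ k ρ R w.1 w.2)) +
          C₁ * (‖w.2 - w.1‖ ^ (-((n : ℝ) + s * p)) *
            (errNear p γ u x₀ k d ρ R w.2 w.1 + errFar p u x₀ k ρ R w.2 w.1))) ≤
      ENNReal.ofReal (2 * C₁ * (C₂ + 2 ^ ((n : ℝ) + s * p)) *
          (R / (R - ρ)) ^ ((n : ℝ) + s * p + p)) *
        (ENNReal.ofReal (R ^ (-(s * p)) * d ^ (p - 1)) *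
            (∫⁻ x in ball x₀ R ∩ {x | k < u x}, ENNReal.ofReal ((1 + (u x - k) / d) ^ γ)) +
          volume (ball x₀ R ∩ {x | k < u x}) *
            (∫⁻ y in (ball x₀ R)ᶜ, ENNReal.ofReal (max (u y - k) 0 ^ (p - 1) *
              ‖y - x₀‖ ^ (-((n : ℝ) + s * p))))) := by
  have hR0 : 0 < R := hρ.trans hR
  have h1R : 1 ≤ R / (R - ρ) := by
    rw [le_div_iff₀ (by linarith)]; linarith
  have hN := lintegral_errNear_le (γ := γ) (k := k) hu hd h
  have hF := lintegral_errFar_le (n := n) (x₀ := x₀) (k := k) hs hp hu hρ hR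
  have a1 := measurable_errNear (p := p) (γ := γ) (x₀ := x₀) (k := k) (d := d) (ρ := ρ) (R := R) hu
  have a2 := measurable_errFar (p := p) (x₀ := x₀) (k := k) (ρ := ρ) (R := R) hu
  set Q := (n : ℝ) + s * p with hQ
  have hQ0 : 0 ≤ Q := by positivity
  set A := ∫⁻ x in ball x₀ R ∩ {x | k < u x}, ENNReal.ofReal ((1 + (u x - k) / d) ^ γ) with hA
  set T := volume (ball x₀ R ∩ {x | k < u x}) * ∫⁻ y in (ball x₀ R)ᶜ,
    ENNReal.ofReal (max (u y - k) 0 ^ (p - 1) * ‖y - x₀‖ ^ (-Q)) with hT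
  rw [lintegral_prod_add_swap (F := fun x y => C₁ * (‖x - y‖ ^ (-Q) *
      (errNear p γ u x₀ k d ρ R x y + errFar p u x₀ k ρ R x y))) (by fun_prop)
    (fun a b => mul_nonneg hC₁ (mul_nonneg (by positivity)
        (add_nonneg (errNear_nonneg hd a b) (errFar_nonneg a b))))]
  rw [lintegral_lintegral_const_mul_add hC₁ a1 a2 (errNear_nonneg hd) errFar_nonneg]
  have hpow : ∀ q ≤ Q + p, (R / (R - ρ)) ^ q ≤ (R / (R - ρ)) ^ (Q + p) := fun q hq =>
    Real.rpow_le_rpow_of_exponent_le h1R hq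
  calc 2 * (ENNReal.ofReal C₁ *
      ((∫⁻ x, ∫⁻ y, ENNReal.ofReal (‖x - y‖ ^ (-Q) * errNear p γ u x₀ k d ρ R x y)) +
        ∫⁻ x, ∫⁻ y, ENNReal.ofReal (‖x - y‖ ^ (-Q) * errFar p u x₀ k ρ R x y)))
      ≤ 2 * (ENNReal.ofReal C₁ * (ENNReal.ofReal (C₂ + 2 ^ Q) *
        ENNReal.ofReal ((R / (R - ρ)) ^ (Q + p)) *
        (ENNReal.ofReal (R ^ (-(s * p)) * d ^ (p - 1)) * A + T))) := by
        gcongr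
        rw [mul_add]
        refine add_le_add (hN.trans ?_) (hF.trans ?_)
        · rw [← mul_assoc, ← ENNReal.ofReal_mul (by positivity), ← mul_assoc,
            ← ENNReal.ofReal_mul (by positivity), ← ENNReal.ofReal_mul (by positivity)]
          gcongr ENNReal.ofReal ?_ * _
          have := hpow p (by linarith)
          calc C₂ * (R / (R - ρ)) ^ p * R ^ (-(s * p)) * d ^ (p - 1)
              ≤ (C₂ + 2 ^ Q) * (R / (R - ρ)) ^ (Q + p) * R ^ (-(s * p)) * d ^ (p - 1) := by
                gcongr
                exact le_add_of_nonneg_right (by positivity)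
            _ = _ := by ring
        · rw [← ENNReal.ofReal_mul (by positivity)]
          gcongr ENNReal.ofReal ?_ * _
          rw [Real.mul_rpow (by norm_num) (by linarith)]
          have := hpow Q (by linarith)
          have h0 : 0 ≤ (R / (R - ρ)) ^ Q := Real.rpow_nonneg (by linarith) _
          gcongr
          exact le_add_of_nonneg_left hC₂
    _ = _ := by
        have h0 : 0 ≤ (R / (R - ρ)) ^ (Q + p) := Real.rpow_nonneg (by linarith) _
        have e2 : ENNReal.ofReal (2 * C₁ * (C₂ + 2 ^ Q) * (R / (R - ρ)) ^ (Q + p)) =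
            2 * (ENNReal.ofReal C₁ * (ENNReal.ofReal (C₂ + 2 ^ Q) *
              ENNReal.ofReal ((R / (R - ρ)) ^ (Q + p)))) := by
          rw [← ENNReal.ofReal_mul (by positivity), ← ENNReal.ofReal_mul (by positivity),
            ← ENNReal.ofReal_ofNat 2, ← ENNReal.ofReal_mul (by positivity)]
          ring_nf
        rw [e2]
        ring

set_option maxHeartbeats 400000 in
lemma exists_caccioppoli (hn : 2 ≤ n) (hs : 0 < s) (hs1 : s < 1) (hp : 1 < p) (hτ : 1 < τ)
    (hγ : τ * (p - 1) ≤ γ) (hΛ : 1 ≤ Λ) :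
    ∃ C > 0, ∀ (Φ : ℝ → ℝ) (K : Rn n → Rn n → ℝ) (Ω : Set (Rn n)) (u f : Rn n → ℝ) (x₀ : Rn n)
      (r : ℝ), KernelBounds n Λ s p K → PhiBounds Λ p Φ → Measurable u →
      gagliardo n s p univ u < ⊤ → Continuous f → HasCompactSupport f →
      (∀ φ, IsTestFun n Ω φ → nonlocalForm n Φ K u φ = ∫ x, φ x * f x) → ball x₀ r ⊆ Ω →
      Cacc n s p τ γ C u x₀ r (∫⁻ x in ball x₀ r, ENNReal.ofReal |f x|) := by
  obtain ⟨C₁, hC₁, h₁⟩ := exists_energy_le (n := n) (s := s) hp hτ hγ hΛ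
  obtain ⟨C₂, hC₂, h₂⟩ := exists_cutoff_energy (n := n) hn hs hs1 hp
  have hΛ0 : 0 < Λ := by linarith
  refine ⟨2 * Λ ^ 2 * (1 + 2 * C₁ * (C₂ + 2 ^ ((n : ℝ) + s * p))), by positivity, ?_⟩
  intro Φ K Ω u f x₀ r hK hΦ hu hgu hf hfc hw hΩ k d ρ R hd hρ hR hRr
  have hR0 : 0 < R := hρ.trans hR
  set Q := (n : ℝ) + s * p with hQ
  have hQ0 : 0 ≤ Q := by positivity
  have hmc := measurable_cutoff (x₀ := x₀) (ρ := ρ) (R := R)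
  have hmT := measurable_Tt (τ := τ)
  have hk : MeasurableSet {x | k < u x} := measurableSet_lt measurable_const hu
  set ψ : Rn n → ℝ := fun x => Tt τ ((u x - k) / d) * cutoff x₀ ρ R x ^ p with hψ
  have hψm : Measurable ψ := by
    refine (hmT.comp ?_).mul (hmc.pow_const p)
    fun_prop
  have hψ1 : ∀ x, |ψ x| ≤ 1 := fun x => by
    have a := Tt_nonneg hτ ((u x - k) / d)
    have b := Tt_le_one (τ := τ) ((u x - k) / d)
    have c := cutoff_nonneg (x₀ := x₀) (ρ := ρ) (R := R) x
    have e : cutoff x₀ ρ R x ^ p ≤ 1 := Real.rpow_le_one c (cutoff_le_one x) (by linarith)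
    have e' : 0 ≤ cutoff x₀ ρ R x ^ p := by positivity
    rw [abs_of_nonneg (mul_nonneg a e')]
    exact mul_le_one₀ b e' e
  have hψ0 : ∀ x, (ρ + R) / 2 ≤ ‖x - x₀‖ → ψ x = 0 := fun x hx => by
    simp [hψ, cutoff_eq_zero hR hx, Real.zero_rpow (show p ≠ 0 by linarith)]
  obtain ⟨hI, hIe⟩ := form_eq_of_energy (R := (ρ + R) / 2) (R' := (ρ + 3 * R) / 4) hs hp hΛ hK hΦ
    hu hgu hf hfc hw hψm hψ1 (x₀ := x₀) (by linarith)
    (fun x hx => hψ0 x (by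
      rw [mem_closedBall, dist_eq_norm, not_le] at hx; exact hx.le))
    ((closedBall_subset_ball (by linarith)).trans ((ball_subset_ball hRr).trans hΩ))
    (gagliardo_test_lt_top hn hs hs1 hp hτ hgu hρ hR k hd)
  have hG0 : ∀ x y, 0 ≤ ‖x - y‖ ^ (-Q) * ((Λ ^ 2)⁻¹ / 2 * max (u x - u y) 0 ^ (p - 1) *
      (Tt τ ((u x - k) / d) - Tt τ ((u y - k) / d)) * cutoff x₀ ρ R x ^ p) := by
    intro x y
    have c := cutoff_nonneg (x₀ := x₀) (ρ := ρ) (R := R) x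
    rcases le_or_gt (u y) (u x) with hle | hlt
    · have : 0 ≤ Tt τ ((u x - k) / d) - Tt τ ((u y - k) / d) :=
        sub_nonneg.2 (Tt_mono hτ (by gcongr))
      positivity
    · rw [max_eq_right (by linarith), Real.zero_rpow (by linarith)]
      simp
  have hE := lintegral_ofReal_le_of_le_add (μ := (volume : Measure (Rn n × Rn n)))
    (G := fun w => ‖w.1 - w.2‖ ^ (-Q) * ((Λ ^ 2)⁻¹ / 2 * max (u w.1 - u w.2) 0 ^ (p - 1) *
          (Tt τ ((u w.1 - k) / d) - Tt τ ((u w.2 - k) / d)) * cutoff x₀ ρ R w.1 ^ p)) hI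
    (B := fun w => (C₁ * (‖w.1 - w.2‖ ^ (-Q) *
            (errNear p γ u x₀ k d ρ R w.1 w.2 + errFar p u x₀ k ρ R w.1 w.2)) +
          C₁ * (‖w.2 - w.1‖ ^ (-Q) *
            (errNear p γ u x₀ k d ρ R w.2 w.1 + errFar p u x₀ k ρ R w.2 w.1)))) ?_ ?_ ?_
    (fun w => h₁ Φ K u x₀ k d ρ R hK hΦ hd hR w.1 w.2)
  rotate_left
  · have a1 := measurable_errNear (p := p) (γ := γ) (x₀ := x₀) (k := k) (d := d) (ρ := ρ) (R := R) hu
    have a2 := measurable_errFar (p := p) (x₀ := x₀) (k := k) (ρ := ρ) (R := R) hu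
    have a3 := a1.comp measurable_swap
    have a4 := a2.comp measurable_swap
    simp only [Function.comp_def, Prod.fst_swap, Prod.snd_swap] at a3 a4
    fun_prop
  · have e1 : ∀ a b : Rn n, 0 ≤ C₁ * (‖a - b‖ ^ (-Q) *
        (errNear p γ u x₀ k d ρ R a b + errFar p u x₀ k ρ R a b)) := fun a b =>
      mul_nonneg hC₁.le (mul_nonneg (by positivity)
        (add_nonneg (errNear_nonneg hd a b) (errFar_nonneg a b)))
    exact fun w => add_nonneg (e1 _ _) (e1 _ _)
  · intro w
    exact hG0 w.1 w.2
  rw [hIe] at hE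
  have hE1 := ofReal_integral_mul_le (f := f) (S := ball x₀ r) measurableSet_ball hψ1 (fun x hx =>
    hψ0 x (by rw [mem_ball, dist_eq_norm, not_lt] at hx; linarith))
  set A := ∫⁻ x in ball x₀ R ∩ {x | k < u x}, ENNReal.ofReal ((1 + (u x - k) / d) ^ γ) with hA
  set T := volume (ball x₀ R ∩ {x | k < u x}) * ∫⁻ y in (ball x₀ R)ᶜ,
    ENNReal.ofReal (max (u y - k) 0 ^ (p - 1) * ‖y - x₀‖ ^ (-Q)) with hT
  have hB := caccioppoli_error_le (γ := γ) (C₁ := C₁) hs hp hu hρ hR hd hC₁.le hC₂.le (k := k)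
    (h₂ x₀ ρ R hρ hR)
  have hlow : ENNReal.ofReal ((Λ ^ 2)⁻¹ / 2) * (∫⁻ x in ball x₀ ρ, ∫⁻ y,
      ENNReal.ofReal (max (u x - u y) 0 ^ (p - 1) *
        (Tt τ ((u x - k) / d) - Tt τ ((u y - k) / d)) * ‖x - y‖ ^ (-Q))) ≤
      ∫⁻ w : Rn n × Rn n, ENNReal.ofReal (‖w.1 - w.2‖ ^ (-Q) *
        ((Λ ^ 2)⁻¹ / 2 * max (u w.1 - u w.2) 0 ^ (p - 1) *
          (Tt τ ((u w.1 - k) / d) - Tt τ ((u w.2 - k) / d)) * cutoff x₀ ρ R w.1 ^ p)) := by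
    rw [Measure.volume_eq_prod, lintegral_prod _ (by fun_prop),
      ← lintegral_const_mul _ (by fun_prop)]
    refine le_trans ?_ (setLIntegral_le_lintegral (ball x₀ ρ) _)
    refine setLIntegral_mono' measurableSet_ball fun x hx => ?_
    rw [← lintegral_const_mul _ (by fun_prop)]
    refine lintegral_mono fun y => ?_
    rw [← ENNReal.ofReal_mul (by positivity), cutoff_eq_one hR hx, Real.one_rpow]
    exact ENNReal.ofReal_le_ofReal (by ring_nf; rfl)
  have hfin := hlow.trans (hE.trans (add_le_add hE1 hB))
  have h1R : 1 ≤ R / (R - ρ) := by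
    rw [le_div_iff₀ (by linarith)]; linarith
  have h1R' : 1 ≤ (R / (R - ρ)) ^ (Q + p) := Real.one_le_rpow h1R (by positivity)
  set L := ∫⁻ x in ball x₀ ρ, ∫⁻ y, ENNReal.ofReal (max (u x - u y) 0 ^ (p - 1) *
    (Tt τ ((u x - k) / d) - Tt τ ((u y - k) / d)) * ‖x - y‖ ^ (-Q)) with hL
  set D := ∫⁻ x in ball x₀ r, ENNReal.ofReal |f x| with hD
  set X := (R / (R - ρ)) ^ (Q + p) with hX
  calc L = ENNReal.ofReal (2 * Λ ^ 2) * (ENNReal.ofReal ((Λ ^ 2)⁻¹ / 2) * L) := by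
        rw [← mul_assoc, ← ENNReal.ofReal_mul (by positivity)]
        have : 2 * Λ ^ 2 * ((Λ ^ 2)⁻¹ / 2) = 1 := by field_simp
        rw [this, ENNReal.ofReal_one, one_mul]
    _ ≤ ENNReal.ofReal (2 * Λ ^ 2) * (ENNReal.ofReal ((1 + 2 * C₁ * (C₂ + 2 ^ Q)) * X) * D +
        ENNReal.ofReal ((1 + 2 * C₁ * (C₂ + 2 ^ Q)) * X) *
          (ENNReal.ofReal (R ^ (-(s * p)) * d ^ (p - 1)) * A + T)) := by
        refine mul_le_mul' le_rfl (hfin.trans (add_le_add ?_ (mul_le_mul' ?_ le_rfl)))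
        · refine le_mul_of_one_le_left zero_le ?_
          rw [ENNReal.one_le_ofReal]
          exact one_le_mul_of_one_le_of_one_le (le_add_of_nonneg_right (by positivity)) h1R'
        · refine ENNReal.ofReal_le_ofReal (mul_le_mul_of_nonneg_right ?_ (by linarith))
          linarith
    _ = _ := by
        rw [show 2 * Λ ^ 2 * (1 + 2 * C₁ * (C₂ + 2 ^ Q)) * X =
          2 * Λ ^ 2 * ((1 + 2 * C₁ * (C₂ + 2 ^ Q)) * X) by ring,
          ENNReal.ofReal_mul (p := 2 * Λ ^ 2) (by positivity)]
        ring

end CaccioppoliProof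

section Rescale

variable {n : ℕ} {s p τ γ C : ℝ} {u : Rn n → ℝ} {x₀ : Rn n}

lemma pos_part_rpow_rescale {a b c m q : ℝ} (hm : 0 < m) :
    max (a - (c + m * b)) 0 ^ q = m ^ q * max ((a - c) / m - b) 0 ^ q := by
  rw [← Real.mul_rpow hm.le (le_max_right _ _), mul_max_of_nonneg _ _ hm.le, mul_zero]
  congr 2
  field_simp
  ring

lemma norm_affine_sub_rpow {r' : ℝ} (hr' : 0 < r') (x y : Rn n) (q : ℝ) :
    ‖(x₀ + r' • x) - (x₀ + r' • y)‖ ^ q = r' ^ q * ‖x - y‖ ^ q := by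
  rw [add_sub_add_left_eq_sub, ← smul_sub, norm_smul, Real.norm_of_nonneg hr'.le,
    Real.mul_rpow hr'.le (norm_nonneg _)]

lemma Cacc.rescale {r δ} (h : Cacc n s p τ γ C u x₀ r δ) (hu : Measurable u) {r' m : ℝ}
    (hr' : 0 < r') (hr : r' ≤ r) (hm : 0 < m) (c : ℝ) :
    Cacc n s p τ γ C (fun x => (u (x₀ + r' • x) - c) / m) 0 1
      (ENNReal.ofReal ((m ^ (p - 1) * r' ^ ((n : ℝ) - s * p))⁻¹) * δ) := by
  intro k d ρ R hd hρ hR hR1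
  have H := h (c + m * k) (m * d) (r' * ρ) (r' * R) (by positivity) (by positivity) (by gcongr)
    ((mul_le_of_le_one_right hr'.le hR1).trans hr)
  have hmT := measurable_Tt (τ := τ)
  have hR0 : 0 < R := hρ.trans hR
  set Q := (n : ℝ) + s * p with hQ
  set a := m ^ (p - 1) * r' ^ ((n : ℝ) - s * p) with ha
  have ha0 : 0 < a := by positivity
  set v : Rn n → ℝ := fun x => (u (x₀ + r' • x) - c) / m with hv
  have hvm : Measurable v := by fun_prop
  have hlev : ∀ x, (u (x₀ + r' • x) - (c + m * k)) / (m * d) = (v x - k) / d := fun x => by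
    simp only [hv]; field_simp; ring
  have hset : (fun x : Rn n => x₀ + r' • x) ⁻¹' (ball x₀ (r' * R) ∩ {x | c + m * k < u x}) =
      ball 0 R ∩ {x | k < v x} := by
    rw [preimage_inter, preimage_affine_ball x₀ hr']
    congr 1
    ext x
    simp only [mem_preimage, mem_ofPred_eq, hv, lt_div_iff₀ hm]
    constructor <;> intro h <;> linarith
  have hkm : MeasurableSet (ball x₀ (r' * R) ∩ {x | c + m * k < u x}) :=
    measurableSet_ball.inter (measurableSet_lt measurable_const hu)
  have hpow : r' ^ n * r' ^ (-(s * p)) = r' ^ ((n : ℝ) - s * p) := by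
    rw [← Real.rpow_natCast, ← Real.rpow_add hr']; ring_nf
  have hpow2 : r' ^ n * r' ^ (-Q) = r' ^ (-(s * p)) := by
    rw [← Real.rpow_natCast, ← Real.rpow_add hr']; congr 1; ring
  have e1 : ∫⁻ x in ball x₀ (r' * ρ), ∫⁻ y, ENNReal.ofReal (max (u x - u y) 0 ^ (p - 1) *
        (Tt τ ((u x - (c + m * k)) / (m * d)) - Tt τ ((u y - (c + m * k)) / (m * d))) *
          ‖x - y‖ ^ (-Q)) = ENNReal.ofReal a *
      ∫⁻ x in ball 0 ρ, ∫⁻ y, ENNReal.ofReal (max (v x - v y) 0 ^ (p - 1) *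
        (Tt τ ((v x - k) / d) - Tt τ ((v y - k) / d)) * ‖x - y‖ ^ (-Q)) := by
    rw [lintegral_ball_affine _ x₀ hr', ha, ← hpow, mul_left_comm,
      ENNReal.ofReal_mul (by positivity), mul_assoc,
      ← lintegral_const_mul (ENNReal.ofReal (m ^ (p - 1) * r' ^ (-(s * p)))) (by fun_prop)]
    congr 1
    refine lintegral_congr fun x => ?_
    rw [lintegral_affine _ x₀ hr', ← hpow2, mul_left_comm, ENNReal.ofReal_mul (by positivity),
      mul_assoc, ← lintegral_const_mul (ENNReal.ofReal (m ^ (p - 1) * r' ^ (-Q))) (by fun_prop)]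
    congr 1
    refine lintegral_congr fun y => ?_
    rw [← ENNReal.ofReal_mul (by positivity), hlev, hlev, norm_affine_sub_rpow hr']
    have := pos_part_rpow_rescale (a := u (x₀ + r' • x)) (b := v y) (c := c) (q := p - 1) hm
    have e : c + m * v y = u (x₀ + r' • y) := by simp only [hv]; field_simp; ring
    rw [e] at this
    rw [this]
    congr 1
    ring
  have e2 : ENNReal.ofReal ((r' * R) ^ (-(s * p)) * (m * d) ^ (p - 1)) *
      (∫⁻ x in ball x₀ (r' * R) ∩ {x | c + m * k < u x},
        ENNReal.ofReal ((1 + (u x - (c + m * k)) / (m * d)) ^ γ)) = ENNReal.ofReal a *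
      (ENNReal.ofReal (R ^ (-(s * p)) * d ^ (p - 1)) *
        (∫⁻ x in ball 0 R ∩ {x | k < v x}, ENNReal.ofReal ((1 + (v x - k) / d) ^ γ))) := by
    rw [setLIntegral_affine _ x₀ hr' hkm, hset, ← mul_assoc, ← mul_assoc]
    simp only [hlev]
    congr 1
    rw [← ENNReal.ofReal_mul (by positivity), ← ENNReal.ofReal_mul (by positivity), ha, ← hpow,
      Real.mul_rpow hr'.le hR0.le, Real.mul_rpow hm.le hd.le]
    congr 1
    ring
  have e3 : volume (ball x₀ (r' * R) ∩ {x | c + m * k < u x}) *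
      (∫⁻ y in (ball x₀ (r' * R))ᶜ, ENNReal.ofReal (max (u y - (c + m * k)) 0 ^ (p - 1) *
        ‖y - x₀‖ ^ (-Q))) = ENNReal.ofReal a * (volume (ball 0 R ∩ {x | k < v x}) *
      (∫⁻ y in (ball 0 R)ᶜ, ENNReal.ofReal (max (v y - k) 0 ^ (p - 1) * ‖y - 0‖ ^ (-Q)))) := by
    have f1 : volume (ball x₀ (r' * R) ∩ {x | c + m * k < u x}) =
        ENNReal.ofReal (r' ^ n) * volume (ball 0 R ∩ {x | k < v x}) := by
      rw [← setLIntegral_one, setLIntegral_affine _ x₀ hr' hkm, hset, setLIntegral_one]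
    have f2 : ∫⁻ y in (ball x₀ (r' * R))ᶜ, ENNReal.ofReal (max (u y - (c + m * k)) 0 ^ (p - 1) *
        ‖y - x₀‖ ^ (-Q)) = ENNReal.ofReal (m ^ (p - 1) * r' ^ (-(s * p))) *
        ∫⁻ y in (ball 0 R)ᶜ, ENNReal.ofReal (max (v y - k) 0 ^ (p - 1) * ‖y - 0‖ ^ (-Q)) := by
      rw [lintegral_compl_ball_affine _ x₀ hr', ← hpow2, mul_left_comm,
        ENNReal.ofReal_mul (by positivity), mul_assoc,
        ← lintegral_const_mul (ENNReal.ofReal (m ^ (p - 1) * r' ^ (-Q))) (by fun_prop)]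
      congr 1
      refine lintegral_congr fun y => ?_
      rw [← ENNReal.ofReal_mul (by positivity), pos_part_rpow_rescale hm]
      have := norm_affine_sub_rpow (x₀ := x₀) hr' y 0 (-Q)
      rw [smul_zero, add_zero] at this
      rw [this]
      congr 1
      simp only [hv]
      ring
    rw [f1, f2, ha, ← hpow, mul_left_comm (m ^ (p - 1)),
      ENNReal.ofReal_mul (p := r' ^ n) (by positivity)]
    ring
  rw [e1, e2, e3, ← mul_sub, mul_div_mul_left _ _ hr'.ne'] at H
  have hc : ENNReal.ofReal a⁻¹ * ENNReal.ofReal a = 1 := by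
    rw [← ENNReal.ofReal_mul (by positivity), inv_mul_cancel₀ ha0.ne', ENNReal.ofReal_one]
  set X := ENNReal.ofReal (C * (R / (R - ρ)) ^ (Q + p))
  refine (le_of_eq (by rw [← mul_assoc, hc, one_mul])).trans
    ((mul_le_mul_right H (ENNReal.ofReal a⁻¹)).trans (le_of_eq ?_))
  set Y := ENNReal.ofReal (R ^ (-(s * p)) * d ^ (p - 1)) *
        (∫⁻ x in ball 0 R ∩ {x | k < v x}, ENNReal.ofReal ((1 + (v x - k) / d) ^ γ))
  set Z := volume (ball 0 R ∩ {x | k < v x}) *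
      (∫⁻ y in (ball 0 R)ᶜ, ENNReal.ofReal (max (v y - k) 0 ^ (p - 1) * ‖y - 0‖ ^ (-Q)))
  calc ENNReal.ofReal a⁻¹ * (X * (ENNReal.ofReal a * Y + ENNReal.ofReal a * Z + δ))
      = X * ((ENNReal.ofReal a⁻¹ * ENNReal.ofReal a) * (Y + Z) + ENNReal.ofReal a⁻¹ * δ) := by ring
    _ = _ := by rw [hc, one_mul]

end Rescale

section Level

variable {n : ℕ} {s p τ : ℝ} {u : Rn n → ℝ}

/-- The truncated energy of `u` on `B_ρ × ℝⁿ`. -/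
def truncEnergy (n : ℕ) (s p τ : ℝ) (u : Rn n → ℝ) (k d ρ : ℝ) : ℝ≥0∞ :=
  ∫⁻ x in ball 0 ρ, ∫⁻ y, ENNReal.ofReal (max (u x - u y) 0 ^ (p - 1) *
    (Tt τ ((u x - k) / d) - Tt τ ((u y - k) / d)) * ‖x - y‖ ^ (-((n : ℝ) + s * p)))

lemma Tt_gap (hτ : 1 < τ) {z v w : ℝ} (hz : 1 ≤ z) (hv : v ≤ z) (hw : 2 * z ≤ w) :
    (τ - 1) * 3 ^ (-τ) * z ^ (1 - τ) ≤ Tt τ w - Tt τ v := by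
  have hz0 : 0 < z := by linarith
  have h1 := Tt_concave hτ hz0.le (by linarith : z ≤ 2 * z)
  have h2 : (3 * z) ^ (-τ) ≤ (1 + 2 * z) ^ (-τ) :=
    Real.rpow_le_rpow_of_nonpos (by linarith) (by linarith) (by linarith)
  have h3 := Tt_mono hτ hv
  have h4 := Tt_mono hτ hw
  have h5 : z ^ (1 - τ) = z ^ (-τ) * z := by
    rw [show 1 - τ = -τ + 1 by ring, Real.rpow_add_one hz0.ne']
  rw [Real.mul_rpow (by norm_num) hz0.le] at h2
  calc (τ - 1) * 3 ^ (-τ) * z ^ (1 - τ) = (τ - 1) * (3 ^ (-τ) * z ^ (-τ)) * z := by rw [h5]; ring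
    _ ≤ (τ - 1) * (1 + 2 * z) ^ (-τ) * z := by
        have : 0 ≤ τ - 1 := by linarith
        gcongr
    _ ≤ _ := by linarith

lemma volume_ball_toReal_pos (n : ℕ) : 0 < (volume (ball (0 : Rn n) 1)).toReal :=
  ENNReal.toReal_pos (measure_ball_pos _ _ one_pos).ne' measure_ball_lt_top.ne

lemma volume_ball_eq (x : Rn n) {r : ℝ} (hr : 0 < r) :
    volume (ball x r) = ENNReal.ofReal (r ^ n * (volume (ball (0 : Rn n) 1)).toReal) := by
  rw [Measure.addHaar_ball_of_pos _ _ hr, finrank_euclideanSpace_fin,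
    ENNReal.ofReal_mul (by positivity), ENNReal.ofReal_toReal measure_ball_lt_top.ne]

lemma energy_lower (hs : 0 < s) (hp : 1 < p) (hτ : 1 < τ) (hn : 2 ≤ n) {k d t ρ R ϱ a : ℝ}
    (hu : Measurable u) (hd : 0 < d) (hdt : d ≤ t) (hϱ : 0 < ϱ) (hϱR : ϱ ≤ R - ρ)
    (ha : volume (ball 0 R ∩ {x | k + t < u x}) = ENNReal.ofReal a) (ha0 : 0 ≤ a)
    (hϱa : ϱ ^ n * (volume (ball (0 : Rn n) 1)).toReal = 2 * a) :
    ENNReal.ofReal ((τ - 1) * 3 ^ (-τ) * (t ^ (p - 1) * (t / d) ^ (1 - τ)) *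
      (ϱ ^ (-((n : ℝ) + s * p)) * a)) * volume (ball 0 ρ ∩ {x | k + 2 * t < u x}) ≤
    truncEnergy n s p τ u k d ρ := by
  have ht : 0 < t := hd.trans_le hdt
  set Q := (n : ℝ) + s * p with hQ
  have hQ0 : 0 ≤ Q := by positivity
  have hm2 : MeasurableSet {x | k + 2 * t < u x} := measurableSet_lt measurable_const hu
  set S := ball 0 R ∩ {x | k + t < u x} with hS
  have hSm : MeasurableSet S := measurableSet_ball.inter (measurableSet_lt measurable_const hu)
  set b := (τ - 1) * 3 ^ (-τ) * (t ^ (p - 1) * (t / d) ^ (1 - τ)) with hb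
  have hb0 : 0 ≤ b := by
    have : 0 < τ - 1 := by linarith
    positivity
  rw [← setLIntegral_const, truncEnergy]
  refine (setLIntegral_mono' (measurableSet_ball.inter hm2) fun x hx => ?_).trans
    (lintegral_mono_set inter_subset_left)
  have hvol : ENNReal.ofReal a ≤ volume (ball x ϱ \ S) := by
    have h1 : volume (ball x ϱ) - volume S ≤ volume (ball x ϱ \ S) := le_measure_sdiff
    rw [volume_ball_eq x hϱ, ha, hϱa, ← ENNReal.ofReal_sub _ ha0] at h1
    convert h1 using 2
    ring
  calc ENNReal.ofReal (b * (ϱ ^ (-Q) * a))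
      = ENNReal.ofReal (b * ϱ ^ (-Q)) * ENNReal.ofReal a := by
        rw [← ENNReal.ofReal_mul (by positivity)]; congr 1; ring
    _ ≤ ENNReal.ofReal (b * ϱ ^ (-Q)) * volume (ball x ϱ \ S) := by gcongr
    _ = ∫⁻ _ in ball x ϱ \ S, ENNReal.ofReal (b * ϱ ^ (-Q)) := (setLIntegral_const _ _).symm
    _ ≤ ∫⁻ y in ball x ϱ \ S, ENNReal.ofReal (max (u x - u y) 0 ^ (p - 1) *
          (Tt τ ((u x - k) / d) - Tt τ ((u y - k) / d)) * ‖x - y‖ ^ (-Q)) := by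
        refine setLIntegral_mono' (measurableSet_ball.diff hSm) fun y hy => ?_
        refine ENNReal.ofReal_le_ofReal ?_
        have hx2 : k + 2 * t < u x := hx.2
        have hxρ : ‖x‖ < ρ := by simpa using hx.1
        have hyx : ‖x - y‖ < ϱ := by
          have := hy.1
          rwa [mem_ball, dist_comm, dist_eq_norm] at this
        have hyR : y ∈ ball (0 : Rn n) R := by
          rw [mem_ball_zero_iff]
          have : ‖y‖ ≤ ‖x‖ + ‖x - y‖ := by
            have := norm_sub_le x (x - y)
            rwa [sub_sub_cancel] at this
          linarith
        have hyu : u y ≤ k + t := by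
          by_contra h
          exact hy.2 ⟨hyR, not_le.1 h⟩
        have hxy : x ≠ y := by
          rintro rfl
          linarith
        have h1 : t ^ (p - 1) ≤ max (u x - u y) 0 ^ (p - 1) :=
          Real.rpow_le_rpow ht.le (le_max_of_le_left (by linarith)) (by linarith)
        have h2 := Tt_gap hτ (z := t / d) (v := (u y - k) / d) (w := (u x - k) / d)
          (by rwa [le_div_iff₀ hd, one_mul]) (by gcongr; linarith)
          (by rw [mul_div_assoc']; gcongr; linarith)
        have h3 : ϱ ^ (-Q) ≤ ‖x - y‖ ^ (-Q) :=
          Real.rpow_le_rpow_of_nonpos (norm_pos_iff.2 (sub_ne_zero.2 hxy)) hyx.le (by linarith)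
        have : 0 < τ - 1 := by linarith
        have h0 : 0 ≤ Tt τ ((u x - k) / d) - Tt τ ((u y - k) / d) := le_trans (by positivity) h2
        calc b * ϱ ^ (-Q) = t ^ (p - 1) * ((τ - 1) * 3 ^ (-τ) * (t / d) ^ (1 - τ)) * ϱ ^ (-Q) := by
              rw [hb]; ring
          _ ≤ _ := by gcongr
    _ ≤ _ := setLIntegral_le_lintegral _ _

lemma exists_level (hs : 0 < s) (hp : 1 < p) (hτ : 1 < τ) (hn : 2 ≤ n) :
    ∃ C > 0, ∀ (u : Rn n → ℝ) (k d t ρ R : ℝ), Measurable u → 0 < d → d ≤ t → 0 < ρ → ρ < R →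
      volume (ball 0 ρ ∩ {x | k + 2 * t < u x}) ≤ ENNReal.ofReal C *
        (volume (ball 0 R ∩ {x | k + t < u x}) ^ (s * p / n) *
            ENNReal.ofReal (t ^ (-(p - 1)) * (t / d) ^ (τ - 1)) * truncEnergy n s p τ u k d ρ +
          ENNReal.ofReal ((R - ρ) ^ (-(s * p))) *
            volume (ball 0 R ∩ {x | k + t < u x}) ^ (1 + s * p / n)) := by
  have hn0 : (0 : ℝ) < n := by positivity
  set ω := (volume (ball (0 : Rn n) 1)).toReal with hω
  have hω0 : 0 < ω := volume_ball_toReal_pos n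
  set β := s * p / n with hβ
  have hβ0 : 0 < β := by positivity
  have hτ1 : 0 < τ - 1 := by linarith
  set c := (τ - 1) * (3 : ℝ) ^ (-τ) with hc
  have hc0 : 0 < c := by positivity
  refine ⟨c⁻¹ * (2 / ω) ^ (1 + β) + (2 / ω) ^ β, by positivity, ?_⟩
  intro u k d t ρ R hu hd hdt hρ hR
  have ht : 0 < t := hd.trans_le hdt
  have hg : 0 < R - ρ := by linarith
  have hsub : ball (0 : Rn n) ρ ∩ {x | k + 2 * t < u x} ⊆ ball 0 R ∩ {x | k + t < u x} := by
    refine inter_subset_inter (ball_subset_ball hR.le) fun x (hx : k + 2 * t < u x) => ?_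
    show k + t < u x
    linarith
  have hfin : volume (ball (0 : Rn n) R ∩ {x | k + t < u x}) ≠ ⊤ :=
    ((measure_mono inter_subset_left).trans_lt measure_ball_lt_top).ne
  obtain ⟨a, ha0, ha⟩ : ∃ a : ℝ, 0 ≤ a ∧
      volume (ball (0 : Rn n) R ∩ {x | k + t < u x}) = ENNReal.ofReal a :=
    ⟨_, ENNReal.toReal_nonneg, (ENNReal.ofReal_toReal hfin).symm⟩
  have hle := measure_mono (μ := volume) hsub
  rw [ha] at hle ⊢
  rcases ha0.eq_or_lt with rfl | hapos
  · simp only [ENNReal.ofReal_zero, nonpos_iff_eq_zero] at hle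
    rw [hle]
    exact zero_le
  rw [ENNReal.ofReal_rpow_of_pos hapos, ENNReal.ofReal_rpow_of_pos hapos]
  set ϱ := (2 * a / ω) ^ (1 / (n : ℝ)) with hϱ
  have hϱ0 : 0 < ϱ := by positivity
  have hϱn : ϱ ^ n = 2 * a / ω := by
    rw [hϱ, ← Real.rpow_natCast, ← Real.rpow_mul (by positivity), one_div,
      inv_mul_cancel₀ hn0.ne', Real.rpow_one]
  rcases le_or_gt ϱ (R - ρ) with hle' | hlt
  · have h := energy_lower (s := s) hs hp hτ hn hu hd hdt hϱ0 hle' ha ha0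
      (by rw [hϱn, ← hω]; field_simp)
    have e : ϱ ^ (-((n : ℝ) + s * p)) * a = ((2 / ω) ^ (1 + β) * a ^ β)⁻¹ := by
      have e1 : ϱ ^ (-((n : ℝ) + s * p)) = ((2 * a / ω) ^ (1 + β))⁻¹ := by
        rw [hϱ, ← Real.rpow_mul (by positivity), ← Real.rpow_neg (by positivity)]
        congr 1
        rw [hβ]; field_simp
      rw [e1, mul_div_right_comm, Real.mul_rpow (by positivity) hapos.le,
        Real.rpow_add hapos, Real.rpow_one]
      field_simp
    set X := c * (t ^ (p - 1) * (t / d) ^ (1 - τ)) * (ϱ ^ (-((n : ℝ) + s * p)) * a) with hX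
    have hX0 : 0 < X := by positivity
    have hXi : X⁻¹ = c⁻¹ * (2 / ω) ^ (1 + β) * (a ^ β * (t ^ (-(p - 1)) * (t / d) ^ (τ - 1))) := by
      rw [hX, e, show τ - 1 = -(1 - τ) by ring, Real.rpow_neg ht.le,
        Real.rpow_neg (x := t / d) (by positivity)]
      field_simp
    calc volume (ball 0 ρ ∩ {x | k + 2 * t < u x})
        = ENNReal.ofReal X⁻¹ * (ENNReal.ofReal X *
            volume (ball 0 ρ ∩ {x | k + 2 * t < u x})) := by
          rw [← mul_assoc, ← ENNReal.ofReal_mul (by positivity), inv_mul_cancel₀ hX0.ne',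
            ENNReal.ofReal_one, one_mul]
      _ ≤ ENNReal.ofReal X⁻¹ * truncEnergy n s p τ u k d ρ := by gcongr
      _ ≤ ENNReal.ofReal ((c⁻¹ * (2 / ω) ^ (1 + β) + (2 / ω) ^ β)) *
          (ENNReal.ofReal (a ^ β) * ENNReal.ofReal (t ^ (-(p - 1)) * (t / d) ^ (τ - 1)) *
            truncEnergy n s p τ u k d ρ) := by
          rw [hXi, ENNReal.ofReal_mul (by positivity), ENNReal.ofReal_mul (p := a ^ β)
            (by positivity), mul_assoc]
          gcongr
          exact le_add_of_nonneg_right (by positivity)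
      _ ≤ _ := by gcongr; exact le_self_add
  · have h1 : (R - ρ) ^ n ≤ 2 * a / ω := by
      rw [← hϱn]; gcongr
    have h2 : (R - ρ) ^ (s * p) ≤ (2 * a / ω) ^ β := by
      calc (R - ρ) ^ (s * p) = ((R - ρ) ^ n) ^ β := by
            rw [← Real.rpow_natCast, ← Real.rpow_mul hg.le]
            congr 1
            rw [hβ]; field_simp
        _ ≤ _ := by gcongr
    have h3 : a ≤ (2 / ω) ^ β * ((R - ρ) ^ (-(s * p)) * a ^ (1 + β)) := by
      rw [mul_div_right_comm, Real.mul_rpow (by positivity) hapos.le] at h2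
      rw [Real.rpow_neg hg.le, Real.rpow_add hapos, Real.rpow_one]
      have : 1 ≤ ((R - ρ) ^ (s * p))⁻¹ * ((2 / ω) ^ β * a ^ β) := by
        rw [inv_mul_eq_div, one_le_div (by positivity)]; exact h2
      calc a ≤ a * (((R - ρ) ^ (s * p))⁻¹ * ((2 / ω) ^ β * a ^ β)) :=
            le_mul_of_one_le_right hapos.le this
        _ = _ := by ring
    calc volume (ball 0 ρ ∩ {x | k + 2 * t < u x}) ≤ ENNReal.ofReal a := hle
      _ ≤ ENNReal.ofReal (c⁻¹ * (2 / ω) ^ (1 + β) + (2 / ω) ^ β) *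
          (ENNReal.ofReal ((R - ρ) ^ (-(s * p))) * ENNReal.ofReal (a ^ (1 + β))) := by
          rw [← ENNReal.ofReal_mul (by positivity), ← ENNReal.ofReal_mul (by positivity)]
          refine ENNReal.ofReal_le_ofReal (h3.trans ?_)
          gcongr
          exact le_add_of_nonneg_left (by positivity)
      _ ≤ _ := by gcongr; exact le_add_self

end Level

section Layer

/-- Admissible choices of the truncation exponent `τ` and the integrability exponent `γ`. -/
structure Exponents (n : ℕ) (s p τ γ : ℝ) : Prop where
  hn : 2 ≤ n
  hs : 0 < s
  hs1 : s < 1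
  hp : 1 < p
  hτ : 1 < τ
  hτγ : τ * (p - 1) ≤ γ
  hqγ : qStar p ≤ γ
  hγp : γ ≤ p
  hγ : γ < p - τ + s * p / n * qStar p

lemma one_le_qStar (p : ℝ) : 1 ≤ qStar p := le_max_left _ _

lemma sub_one_le_qStar (p : ℝ) : p - 1 ≤ qStar p := le_max_right _ _

lemma exists_exponents {n : ℕ} {s p : ℝ} (hn : 2 ≤ n) (hs : 0 < s) (hs1 : s < 1)
    (hp : 2 - s / (n : ℝ) < p) : ∃ τ γ : ℝ, Exponents n s p τ γ := by
  have hn0 : (2 : ℝ) ≤ n := by exact_mod_cast hn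
  have hsn : s / (n : ℝ) < 1 / 2 := by
    rw [div_lt_div_iff₀ (by linarith) (by norm_num)]; linarith
  have hsn0 : 0 < s / (n : ℝ) := by positivity
  have hp1 : 1 < p := by linarith
  have hsp : s * p / n = s / n * p := by ring
  rcases le_or_gt 2 p with h2 | h2
  · have hq : qStar p = p - 1 := max_eq_right (by linarith)
    refine ⟨min (1 + s / n * (p - 1) / 2) (p / (p - 1)),
      min (1 + s / n * (p - 1) / 2) (p / (p - 1)) * (p - 1), hn, hs, hs1, hp1, ?_, le_rfl, ?_, ?_, ?_⟩
    · refine lt_min ?_ ?_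
      · have : 0 < s / n * (p - 1) := mul_pos hsn0 (by linarith)
        linarith
      · rw [lt_div_iff₀ (by linarith)]; linarith
    · rw [hq]
      have : (1 : ℝ) ≤ min (1 + s / n * (p - 1) / 2) (p / (p - 1)) := by
        refine le_min ?_ ?_
        · have : 0 < s / n * (p - 1) := mul_pos hsn0 (by linarith)
          linarith
        · rw [le_div_iff₀ (by linarith)]; linarith
      nlinarith
    · have := min_le_right (1 + s / n * (p - 1) / 2) (p / (p - 1))
      calc _ ≤ p / (p - 1) * (p - 1) := by gcongr
        _ = p := div_mul_cancel₀ _ (by linarith)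
    · have := min_le_left (1 + s / n * (p - 1) / 2) (p / (p - 1))
      rw [hq, hsp]
      have h3 : min (1 + s / n * (p - 1) / 2) (p / (p - 1)) * p ≤
        (1 + s / n * (p - 1) / 2) * p := by gcongr
      have : 0 < s / n * (p - 1) * p := by
        have : 0 < p - 1 := by linarith
        positivity
      nlinarith
  · have hq : qStar p = 1 := max_eq_left (by linarith)
    have h4 : 1 < p - 1 + s / n * p := by
      have : s / n * (1 - p) < 0 := mul_neg_of_pos_of_neg hsn0 (by linarith)
      nlinarith
    obtain ⟨τ, h5, h6⟩ := exists_between (lt_min h4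
      (by rw [one_lt_div (by linarith)]; linarith : 1 < 1 / (p - 1)))
    have h7 := h6.trans_le (min_le_left _ _)
    have h8 := h6.trans_le (min_le_right _ _)
    rw [lt_div_iff₀ (by linarith)] at h8
    refine ⟨τ, 1, hn, hs, hs1, hp1, h5, h8.le, hq.le, hp1.le, ?_⟩
    rw [hq, hsp]
    linarith

variable {n : ℕ} {s p τ γ : ℝ}

lemma Exponents.γ_pos (h : Exponents n s p τ γ) : 0 < γ := by
  linarith [h.hqγ, one_le_qStar p]

lemma lintegral_le_dyadic {u : Rn n → ℝ} {S : Set (Rn n)} (hu : Measurable u)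
    (hS : MeasurableSet S) {k d : ℝ} (hd : 0 < d)
    (hγ : 0 ≤ γ) (i₀ : ℕ) :
    ∫⁻ x in S ∩ {x | k + 2 ^ i₀ * (2 * d) < u x}, ENNReal.ofReal ((u x - k) ^ γ) ≤
      ∑' i : ℕ, ENNReal.ofReal ((4 * (2 ^ (i₀ + i) * d)) ^ γ) *
        volume (S ∩ {x | k + 2 * (2 ^ (i₀ + i) * d) < u x}) := by
  set B : ℕ → Set (Rn n) := fun i => S ∩ {x | k + 2 * (2 ^ (i₀ + i) * d) < u x} ∩
    {x | u x - k ≤ 4 * (2 ^ (i₀ + i) * d)} with hB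
  have hsub : S ∩ {x | k + 2 ^ i₀ * (2 * d) < u x} ⊆ ⋃ i, B i := by
    rintro x ⟨hxS, hx⟩
    have hx' : k + 2 ^ i₀ * (2 * d) < u x := hx
    have hD : 0 < 2 ^ i₀ * (2 * d) := by positivity
    obtain ⟨i, hi1, hi2⟩ := exists_nat_pow_near (x := (u x - k) / (2 ^ i₀ * (2 * d))) (y := 2)
      (by rw [one_le_div hD]; linarith) one_lt_two
    rw [le_div_iff₀ hD] at hi1
    rw [div_lt_iff₀ hD] at hi2
    rcases hi1.eq_or_lt with he | hl
    · rcases i with _ | i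
      · simp at he; linarith
      · refine mem_iUnion.2 ⟨i, ⟨hxS, ?_⟩, ?_⟩
        · show k + 2 * (2 ^ (i₀ + i) * d) < u x
          have : 2 ^ (i + 1) * (2 ^ i₀ * (2 * d)) = 4 * (2 ^ (i₀ + i) * d) := by ring
          have : 0 < (2 : ℝ) ^ (i₀ + i) * d := by positivity
          linarith
        · show u x - k ≤ 4 * (2 ^ (i₀ + i) * d)
          rw [← he]; apply le_of_eq; ring
    · refine mem_iUnion.2 ⟨i, ⟨hxS, ?_⟩, ?_⟩
      · show k + 2 * (2 ^ (i₀ + i) * d) < u x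
        have : 2 ^ i * (2 ^ i₀ * (2 * d)) = 2 * (2 ^ (i₀ + i) * d) := by ring
        linarith
      · show u x - k ≤ 4 * (2 ^ (i₀ + i) * d)
        refine hi2.le.trans (le_of_eq ?_)
        ring
  refine (lintegral_mono_set hsub).trans ((lintegral_iUnion_le _ _).trans ?_)
  refine ENNReal.tsum_le_tsum fun i => ?_
  calc ∫⁻ x in B i, ENNReal.ofReal ((u x - k) ^ γ)
      ≤ ∫⁻ x in B i, ENNReal.ofReal ((4 * (2 ^ (i₀ + i) * d)) ^ γ) := by
        refine setLIntegral_mono' ((hS.inter (measurableSet_lt measurable_const hu)).inter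
          (measurableSet_le (hu.sub_const _) measurable_const)) fun x hx => ?_
        have h1 : k + 2 * (2 ^ (i₀ + i) * d) < u x := hx.1.2
        have h2 : u x - k ≤ 4 * (2 ^ (i₀ + i) * d) := hx.2
        have : 0 < (2 : ℝ) ^ (i₀ + i) * d := by positivity
        have h3 : 0 ≤ u x - k := by linarith
        gcongr
    _ ≤ _ := by
        rw [setLIntegral_const]
        gcongr
        exact inter_subset_left

lemma exists_layer (he : Exponents n s p τ γ) {q : ℝ} (hq : p - 1 ≤ q)
    (hqγ : γ < p - τ + s * p / n * q) :
    ∃ C > (0 : ℝ), ∃ κ > (0 : ℝ), ∀ (u : Rn n → ℝ) (k d ρ R : ℝ) (V : ℝ≥0∞) (i₀ : ℕ), Measurable u → 0 < d →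
      0 < ρ → ρ < R →
      (∀ t, d ≤ t → volume (ball 0 R ∩ {x | k + t < u x}) ≤ ENNReal.ofReal (t ^ (-q)) * V) →
      ∫⁻ x in ball 0 ρ ∩ {x | k + 2 ^ i₀ * (2 * d) < u x}, ENNReal.ofReal ((u x - k) ^ γ) ≤
        ENNReal.ofReal (C * ((2 : ℝ) ^ (-κ)) ^ i₀) * (V ^ (s * p / n) *
          ENNReal.ofReal (d ^ (γ - q * (s * p / n) - (p - 1))) * truncEnergy n s p τ u k d ρ +
          ENNReal.ofReal ((R - ρ) ^ (-(s * p)) * d ^ (γ - q * (1 + s * p / n))) *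
            V ^ (1 + s * p / n)) := by
  obtain ⟨C, hC, hlev⟩ := exists_level (n := n) he.hs he.hp he.hτ he.hn
  have hp := he.hp
  have hs := he.hs
  have hτ := he.hτ
  have hγ0 := he.γ_pos
  have hn0 : (0 : ℝ) < n := by have := he.hn; positivity
  set β := s * p / n with hβ
  have hβ0 : 0 < β := by positivity
  set e₁ := γ - q * β - p + τ with he₁
  set e₂ := γ - q * (1 + β) with he₂
  set κ := min (-e₁) (-e₂) with hκ
  have hκ0 : 0 < κ := lt_min (by rw [he₁]; linarith) (by rw [he₂]; nlinarith)
  have hr1 : (2 : ℝ) ^ (-κ) < 1 := Real.rpow_lt_one_of_one_lt_of_neg one_lt_two (by linarith)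
  have hr0 : (0 : ℝ) < 2 ^ (-κ) := by positivity
  refine ⟨4 ^ γ * C * (1 - 2 ^ (-κ))⁻¹, by have : 0 < 1 - (2 : ℝ) ^ (-κ) := by linarith
                                           positivity, κ, hκ0, ?_⟩
  intro u k d ρ R V i₀ hu hd hρ hR hV
  set X := V ^ β * ENNReal.ofReal (d ^ (γ - q * β - (p - 1))) * truncEnergy n s p τ u k d ρ +
          ENNReal.ofReal ((R - ρ) ^ (-(s * p)) * d ^ e₂) * V ^ (1 + β) with hX
  have hg : 0 < R - ρ := by linarith
  have key : ∀ i : ℕ, ENNReal.ofReal ((4 * (2 ^ (i₀ + i) * d)) ^ γ) *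
        volume (ball 0 ρ ∩ {x | k + 2 * (2 ^ (i₀ + i) * d) < u x}) ≤
      ENNReal.ofReal (4 ^ γ * C * (2 ^ (-κ)) ^ i₀) * X * ENNReal.ofReal (2 ^ (-κ)) ^ i := by
    intro i
    set j := i₀ + i with hj
    have h2j : (1 : ℝ) ≤ 2 ^ j := one_le_pow₀ one_le_two
    set t := 2 ^ j * d with ht
    have ht0 : 0 < t := by positivity
    have hdt : d ≤ t := le_mul_of_one_le_left hd.le h2j
    have htd : t / d = 2 ^ j := by rw [ht]; field_simp
    have hpow : ∀ e ≤ -κ, ((2 : ℝ) ^ j) ^ e ≤ (2 ^ (-κ)) ^ j := by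
      intro e hee
      rw [← Real.rpow_mul_natCast (by norm_num), ← Real.rpow_natCast_mul (by norm_num)]
      refine Real.rpow_le_rpow_of_exponent_le one_le_two ?_
      rw [mul_comm]
      gcongr
    have hα := hV t hdt
    have hl := hlev u k d t ρ R hu hd hdt hρ hR
    have hα1 : volume (ball 0 R ∩ {x | k + t < u x}) ^ β ≤
        ENNReal.ofReal (t ^ (-(q * β))) * V ^ β := by
      refine (ENNReal.rpow_le_rpow hα hβ0.le).trans (le_of_eq ?_)
      rw [ENNReal.mul_rpow_of_nonneg _ _ hβ0.le, ENNReal.ofReal_rpow_of_pos (by positivity),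
        ← Real.rpow_mul ht0.le, neg_mul]
    have hα2 : volume (ball 0 R ∩ {x | k + t < u x}) ^ (1 + β) ≤
        ENNReal.ofReal (t ^ (-(q * (1 + β)))) * V ^ (1 + β) := by
      refine (ENNReal.rpow_le_rpow hα (by positivity)).trans (le_of_eq ?_)
      rw [ENNReal.mul_rpow_of_nonneg _ _ (by positivity), ENNReal.ofReal_rpow_of_pos (by positivity),
        ← Real.rpow_mul ht0.le, neg_mul]
    have f1 : t ^ γ * (t ^ (-(q * β)) * (t ^ (-(p - 1)) * (t / d) ^ (τ - 1))) =
        (2 ^ j) ^ e₁ * d ^ (γ - q * β - (p - 1)) := by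
      rw [htd, ← mul_assoc, ← mul_assoc, ← Real.rpow_add ht0, ← Real.rpow_add ht0, ht,
        Real.mul_rpow (by positivity) hd.le, mul_right_comm, ← Real.rpow_add (by positivity)]
      congr 2
      rw [he₁]
      ring
    have f2 : t ^ γ * t ^ (-(q * (1 + β))) = (2 ^ j) ^ e₂ * d ^ e₂ := by
      rw [← Real.rpow_add ht0, ht, Real.mul_rpow (by positivity) hd.le, he₂]
      congr 2
    have hb1 := hpow e₁ (by linarith [min_le_left (-e₁) (-e₂)])
    have hb2 := hpow e₂ (by linarith [min_le_right (-e₁) (-e₂)])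
    calc ENNReal.ofReal ((4 * t) ^ γ) * volume (ball 0 ρ ∩ {x | k + 2 * t < u x})
        ≤ ENNReal.ofReal ((4 * t) ^ γ) * (ENNReal.ofReal C *
          (ENNReal.ofReal (t ^ (-(q * β))) * V ^ β *
            ENNReal.ofReal (t ^ (-(p - 1)) * (t / d) ^ (τ - 1)) * truncEnergy n s p τ u k d ρ +
          ENNReal.ofReal ((R - ρ) ^ (-(s * p))) *
            (ENNReal.ofReal (t ^ (-(q * (1 + β)))) * V ^ (1 + β)))) := by
          gcongr
          exact hl.trans (by gcongr)
      _ = ENNReal.ofReal (4 ^ γ * C) * (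
            ENNReal.ofReal (t ^ γ * (t ^ (-(q * β)) * (t ^ (-(p - 1)) * (t / d) ^ (τ - 1)))) *
              (V ^ β * truncEnergy n s p τ u k d ρ) +
            ENNReal.ofReal ((R - ρ) ^ (-(s * p))) *
              ENNReal.ofReal (t ^ γ * t ^ (-(q * (1 + β)))) * V ^ (1 + β)) := by
          rw [Real.mul_rpow (by norm_num) ht0.le, ENNReal.ofReal_mul (p := 4 ^ γ) (by positivity),
            ENNReal.ofReal_mul (p := 4 ^ γ) (by positivity),
            ENNReal.ofReal_mul (p := t ^ γ) (by positivity),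
            ENNReal.ofReal_mul (p := t ^ γ) (by positivity),
            ENNReal.ofReal_mul (p := t ^ (-(q * β))) (by positivity)]
          ring
      _ ≤ ENNReal.ofReal (4 ^ γ * C) * (
            ENNReal.ofReal ((2 ^ (-κ)) ^ j * d ^ (γ - q * β - (p - 1))) *
              (V ^ β * truncEnergy n s p τ u k d ρ) +
            ENNReal.ofReal ((R - ρ) ^ (-(s * p))) *
              ENNReal.ofReal ((2 ^ (-κ)) ^ j * d ^ e₂) * V ^ (1 + β)) := by
          rw [f1, f2]
          gcongr
      _ = _ := by
          rw [hX, ← ENNReal.ofReal_pow hr0.le, hj, pow_add,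
            ENNReal.ofReal_mul (p := (2 ^ (-κ)) ^ i₀ * (2 ^ (-κ)) ^ i) (by positivity),
            ENNReal.ofReal_mul (p := (2 ^ (-κ)) ^ i₀ * (2 ^ (-κ)) ^ i) (by positivity),
            ENNReal.ofReal_mul (p := (2 ^ (-κ)) ^ i₀) (by positivity),
            ENNReal.ofReal_mul (p := (R - ρ) ^ (-(s * p))) (by positivity),
            ENNReal.ofReal_mul (p := 4 ^ γ * C) (by positivity)]
          ring
  refine (lintegral_le_dyadic hu measurableSet_ball hd hγ0.le i₀).trans
    ((ENNReal.tsum_le_tsum key).trans (le_of_eq ?_))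
  rw [ENNReal.tsum_mul_left, ENNReal.tsum_geometric,
    show (1 - ENNReal.ofReal (2 ^ (-κ)))⁻¹ = ENNReal.ofReal (1 - 2 ^ (-κ))⁻¹ by
      rw [ENNReal.ofReal_inv_of_pos (by linarith), ENNReal.ofReal_sub _ hr0.le,
        ENNReal.ofReal_one]]
  rw [mul_right_comm, ← ENNReal.ofReal_mul (by positivity)]
  congr 2
  ring

end Layer

section DeGiorgi

variable {n : ℕ} {s p τ γ C : ℝ} {u : Rn n → ℝ}

lemma Cacc.mono {x₀ : Rn n} {r : ℝ} {δ δ' : ℝ≥0∞} (h : Cacc n s p τ γ C u x₀ r δ) (hδ : δ ≤ δ') :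
    Cacc n s p τ γ C u x₀ r δ' := fun k d ρ R hd hρ hR hr =>
  (h k d ρ R hd hρ hR hr).trans (by gcongr)

lemma Cacc.energy_le {δ : ℝ≥0∞} {k d ρ R : ℝ} (h : Cacc n s p τ γ C u 0 1 δ) (hC : 0 < C)
    (hs : 0 < s) (hp : 1 < p) (hd : 0 < d) (hρ : 1 / 2 ≤ ρ) (hρR : ρ < R) (hR : R ≤ 1) :
    truncEnergy n s p τ u k d ρ ≤ ENNReal.ofReal (C * 2 ^ (s * p) *
      (R - ρ) ^ (-((n : ℝ) + s * p + p))) * (ENNReal.ofReal (d ^ (p - 1)) *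
        (∫⁻ x in ball 0 R ∩ {x | k < u x}, ENNReal.ofReal ((1 + (u x - k) / d) ^ γ)) +
        volume (ball 0 R ∩ {x | k < u x}) *
          (∫⁻ y in (ball 0 (1 / 2))ᶜ,
            ENNReal.ofReal (max (u y - k) 0 ^ (p - 1) * ‖y‖ ^ (-((n : ℝ) + s * p)))) + δ) := by
  have hg : 0 < R - ρ := by linarith
  have hR0 : 0 < R := by linarith
  have h1 : (R / (R - ρ)) ^ ((n : ℝ) + s * p + p) ≤ (R - ρ) ^ (-((n : ℝ) + s * p + p)) := by
    rw [Real.rpow_neg hg.le, ← Real.inv_rpow hg.le, ← one_div]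
    gcongr
  have h2 : R ^ (-(s * p)) ≤ 2 ^ (s * p) := by
    rw [Real.rpow_neg hR0.le, ← Real.inv_rpow hR0.le]
    gcongr
    rw [inv_le_comm₀ hR0 (by norm_num)]
    linarith
  have h2' : (1 : ℝ) ≤ 2 ^ (s * p) := Real.one_le_rpow one_le_two (by positivity)
  refine (h k d ρ R hd (by linarith) hρR hR).trans ?_
  simp only [sub_zero]
  calc _ ≤ ENNReal.ofReal (C * (R - ρ) ^ (-((n : ℝ) + s * p + p))) *
        (ENNReal.ofReal (2 ^ (s * p) * d ^ (p - 1)) *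
        (∫⁻ x in ball 0 R ∩ {x | k < u x}, ENNReal.ofReal ((1 + (u x - k) / d) ^ γ)) +
        ENNReal.ofReal (2 ^ (s * p)) * (volume (ball 0 R ∩ {x | k < u x}) *
          (∫⁻ y in (ball 0 (1 / 2))ᶜ,
            ENNReal.ofReal (max (u y - k) 0 ^ (p - 1) * ‖y‖ ^ (-((n : ℝ) + s * p))))) +
          ENNReal.ofReal (2 ^ (s * p)) * δ) := by
        have h3 : 1 ≤ ENNReal.ofReal (2 ^ (s * p)) := by
          rwa [← ENNReal.ofReal_one, ENNReal.ofReal_le_ofReal_iff (by positivity)]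
        refine mul_le_mul' (by gcongr) (add_le_add (add_le_add (by gcongr) ?_) ?_)
        · refine le_trans ?_ (le_mul_of_one_le_left' h3)
          gcongr
          linarith
        · exact le_mul_of_one_le_left' h3
    _ = _ := by
        rw [mul_right_comm, ENNReal.ofReal_mul (q := 2 ^ (s * p)) (by positivity),
          ENNReal.ofReal_mul (p := 2 ^ (s * p)) (by positivity)]
        ring

lemma measure_superlevel_le {S : Set (Rn n)} (hu : Measurable u)
    {k t q : ℝ} (ht : 0 < t) (hq : 0 < q) :
    volume (S ∩ {x | k + t < u x}) ≤
      ENNReal.ofReal (t ^ (-q)) * ∫⁻ x in S, ENNReal.ofReal (max (u x - k) 0 ^ q) := by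
  have hm : MeasurableSet {x | k + t < u x} := measurableSet_lt measurable_const hu
  have h1 : ENNReal.ofReal (t ^ q) * volume (S ∩ {x | k + t < u x}) ≤
      ∫⁻ x in S, ENNReal.ofReal (max (u x - k) 0 ^ q) := by
    rw [inter_comm, ← Measure.restrict_apply hm]
    refine le_trans ?_ (mul_meas_ge_le_lintegral₀ (by fun_prop) (ENNReal.ofReal (t ^ q)))
    refine mul_le_mul' le_rfl (measure_mono fun x (hx : k + t < u x) => ?_)
    refine ENNReal.ofReal_le_ofReal (Real.rpow_le_rpow ht.le ?_ hq.le)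
    exact le_max_of_le_left (by linarith)
  calc volume (S ∩ {x | k + t < u x})
      = ENNReal.ofReal (t ^ (-q)) * (ENNReal.ofReal (t ^ q) *
          volume (S ∩ {x | k + t < u x})) := by
        rw [← mul_assoc, ← ENNReal.ofReal_mul (by positivity), ← Real.rpow_add ht,
          neg_add_cancel, Real.rpow_zero, ENNReal.ofReal_one, one_mul]
    _ ≤ _ := by gcongr

lemma exists_degiorgi_step (he : Exponents n s p τ γ) (hC : 0 < C) :
    ∃ C' > 0, ∀ (u : Rn n → ℝ) (k d ρ R : ℝ) (δ M : ℝ≥0∞), Measurable u →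
      Cacc n s p τ γ C u 0 1 δ → 0 ≤ k → 0 < d → d ≤ 1 → 1 / 2 ≤ ρ → ρ < R → R ≤ 1 →
      ∫⁻ y in (ball 0 (1 / 2))ᶜ,
        ENNReal.ofReal (max (u y) 0 ^ (p - 1) * ‖y‖ ^ (-((n : ℝ) + s * p))) ≤ M →
      ∫⁻ x in ball 0 ρ, ENNReal.ofReal (max (u x - (k + 3 * d)) 0 ^ γ) ≤
        ENNReal.ofReal (C' * (R - ρ) ^ (-((n : ℝ) + s * p + p)) *
          d ^ (-(γ * (s * p / n) + (p - 1)))) * (1 + M) *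
          ((∫⁻ x in ball 0 R, ENNReal.ofReal (max (u x - k) 0 ^ γ)) ^ (s * p / n) *
            ((∫⁻ x in ball 0 R, ENNReal.ofReal (max (u x - k) 0 ^ γ)) + δ)) := by
  have hγ0 := he.γ_pos
  have hp := he.hp
  have hs := he.hs
  have hn0 : (0 : ℝ) < n := by have := he.hn; positivity
  have hqγ := he.hqγ
  have hβ0 : 0 < s * p / n := by positivity
  obtain ⟨C₂, hC₂, κ, hκ, hlay⟩ := exists_layer he (q := γ)
    (by linarith [sub_one_le_qStar p]) (by nlinarith [he.hγ])
  set β := s * p / n with hβ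
  set Q := (n : ℝ) + s * p + p with hQ
  refine ⟨C₂ * (C * 2 ^ (s * p) + 1), by positivity, ?_⟩
  intro u k d ρ R δ M hu h hk hd hd1 hρ hρR hR hM
  have hg : 0 < R - ρ := by linarith
  have hg1 : R - ρ ≤ 1 := by linarith
  set Y := ∫⁻ x in ball 0 R, ENNReal.ofReal (max (u x - k) 0 ^ γ) with hY
  have hvol : ∀ t, d ≤ t → volume (ball 0 R ∩ {x | k + d + t < u x}) ≤
      ENNReal.ofReal (t ^ (-γ)) * Y := by
    intro t ht
    refine le_trans (measure_mono ?_) (measure_superlevel_le hu (hd.trans_le ht) hγ0)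
    refine inter_subset_inter_right _ fun x (hx : k + d + t < u x) => ?_
    show k + t < u x
    linarith
  have hl := hlay u (k + d) d ρ R Y 0 hu hd (by linarith) hρR hvol
  rw [pow_zero, pow_zero, mul_one] at hl
  have hE : truncEnergy n s p τ u (k + d) d ρ ≤
      ENNReal.ofReal (C * 2 ^ (s * p) * (R - ρ) ^ (-Q)) * ENNReal.ofReal (d ^ (-γ)) *
        ((1 + M) * (Y + δ)) := by
    refine (h.energy_le (k := k + d) hC hs hp hd hρ hρR hR).trans ?_
    refine le_trans (mul_le_mul' le_rfl ?_) (mul_assoc _ _ _).ge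
    have e1 : ∫⁻ x in ball 0 R ∩ {x | k + d < u x}, ENNReal.ofReal ((1 + (u x - (k + d)) / d) ^ γ)
        ≤ ENNReal.ofReal (d ^ (-γ)) * Y := by
      rw [hY, ← lintegral_const_mul _ (by fun_prop)]
      refine le_trans ?_ (lintegral_mono_set (inter_subset_left (t := {x | k + d < u x})))
      refine setLIntegral_mono' (measurableSet_ball.inter (measurableSet_lt measurable_const hu))
        fun x hx => ?_
      have hx : k + d < u x := hx.2
      rw [← ENNReal.ofReal_mul (by positivity)]
      refine ENNReal.ofReal_le_ofReal ?_
      rw [show 1 + (u x - (k + d)) / d = (u x - k) / d by field_simp; ring,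
        max_eq_left (by linarith), Real.div_rpow (by linarith) hd.le, Real.rpow_neg hd.le,
        div_eq_inv_mul]
    have e2 : volume (ball 0 R ∩ {x | k + d < u x}) ≤ ENNReal.ofReal (d ^ (-γ)) * Y :=
      measure_superlevel_le hu hd hγ0
    have e3 : ∫⁻ y in (ball 0 (1 / 2))ᶜ, ENNReal.ofReal (max (u y - (k + d)) 0 ^ (p - 1) *
        ‖y‖ ^ (-((n : ℝ) + s * p))) ≤ M := by
      refine le_trans (lintegral_mono fun y => ENNReal.ofReal_le_ofReal ?_) hM
      gcongr
      linarith
    have e4 : ENNReal.ofReal (d ^ (p - 1)) ≤ 1 := by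
      rw [ENNReal.ofReal_le_one]
      exact Real.rpow_le_one hd.le hd1 (by linarith)
    have e5 : 1 ≤ ENNReal.ofReal (d ^ (-γ)) := by
      rw [ENNReal.one_le_ofReal]
      exact Real.one_le_rpow_of_pos_of_le_one_of_nonpos hd hd1 (by linarith)
    calc _ ≤ 1 * (ENNReal.ofReal (d ^ (-γ)) * Y) + ENNReal.ofReal (d ^ (-γ)) * Y * M +
          ENNReal.ofReal (d ^ (-γ)) * (1 * δ) := by
          refine add_le_add (add_le_add (mul_le_mul' e4 e1) (mul_le_mul' e2 e3)) ?_
          rw [one_mul]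
          exact le_mul_of_one_le_left' e5
      _ ≤ 1 * (ENNReal.ofReal (d ^ (-γ)) * Y) + ENNReal.ofReal (d ^ (-γ)) * Y * M +
          ENNReal.ofReal (d ^ (-γ)) * ((1 + M) * δ) := by
          gcongr
          exact le_self_add
      _ = _ := by ring
  have hset : ∫⁻ x in ball 0 ρ, ENNReal.ofReal (max (u x - (k + 3 * d)) 0 ^ γ) ≤
      ∫⁻ x in ball 0 ρ ∩ {x | k + d + 1 * (2 * d) < u x}, ENNReal.ofReal ((u x - (k + d)) ^ γ) := by
    have hm : MeasurableSet {x | k + d + 1 * (2 * d) < u x} := measurableSet_lt measurable_const hu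
    rw [inter_comm, ← Measure.restrict_restrict hm, ← lintegral_indicator hm]
    refine lintegral_mono fun x => ?_
    by_cases hx : k + d + 1 * (2 * d) < u x
    · rw [indicator_of_mem (by exact hx)]
      refine ENNReal.ofReal_le_ofReal (Real.rpow_le_rpow (le_max_right _ _) ?_ hγ0.le)
      exact max_le (by linarith) (by linarith)
    · rw [max_eq_right (by linarith), Real.zero_rpow hγ0.ne', ENNReal.ofReal_zero]
      exact zero_le
  have f1 : d ^ (γ - γ * β - (p - 1)) * d ^ (-γ) = d ^ (-(γ * β + (p - 1))) := by
    rw [← Real.rpow_add hd]; congr 1; ring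
  have f2 : d ^ (γ - γ * (1 + β)) ≤ d ^ (-(γ * β + (p - 1))) := by
    refine Real.rpow_le_rpow_of_exponent_ge hd hd1 ?_
    linarith
  have f3 : (R - ρ) ^ (-(s * p)) ≤ (R - ρ) ^ (-Q) := by
    refine Real.rpow_le_rpow_of_exponent_ge hg hg1 ?_
    rw [hQ]; linarith
  set D := d ^ (-(γ * β + (p - 1))) with hD
  have hD0 : 0 < D := by positivity
  refine hset.trans (hl.trans ?_)
  calc ENNReal.ofReal C₂ * (Y ^ β * ENNReal.ofReal (d ^ (γ - γ * β - (p - 1))) *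
          truncEnergy n s p τ u (k + d) d ρ +
          ENNReal.ofReal ((R - ρ) ^ (-(s * p)) * d ^ (γ - γ * (1 + β))) * Y ^ (1 + β))
      ≤ ENNReal.ofReal C₂ * (Y ^ β * ENNReal.ofReal (d ^ (γ - γ * β - (p - 1))) *
          (ENNReal.ofReal (C * 2 ^ (s * p) * (R - ρ) ^ (-Q)) * ENNReal.ofReal (d ^ (-γ)) *
        ((1 + M) * (Y + δ))) +
          ENNReal.ofReal ((R - ρ) ^ (-Q) * D) * (Y ^ β * ((1 + M) * (Y + δ)))) := by
        gcongr
        rw [add_comm, ENNReal.rpow_add_of_nonneg _ _ hβ0.le zero_le_one, ENNReal.rpow_one]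
        gcongr
        exact le_mul_of_one_le_of_le le_self_add le_self_add
    _ = ENNReal.ofReal (C₂ * (C * 2 ^ (s * p) + 1)) * ENNReal.ofReal ((R - ρ) ^ (-Q)) *
        ENNReal.ofReal D * (1 + M) * (Y ^ β * (Y + δ)) := by
        rw [← f1, ENNReal.ofReal_mul (p := d ^ (γ - γ * β - (p - 1))) (by positivity),
          ENNReal.ofReal_mul (p := (R - ρ) ^ (-Q)) (by positivity),
          ENNReal.ofReal_mul (p := C₂) (by positivity),
          ENNReal.ofReal_mul (p := d ^ (γ - γ * β - (p - 1))) (by positivity),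
          ENNReal.ofReal_mul (p := C * 2 ^ (s * p)) (by positivity),
          ENNReal.ofReal_add (by positivity) (by positivity), ENNReal.ofReal_one]
        ring
    _ = _ := by
        rw [← ENNReal.ofReal_mul (by positivity), ← ENNReal.ofReal_mul (by positivity)]

lemma exists_degiorgi (he : Exponents n s p τ γ) (hC : 0 < C) {M : ℝ} (hM : 0 ≤ M) :
    ∃ ν > 0, ∀ ε > 0, ∃ δ > 0, ∀ u : Rn n → ℝ, Measurable u →
      Cacc n s p τ γ C u 0 1 (ENNReal.ofReal δ) →
      ∫⁻ x in ball 0 1, ENNReal.ofReal (max (u x) 0 ^ γ) ≤ ENNReal.ofReal ν →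
      ∫⁻ y in (ball 0 (1 / 2))ᶜ,
        ENNReal.ofReal (max (u y) 0 ^ (p - 1) * ‖y‖ ^ (-((n : ℝ) + s * p))) ≤ ENNReal.ofReal M →
      ∫⁻ x in ball 0 (1 / 2), ENNReal.ofReal (max (u x - 1) 0 ^ γ) ≤ ENNReal.ofReal ε := by
  obtain ⟨C₁, hC₁, hstep⟩ := exists_degiorgi_step he hC
  have hγ0 := he.γ_pos
  have hp := he.hp
  have hs := he.hs
  have hn0 : (0 : ℝ) < n := by have := he.hn; positivity
  set β := s * p / n with hβ
  have hβ0 : 0 < β := by positivity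
  set Q := (n : ℝ) + s * p + p with hQ
  have hQ0 : 0 < Q := by positivity
  set Q' := γ * β + (p - 1) with hQ'
  have hQ'0 : 0 < Q' := by have := mul_pos hγ0 hβ0; linarith
  set b : ℝ := 2 ^ (Q + Q') with hb
  have hb1 : 1 < b := Real.one_lt_rpow one_lt_two (by linarith)
  have hb0 : 0 < b := by linarith
  set A := C₁ * (4 ^ Q * 6 ^ Q') * (1 + M) with hA
  have hA0 : 0 < A := by positivity
  set θ := b ^ (-β⁻¹) with hθ
  have hθ0 : 0 < θ := by positivity
  have hθ1 : θ < 1 := Real.rpow_lt_one_of_one_lt_of_neg hb1 (by simpa using hβ0)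
  have hbθ : b * θ ^ β = 1 := by
    rw [hθ, ← Real.rpow_mul hb0.le, neg_mul, inv_mul_cancel₀ hβ0.ne', Real.rpow_neg_one,
      mul_inv_cancel₀ hb0.ne']
  set ν := (θ / (2 * A)) ^ β⁻¹ with hν
  have hν0 : 0 < ν := by positivity
  have hνβ : A * ν ^ β * 2 = θ := by
    rw [hν, ← Real.rpow_mul (by positivity), inv_mul_cancel₀ hβ0.ne', Real.rpow_one]
    field_simp
  refine ⟨ν, hν0, fun ε hε => ?_⟩
  obtain ⟨N, hN⟩ := exists_pow_lt_of_lt_one (div_pos hε hν0) hθ1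
  rw [lt_div_iff₀' hν0] at hN
  refine ⟨ν * θ ^ N, by positivity, ?_⟩
  intro u hu h hY0 htail
  have claim : ∀ j ≤ N, ∫⁻ x in ball 0 (1 / 2 + (1 / 2) ^ (j + 1)),
      ENNReal.ofReal (max (u x - (1 - (1 / 2) ^ j)) 0 ^ γ) ≤ ENNReal.ofReal (ν * θ ^ j) := by
    intro j
    induction j with
    | zero =>
      intro _
      norm_num
      exact hY0
    | succ j ih =>
      intro hj
      have hY := ih (by omega)
      set d : ℝ := (1 / 2) ^ j / 6 with hd
      have hpj : (0 : ℝ) < (1 / 2) ^ j := by positivity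
      have hpj2 : (1 / 2 : ℝ) ^ j = (2 ^ j)⁻¹ := by rw [one_div, inv_pow]
      have hpj1 : (1 / 2 : ℝ) ^ j ≤ 1 := pow_le_one₀ (by norm_num) (by norm_num)
      have hs' := hstep u (1 - (1 / 2) ^ j) d (1 / 2 + (1 / 2) ^ (j + 1 + 1))
        (1 / 2 + (1 / 2) ^ (j + 1)) (ENNReal.ofReal (ν * θ ^ N)) (ENNReal.ofReal M) hu h
        (by linarith) (by positivity) (by linarith) (by simp) (by
          rw [pow_succ _ (j + 1), pow_succ]; linarith) (by rw [pow_succ]; linarith) htail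
      set Y := ∫⁻ x in ball 0 (1 / 2 + (1 / 2) ^ (j + 1)),
        ENNReal.ofReal (max (u x - (1 - (1 / 2) ^ j)) 0 ^ γ) with hYdef
      rw [show 1 - (1 / 2 : ℝ) ^ j + 3 * d = 1 - (1 / 2) ^ (j + 1) by rw [hd, pow_succ]; ring] at hs'
      refine hs'.trans ?_
      have hδ : ν * θ ^ N ≤ ν * θ ^ j :=
        mul_le_mul_of_nonneg_left (pow_le_pow_of_le_one hθ0.le hθ1.le (by omega)) hν0.le
      have e1 : (1 / 2 + (1 / 2 : ℝ) ^ (j + 1) - (1 / 2 + (1 / 2) ^ (j + 1 + 1))) ^ (-Q) =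
          4 ^ Q * (2 ^ Q) ^ j := by
        rw [show (1 / 2 + (1 / 2 : ℝ) ^ (j + 1) - (1 / 2 + (1 / 2) ^ (j + 1 + 1))) = (4 * 2 ^ j)⁻¹ by
          rw [pow_succ _ (j + 1), pow_succ, hpj2]; field_simp; ring, Real.rpow_neg (by positivity),
          Real.inv_rpow (by positivity), inv_inv, Real.mul_rpow (by norm_num) (by positivity),
          Real.rpow_pow_comm (by norm_num)]
      have e2 : d ^ (-Q') = 6 ^ Q' * (2 ^ Q') ^ j := by
        rw [show d = (6 * 2 ^ j)⁻¹ by rw [hd, hpj2]; field_simp, Real.rpow_neg (by positivity),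
          Real.inv_rpow (by positivity), inv_inv, Real.mul_rpow (by norm_num) (by positivity),
          Real.rpow_pow_comm (by norm_num)]
      rw [e1, e2]
      calc _ ≤ ENNReal.ofReal (C₁ * (4 ^ Q * (2 ^ Q) ^ j) * (6 ^ Q' * (2 ^ Q') ^ j)) *
            (1 + ENNReal.ofReal M) * (ENNReal.ofReal (ν * θ ^ j) ^ β *
              (ENNReal.ofReal (ν * θ ^ j) + ENNReal.ofReal (ν * θ ^ j))) := by gcongr
        _ = ENNReal.ofReal (C₁ * (4 ^ Q * (2 ^ Q) ^ j) * (6 ^ Q' * (2 ^ Q') ^ j) * (1 + M) *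
              ((ν * θ ^ j) ^ β * (ν * θ ^ j + ν * θ ^ j))) := by
            rw [ENNReal.ofReal_rpow_of_pos (by positivity),
              ← ENNReal.ofReal_add (by positivity) (by positivity),
              ← ENNReal.ofReal_mul (by positivity), ← ENNReal.ofReal_one,
              ← ENNReal.ofReal_add zero_le_one hM, ← ENNReal.ofReal_mul (by positivity),
              ← ENNReal.ofReal_mul (by positivity)]
        _ = _ := by
            congr 1
            have e3 : (ν * θ ^ j) ^ β = ν ^ β * (θ ^ β) ^ j := by
              rw [Real.mul_rpow hν0.le (by positivity), Real.rpow_pow_comm hθ0.le]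
            calc C₁ * (4 ^ Q * (2 ^ Q) ^ j) * (6 ^ Q' * (2 ^ Q') ^ j) * (1 + M) *
                  ((ν * θ ^ j) ^ β * (ν * θ ^ j + ν * θ ^ j))
                = (A * ν ^ β * 2) * (b * θ ^ β) ^ j * (ν * θ ^ j) := by
                  rw [e3, hb, Real.rpow_add two_pos Q Q', mul_pow, mul_pow, hA]; ring
              _ = _ := by rw [hνβ, hbθ, one_pow, pow_succ]; ring
  calc _ ≤ ∫⁻ x in ball 0 (1 / 2 + (1 / 2) ^ (N + 1)),
        ENNReal.ofReal (max (u x - (1 - (1 / 2) ^ N)) 0 ^ γ) := by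
        refine (lintegral_mono fun x => ?_).trans (lintegral_mono_set (ball_subset_ball ?_))
        · have : (0 : ℝ) < (1 / 2) ^ N := by positivity
          gcongr
          linarith
        · simp
    _ ≤ _ := (claim N le_rfl).trans (ENNReal.ofReal_le_ofReal hN.le)

end DeGiorgi

section ReverseHolder

lemma exists_iteration_bound {A Q : ℝ} (hA : 0 ≤ A) (hQ : 0 < Q) : ∃ B > 0, ∀ (Z : ℝ → ℝ) (z : ℝ),
    (∀ ρ ≤ 1, Z ρ ≤ z) →
    (∀ ρ R, 1 / 2 ≤ ρ → ρ < R → R ≤ 1 → Z ρ ≤ 1 / 2 * Z R + A * (R - ρ) ^ (-Q)) →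
    Z (1 / 2) ≤ B := by
  set l : ℝ := (3 / 2) ^ (-Q⁻¹) with hl
  have hl0 : 0 < l := by positivity
  have hl1 : l < 1 := Real.rpow_lt_one_of_one_lt_of_neg (by norm_num) (by simpa using hQ)
  have hlQ : l ^ (-Q) = 3 / 2 := by
    rw [hl, ← Real.rpow_mul (by norm_num), neg_mul_neg, inv_mul_cancel₀ hQ.ne', Real.rpow_one]
  set D := A * ((1 - l) / 2) ^ (-Q) with hD
  have h1l : 0 < (1 - l) / 2 := by linarith
  have hD0 : 0 ≤ D := by positivity
  refine ⟨4 * D + 1, by positivity, fun Z z hz hZ => ?_⟩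
  have key : ∀ N : ℕ, Z (1 / 2) ≤ 4 * D * (1 - (3 / 4) ^ N) + (1 / 2) ^ N * Z (1 - l ^ N / 2) := by
    intro N
    induction N with
    | zero => norm_num
    | succ N ih =>
      have hlN : 0 < l ^ N := by positivity
      have hlN1 : l ^ N ≤ 1 := pow_le_one₀ hl0.le hl1.le
      have h := hZ (1 - l ^ N / 2) (1 - l ^ (N + 1) / 2) (by linarith)
        (by rw [pow_succ]; nlinarith) (by have : 0 < l ^ (N + 1) := by positivity
                                          linarith)
      have e : A * (1 - l ^ (N + 1) / 2 - (1 - l ^ N / 2)) ^ (-Q) = D * (3 / 2) ^ N := by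
        rw [show 1 - l ^ (N + 1) / 2 - (1 - l ^ N / 2) = (1 - l) / 2 * l ^ N by rw [pow_succ]; ring,
          Real.mul_rpow h1l.le hlN.le, ← Real.rpow_pow_comm hl0.le, hlQ, hD]
        ring
      rw [e] at h
      calc Z (1 / 2) ≤ 4 * D * (1 - (3 / 4) ^ N) + (1 / 2) ^ N * Z (1 - l ^ N / 2) := ih
        _ ≤ 4 * D * (1 - (3 / 4) ^ N) + (1 / 2) ^ N *
            (1 / 2 * Z (1 - l ^ (N + 1) / 2) + D * (3 / 2) ^ N) := by gcongr
        _ = 4 * D * (1 - (3 / 4) ^ (N + 1)) + (1 / 2) ^ (N + 1) * Z (1 - l ^ (N + 1) / 2) := by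
            have : (1 / 2 : ℝ) ^ N * (3 / 2) ^ N = (3 / 4) ^ N := by rw [← mul_pow]; norm_num
            rw [pow_succ (3 / 4 : ℝ), pow_succ (1 / 2 : ℝ), mul_add,
              show (1 / 2 : ℝ) ^ N * (D * (3 / 2) ^ N) = D * ((1 / 2 : ℝ) ^ N * (3 / 2) ^ N) by ring,
              this]
            ring
  have key2 : ∀ N : ℕ, Z (1 / 2) ≤ 4 * D + (1 / 2) ^ N * z := fun N => by
    have h1 : Z (1 - l ^ N / 2) ≤ z := hz _ (by have : 0 < l ^ N := by positivity
                                                linarith)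
    have h2 : 0 ≤ 4 * D * (3 / 4) ^ N := by positivity
    calc _ ≤ _ := key N
      _ ≤ 4 * D * (1 - (3 / 4) ^ N) + (1 / 2) ^ N * z := by gcongr
      _ ≤ _ := by linarith
  have hlim : Tendsto (fun N : ℕ => 4 * D + (1 / 2 : ℝ) ^ N * z) atTop (𝓝 (4 * D + 0 * z)) :=
    ((tendsto_pow_atTop_nhds_zero_of_lt_one (by norm_num) (by norm_num)).mul_const z).const_add _
  have := ge_of_tendsto' hlim key2
  linarith

variable {n : ℕ} {s p τ γ C : ℝ} {u : Rn n → ℝ}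

/-- `(1 + a) ^ γ ≤ 2 ^ γ (1 + a ^ γ)`. -/
lemma one_add_rpow_le {a γ : ℝ} (ha : 0 ≤ a) (hγ : 0 ≤ γ) :
    (1 + a) ^ γ ≤ 2 ^ γ * (1 + a ^ γ) := by
  rcases le_total a 1 with h | h
  · calc (1 + a) ^ γ ≤ 2 ^ γ := by gcongr; linarith
      _ ≤ _ := le_mul_of_one_le_right (by positivity) (by have : 0 ≤ a ^ γ := by positivity
                                                          linarith)
  · calc (1 + a) ^ γ ≤ (2 * a) ^ γ := by gcongr; linarith
      _ = 2 ^ γ * a ^ γ := Real.mul_rpow (by norm_num) ha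
      _ ≤ _ := by gcongr; linarith

lemma volume_ball_le_one_ofReal {R : ℝ} (hR : R ≤ 1) :
    volume (ball (0 : Rn n) R) ≤ ENNReal.ofReal (volume (ball (0 : Rn n) 1)).toReal := by
  rw [ENNReal.ofReal_toReal measure_ball_lt_top.ne]
  exact measure_mono (ball_subset_ball hR)

lemma exists_truncated_integral_le (he : Exponents n s p τ γ) (hC : 0 < C) {M : ℝ} (hM : 0 ≤ M) :
    ∃ C' ≥ (1 : ℝ), ∃ κ > (0 : ℝ), ∀ (u : Rn n → ℝ) (ρ R : ℝ) (i₀ : ℕ), Measurable u →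
      Cacc n s p τ γ C u 0 1 1 →
      ∫⁻ x in ball 0 1, ENNReal.ofReal (max (u x) 0 ^ qStar p) ≤ 1 →
      ∫⁻ y in (ball 0 (1 / 2))ᶜ,
        ENNReal.ofReal (max (u y) 0 ^ (p - 1) * ‖y‖ ^ (-((n : ℝ) + s * p))) ≤ ENNReal.ofReal M →
      1 / 2 ≤ ρ → ρ < R → R ≤ 1 →
      ∫⁻ x in ball 0 ρ, ENNReal.ofReal (max (u x) 0 ^ γ) ≤
        ENNReal.ofReal (C' * (2 ^ i₀) ^ γ) +
        ENNReal.ofReal (C' * ((2 : ℝ) ^ (-κ)) ^ i₀ * (R - ρ) ^ (-((n : ℝ) + s * p + p))) *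
          ((∫⁻ x in ball 0 R, ENNReal.ofReal (max (u x) 0 ^ γ)) + 1) := by
  have hγ0 := he.γ_pos
  have hp := he.hp
  have hs := he.hs
  have hn0 : (0 : ℝ) < n := by have := he.hn; positivity
  have hq1 := one_le_qStar p
  obtain ⟨C₂, hC₂, κ, hκ, hlay⟩ := exists_layer he (sub_one_le_qStar p) he.hγ
  set Q := (n : ℝ) + s * p + p with hQ
  set ω := (volume (ball (0 : Rn n) 1)).toReal with hω
  have hω0 : 0 < ω := volume_ball_toReal_pos n
  set A := C * 2 ^ (s * p) with hA
  set D := 2 ^ γ * (ω + 1) + ω * M + 1 with hD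
  refine ⟨ω * 2 ^ γ + C₂ * (A * D + 1) + 1, ?_, κ, hκ, ?_⟩
  · have : 0 ≤ ω * 2 ^ γ + C₂ * (A * D + 1) := by positivity
    linarith
  intro u ρ R i₀ hu h hq hT hρ hρR hR
  have hg : 0 < R - ρ := by linarith
  have hg1 : R - ρ ≤ 1 := by linarith
  set Z := ∫⁻ x in ball 0 R, ENNReal.ofReal (max (u x) 0 ^ γ) with hZ
  have hvol : ∀ t : ℝ, 1 ≤ t → volume (ball 0 R ∩ {x | 0 + t < u x}) ≤
      ENNReal.ofReal (t ^ (-qStar p)) * 1 := by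
    intro t ht
    refine (measure_superlevel_le hu (q := qStar p) (by linarith) (by linarith)).trans ?_
    refine mul_le_mul' le_rfl ?_
    simp only [sub_zero]
    exact (lintegral_mono_set (ball_subset_ball hR)).trans hq
  have hl := hlay u 0 1 ρ R 1 i₀ hu one_pos (by linarith) hρR hvol
  have hE : truncEnergy n s p τ u 0 1 ρ ≤ ENNReal.ofReal (A * D * (R - ρ) ^ (-Q)) * (Z + 1) := by
    refine (h.energy_le (k := 0) hC hs hp one_pos hρ hρR hR).trans ?_
    simp only [sub_zero, Real.one_rpow, ENNReal.ofReal_one, one_mul, div_one]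
    have e1 : ∫⁻ x in ball 0 R ∩ {x | 0 < u x}, ENNReal.ofReal ((1 + u x) ^ γ) ≤
        ENNReal.ofReal (2 ^ γ * (ω + 1)) * (Z + 1) := by
      calc ∫⁻ x in ball 0 R ∩ {x | 0 < u x}, ENNReal.ofReal ((1 + u x) ^ γ)
          ≤ ∫⁻ x in ball 0 R ∩ {x | 0 < u x},
              ENNReal.ofReal (2 ^ γ) * (1 + ENNReal.ofReal (max (u x) 0 ^ γ)) := by
            refine setLIntegral_mono' (measurableSet_ball.inter
              (measurableSet_lt measurable_const hu)) fun x hx => ?_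
            have hx : 0 < u x := hx.2
            rw [max_eq_left hx.le, ← ENNReal.ofReal_one,
              ← ENNReal.ofReal_add zero_le_one (by positivity), ← ENNReal.ofReal_mul (by positivity)]
            exact ENNReal.ofReal_le_ofReal (one_add_rpow_le hx.le hγ0.le)
        _ ≤ ∫⁻ x in ball 0 R, ENNReal.ofReal (2 ^ γ) * (1 + ENNReal.ofReal (max (u x) 0 ^ γ)) :=
            lintegral_mono_set inter_subset_left
        _ = ENNReal.ofReal (2 ^ γ) * (volume (ball (0 : Rn n) R) + Z) := by
            rw [lintegral_const_mul _ (by fun_prop), lintegral_add_left (by fun_prop),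
              setLIntegral_const, one_mul]
        _ ≤ ENNReal.ofReal (2 ^ γ) * (ENNReal.ofReal ω + Z) := by
            gcongr
            exact volume_ball_le_one_ofReal hR
        _ ≤ ENNReal.ofReal (2 ^ γ) * ((ENNReal.ofReal ω + 1) * (Z + 1)) := by
            gcongr
            rw [add_mul, mul_add, mul_one, one_mul, add_assoc]
            exact le_add_left (add_le_add_right le_self_add _)
        _ = _ := by
            rw [ENNReal.ofReal_mul (by positivity), ENNReal.ofReal_add hω0.le zero_le_one,
              ENNReal.ofReal_one, mul_assoc]
    have e2 : volume (ball 0 R ∩ {x | 0 < u x}) ≤ ENNReal.ofReal ω :=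
      (measure_mono inter_subset_left).trans (volume_ball_le_one_ofReal hR)
    calc _ ≤ ENNReal.ofReal (A * (R - ρ) ^ (-Q)) * (ENNReal.ofReal (2 ^ γ * (ω + 1)) * (Z + 1) +
          ENNReal.ofReal ω * ENNReal.ofReal M * (Z + 1) + 1 * (Z + 1)) := by
          refine mul_le_mul' le_rfl (add_le_add (add_le_add e1 ?_) ?_)
          · exact (mul_le_mul' e2 hT).trans (le_mul_of_one_le_right' le_add_self)
          · rw [one_mul]; exact le_add_self
      _ = _ := by
          rw [← add_mul, ← add_mul, ← ENNReal.ofReal_mul hω0.le, ← ENNReal.ofReal_one,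
            ← ENNReal.ofReal_add (by positivity) (by positivity),
            ← ENNReal.ofReal_add (by positivity) (by positivity), ← mul_assoc,
            ← ENNReal.ofReal_mul (by positivity)]
          congr 2
          rw [hD]; ring
  have hset : ∫⁻ x in ball 0 ρ, ENNReal.ofReal (max (u x) 0 ^ γ) ≤
      ENNReal.ofReal (ω * 2 ^ γ * (2 ^ i₀) ^ γ) +
      ∫⁻ x in ball 0 ρ ∩ {x | 0 + 2 ^ i₀ * (2 * 1) < u x}, ENNReal.ofReal ((u x - 0) ^ γ) := by
    have hm : MeasurableSet {x | 0 + 2 ^ i₀ * (2 * 1) < u x} := measurableSet_lt measurable_const hu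
    rw [inter_comm, ← Measure.restrict_restrict hm, ← lintegral_indicator hm]
    have e1 : ENNReal.ofReal (2 ^ γ * (2 ^ i₀) ^ γ) * volume (ball (0 : Rn n) ρ) ≤
        ENNReal.ofReal (ω * 2 ^ γ * (2 ^ i₀) ^ γ) := by
      rw [mul_assoc, mul_comm ω, ENNReal.ofReal_mul (q := ω) (by positivity)]
      exact mul_le_mul' le_rfl (volume_ball_le_one_ofReal (by linarith))
    refine le_trans ?_ (add_le_add e1 le_rfl)
    rw [← setLIntegral_const, ← lintegral_add_left (by fun_prop)]
    refine lintegral_mono fun x => ?_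
    by_cases hx : 0 + 2 ^ i₀ * (2 * 1) < u x
    · rw [indicator_of_mem (by exact hx)]
      refine le_add_left (ENNReal.ofReal_le_ofReal ?_)
      have : (0 : ℝ) < 2 ^ i₀ := by positivity
      rw [sub_zero, max_eq_left (by linarith)]
    · refine le_add_right (ENNReal.ofReal_le_ofReal ?_)
      rw [← Real.mul_rpow (by norm_num) (by positivity)]
      refine Real.rpow_le_rpow (le_max_right _ _) (max_le ?_ (by positivity)) hγ0.le
      linarith
  refine hset.trans ?_
  have hlast : ∫⁻ x in ball 0 ρ ∩ {x | 0 + 2 ^ i₀ * (2 * 1) < u x}, ENNReal.ofReal ((u x - 0) ^ γ) ≤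
      ENNReal.ofReal (C₂ * (A * D + 1) * (2 ^ (-κ)) ^ i₀ * (R - ρ) ^ (-Q)) * (Z + 1) := by
    refine hl.trans ?_
    simp only [Real.one_rpow, ENNReal.one_rpow, ENNReal.ofReal_one, mul_one, one_mul]
    have f3 : (R - ρ) ^ (-(s * p)) ≤ (R - ρ) ^ (-Q) := by
      refine Real.rpow_le_rpow_of_exponent_ge hg hg1 ?_
      rw [hQ]; linarith
    calc _ ≤ ENNReal.ofReal (C₂ * (2 ^ (-κ)) ^ i₀) *
          (ENNReal.ofReal (A * D * (R - ρ) ^ (-Q)) * (Z + 1) +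
            ENNReal.ofReal ((R - ρ) ^ (-Q)) * (Z + 1)) := by
          gcongr
          exact (ENNReal.ofReal_le_ofReal f3).trans (le_mul_of_one_le_right' le_add_self)
      _ = _ := by
          rw [← add_mul, ← ENNReal.ofReal_add (by positivity) (by positivity), ← mul_assoc,
            ← ENNReal.ofReal_mul (by positivity)]
          congr 2
          ring
  refine add_le_add (ENNReal.ofReal_le_ofReal ?_) (hlast.trans ?_)
  · gcongr
    have : 0 ≤ C₂ * (A * D + 1) := by positivity
    linarith
  · gcongr
    have : 0 ≤ ω * 2 ^ γ := by positivity
    linarith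

lemma exists_reverse_holder (he : Exponents n s p τ γ) (hC : 0 < C) {M : ℝ} (hM : 0 ≤ M) :
    ∃ B > 0, ∀ u : Rn n → ℝ, Measurable u → Cacc n s p τ γ C u 0 1 1 →
      ∫⁻ x in ball 0 1, ENNReal.ofReal (max (u x) 0 ^ γ) < ⊤ →
      ∫⁻ x in ball 0 1, ENNReal.ofReal (max (u x) 0 ^ qStar p) ≤ 1 →
      ∫⁻ y in (ball 0 (1 / 2))ᶜ,
        ENNReal.ofReal (max (u y) 0 ^ (p - 1) * ‖y‖ ^ (-((n : ℝ) + s * p))) ≤ ENNReal.ofReal M →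
      ∫⁻ x in ball 0 (1 / 2), ENNReal.ofReal (max (u x) 0 ^ γ) ≤ ENNReal.ofReal B := by
  have hγ0 := he.γ_pos
  have hp := he.hp
  have hs := he.hs
  have hn0 : (0 : ℝ) < n := by have := he.hn; positivity
  obtain ⟨C₁, hC₁, κ, hκ, hint⟩ := exists_truncated_integral_le he hC hM
  set Q := (n : ℝ) + s * p + p with hQ
  have hQ0 : 0 < Q := by positivity
  set b : ℝ := 2 ^ κ with hb
  have hb1 : 1 < b := Real.one_lt_rpow one_lt_two hκ
  have hb0 : 0 < b := by linarith
  set Q₂ := Q * (γ / κ) with hQ₂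
  have hQ₂0 : 0 < Q₂ := by positivity
  set A := C₁ * (2 * C₁ * b) ^ (γ / κ) + 1 / 2 with hA
  obtain ⟨B, hB, hiter⟩ := exists_iteration_bound (A := A) (by positivity) hQ₂0
  refine ⟨B, hB, fun u hu h hfin hq hT => ?_⟩
  set Z : ℝ → ℝ≥0∞ := fun ρ => ∫⁻ x in ball 0 ρ, ENNReal.ofReal (max (u x) 0 ^ γ) with hZ
  have hZfin : ∀ ρ ≤ 1, Z ρ ≠ ⊤ := fun ρ hρ =>
    ((lintegral_mono_set (ball_subset_ball hρ)).trans_lt hfin).ne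
  have := hiter (fun ρ => (Z ρ).toReal) (Z 1).toReal
    (fun ρ hρ => ENNReal.toReal_mono (hZfin 1 le_rfl) (lintegral_mono_set (ball_subset_ball hρ)))
    ?_
  · exact (ENNReal.le_ofReal_iff_toReal_le (hZfin _ (by norm_num)) hB.le).2 this
  intro ρ R hρ hρR hR
  have hg : 0 < R - ρ := by linarith
  have hg1 : R - ρ ≤ 1 := by linarith
  set X := 2 * C₁ * (R - ρ) ^ (-Q) with hX
  have hgQ : 1 ≤ (R - ρ) ^ (-Q) :=
    Real.one_le_rpow_of_pos_of_le_one_of_nonpos hg hg1 (by linarith)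
  have hX1 : 1 ≤ X := by nlinarith
  obtain ⟨m, hm1, hm2⟩ := exists_nat_pow_near hX1 hb1
  have hi := hint u ρ R (m + 1) hu h hq hT hρ hρR hR
  have e1 : C₁ * ((2 : ℝ) ^ (-κ)) ^ (m + 1) * (R - ρ) ^ (-Q) ≤ 1 / 2 := by
    rw [Real.rpow_neg (by norm_num), ← hb, inv_pow, mul_right_comm, ← div_eq_mul_inv,
      div_le_iff₀ (by positivity)]
    linarith
  have e2 : C₁ * (2 ^ (m + 1)) ^ γ ≤ C₁ * (2 * C₁ * b) ^ (γ / κ) * (R - ρ) ^ (-Q₂) := by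
    have h2 : ((2 : ℝ) ^ (m + 1)) ^ γ = (b ^ (m + 1)) ^ (γ / κ) := by
      rw [hb, Real.rpow_pow_comm (by norm_num), ← Real.rpow_mul (by positivity)]
      congr 1
      field_simp
    rw [h2, mul_assoc]
    gcongr
    calc (b ^ (m + 1)) ^ (γ / κ) ≤ (2 * C₁ * b * (R - ρ) ^ (-Q)) ^ (γ / κ) := by
          gcongr
          rw [pow_succ]
          calc b ^ m * b ≤ X * b := by gcongr
            _ = _ := by rw [hX]; ring
      _ = _ := by
          rw [Real.mul_rpow (by positivity) (by positivity), ← Real.rpow_mul hg.le, hQ₂, neg_mul]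
  have hgQ₂ : 1 ≤ (R - ρ) ^ (-Q₂) :=
    Real.one_le_rpow_of_pos_of_le_one_of_nonpos hg hg1 (by linarith)
  have hZR := ENNReal.ofReal_toReal (hZfin R hR)
  show (Z ρ).toReal ≤ 1 / 2 * (Z R).toReal + A * (R - ρ) ^ (-Q₂)
  refine ENNReal.toReal_le_of_le_ofReal (by positivity) (hi.trans ?_)
  change _ + _ * (Z R + 1) ≤ _
  calc _ ≤ ENNReal.ofReal (C₁ * (2 * C₁ * b) ^ (γ / κ) * (R - ρ) ^ (-Q₂)) +
        ENNReal.ofReal (1 / 2) * (ENNReal.ofReal (Z R).toReal + ENNReal.ofReal 1) := by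
        rw [hZR, ENNReal.ofReal_one]
        gcongr
    _ = ENNReal.ofReal (C₁ * (2 * C₁ * b) ^ (γ / κ) * (R - ρ) ^ (-Q₂) +
        1 / 2 * ((Z R).toReal + 1)) := by
        rw [← ENNReal.ofReal_add ENNReal.toReal_nonneg zero_le_one,
          ← ENNReal.ofReal_mul (by norm_num), ← ENNReal.ofReal_add (by positivity) (by positivity)]
    _ ≤ _ := by
        refine ENNReal.ofReal_le_ofReal ?_
        rw [hA, add_mul]
        linarith

end ReverseHolder

section Powers

variable {n : ℕ} {s p : ℝ} {f g : Rn n → ℝ}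

/-- `∫_{B_R} f^q`. -/
def ballPow (n : ℕ) (q : ℝ) (f : Rn n → ℝ) (R : ℝ) : ℝ≥0∞ :=
  ∫⁻ x in ball 0 R, ENNReal.ofReal (f x ^ q)

/-- `∫_{ℝⁿ∖B_R} f^{p-1} |y|^{-n-sp}`. -/
def tailPow (n : ℕ) (s p : ℝ) (f : Rn n → ℝ) (R : ℝ) : ℝ≥0∞ :=
  ∫⁻ y in (ball 0 R)ᶜ, ENNReal.ofReal (f y ^ (p - 1) * ‖y‖ ^ (-((n : ℝ) + s * p)))

lemma ballPow_comp_smul (q : ℝ) (f : Rn n → ℝ) {σ : ℝ} (hσ : 0 < σ) (R : ℝ) :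
    ballPow n q (fun x => f (σ • x)) R = ENNReal.ofReal ((σ ^ n)⁻¹) * ballPow n q f (σ * R) := by
  have h := lintegral_ball_affine (fun x => ENNReal.ofReal (f x ^ q)) (0 : Rn n) hσ R
  simp only [zero_add] at h
  rw [ballPow, ballPow, h, ← mul_assoc, ← ENNReal.ofReal_mul (by positivity),
    inv_mul_cancel₀ (by positivity), ENNReal.ofReal_one, one_mul]

lemma tailPow_comp_smul (f : Rn n → ℝ) {σ : ℝ} (hσ : 0 < σ) (R : ℝ) :
    tailPow n s p (fun x => f (σ • x)) R =
      ENNReal.ofReal (σ ^ (s * p)) * tailPow n s p f (σ * R) := by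
  have h := lintegral_compl_ball_affine
    (fun x => ENNReal.ofReal (f x ^ (p - 1) * ‖x‖ ^ (-((n : ℝ) + s * p)))) (0 : Rn n) hσ R
  simp only [zero_add] at h
  rw [tailPow, tailPow, h, ← mul_assoc, ← ENNReal.ofReal_mul (by positivity),
    ← lintegral_const_mul' _ _ ENNReal.ofReal_ne_top]
  refine lintegral_congr fun x => ?_
  rw [← ENNReal.ofReal_mul (by positivity), norm_smul, Real.norm_of_nonneg hσ.le,
    Real.mul_rpow hσ.le (norm_nonneg _)]
  congr 1
  have e : σ ^ (s * p) * σ ^ n * σ ^ (-((n : ℝ) + s * p)) = 1 := by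
    rw [← Real.rpow_natCast, ← Real.rpow_add hσ, ← Real.rpow_add hσ]
    convert Real.rpow_zero σ using 2
    ring
  linear_combination (-(f (σ • x) ^ (p - 1) * ‖x‖ ^ (-((n : ℝ) + s * p)))) * e

lemma ballPow_const_mul {q m : ℝ} (hf : ∀ x, 0 ≤ f x) (hm : 0 ≤ m) (R : ℝ) :
    ballPow n q (fun x => m * f x) R = ENNReal.ofReal (m ^ q) * ballPow n q f R := by
  rw [ballPow, ballPow, ← lintegral_const_mul' _ _ ENNReal.ofReal_ne_top]
  refine lintegral_congr fun x => ?_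
  rw [Real.mul_rpow hm (hf x), ENNReal.ofReal_mul (by positivity)]

lemma tailPow_const_mul {m : ℝ} (hf : ∀ x, 0 ≤ f x) (hm : 0 ≤ m) (R : ℝ) :
    tailPow n s p (fun x => m * f x) R =
      ENNReal.ofReal (m ^ (p - 1)) * tailPow n s p f R := by
  rw [tailPow, tailPow, ← lintegral_const_mul' _ _ ENNReal.ofReal_ne_top]
  refine lintegral_congr fun x => ?_
  rw [Real.mul_rpow hm (hf x), mul_assoc, ENNReal.ofReal_mul (by positivity)]

lemma ballPow_mono {q r R : ℝ} (hq : 0 ≤ q) (hf : ∀ x, 0 ≤ f x) (hfg : ∀ x, f x ≤ g x)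
    (hr : r ≤ R) : ballPow n q f r ≤ ballPow n q g R := by
  refine (lintegral_mono fun x => ?_).trans (lintegral_mono_set (ball_subset_ball hr))
  exact ENNReal.ofReal_le_ofReal (Real.rpow_le_rpow (hf x) (hfg x) hq)

lemma tailPow_mono {r R : ℝ} (hp : 1 < p) (hf : ∀ x, 0 ≤ f x) (hfg : ∀ x, f x ≤ g x)
    (hr : r ≤ R) : tailPow n s p f R ≤ tailPow n s p g r := by
  refine (lintegral_mono fun x => ?_).trans
    (lintegral_mono_set (compl_subset_compl.2 (ball_subset_ball hr)))
  refine ENNReal.ofReal_le_ofReal ?_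
  have := Real.rpow_le_rpow (hf x) (hfg x) (by linarith : 0 ≤ p - 1)
  gcongr

lemma rpow_le_of_le_add {a b c q : ℝ} (ha : 0 ≤ a) (hb : 0 ≤ b) (hc : 0 ≤ c) (h : a ≤ b + c)
    (hq : 0 ≤ q) : a ^ q ≤ 2 ^ q * (b ^ q + c ^ q) := by
  have key : ∀ b c : ℝ, 0 ≤ b → 0 ≤ c → b ≤ c → a ≤ b + c → a ^ q ≤ 2 ^ q * (b ^ q + c ^ q) := by
    intro b c hb hc hbc h
    calc a ^ q ≤ (2 * c) ^ q := by gcongr; linarith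
      _ = 2 ^ q * c ^ q := Real.mul_rpow (by norm_num) hc
      _ ≤ _ := by
          have : 0 ≤ b ^ q := by positivity
          gcongr
          linarith
  rcases le_total b c with hbc | hbc
  · exact key b c hb hc hbc h
  · rw [add_comm (b ^ q)]
    exact key c b hc hb hbc (by linarith)

lemma ballPow_le_add {h : Rn n → ℝ} {q R : ℝ} (hq : 0 ≤ q) (hg : Measurable g)
    (hf0 : ∀ x, 0 ≤ f x) (hg0 : ∀ x, 0 ≤ g x) (hh0 : ∀ x, 0 ≤ h x) (hfg : ∀ x, f x ≤ g x + h x) :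
    ballPow n q f R ≤ ENNReal.ofReal (2 ^ q) * (ballPow n q g R + ballPow n q h R) := by
  rw [ballPow, ballPow, ballPow, ← lintegral_add_left (by fun_prop),
    ← lintegral_const_mul' _ _ ENNReal.ofReal_ne_top]
  refine lintegral_mono fun x => ?_
  have := hg0 x
  have := hh0 x
  rw [← ENNReal.ofReal_add (by positivity) (by positivity), ← ENNReal.ofReal_mul (by positivity)]
  exact ENNReal.ofReal_le_ofReal (rpow_le_of_le_add (hf0 x) (hg0 x) (hh0 x) (hfg x) hq)

lemma tailPow_le_add {h : Rn n → ℝ} {R : ℝ} (hp : 1 < p) (hg : Measurable g)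
    (hf0 : ∀ x, 0 ≤ f x) (hg0 : ∀ x, 0 ≤ g x) (hh0 : ∀ x, 0 ≤ h x) (hfg : ∀ x, f x ≤ g x + h x) :
    tailPow n s p f R ≤
      ENNReal.ofReal (2 ^ (p - 1)) * (tailPow n s p g R + tailPow n s p h R) := by
  rw [tailPow, tailPow, tailPow, ← lintegral_add_left (by fun_prop),
    ← lintegral_const_mul' _ _ ENNReal.ofReal_ne_top]
  refine lintegral_mono fun x => ?_
  have := hg0 x
  have := hh0 x
  rw [← ENNReal.ofReal_add (by positivity) (by positivity), ← ENNReal.ofReal_mul (by positivity)]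
  refine ENNReal.ofReal_le_ofReal ?_
  rw [← add_mul, ← mul_assoc]
  gcongr
  exact rpow_le_of_le_add (hf0 x) (hg0 x) (hh0 x) (hfg x) (by linarith)

lemma ballPow_const {q a : ℝ} (R : ℝ) :
    ballPow n q (fun _ => a) R = ENNReal.ofReal (a ^ q) * volume (ball (0 : Rn n) R) :=
  setLIntegral_const _ _

lemma exists_tailPow_const (hn : 2 ≤ n) (hs : 0 < s) (hp : 1 < p) : ∃ C > 0, ∀ a R : ℝ,
    0 ≤ a → 0 < R →
      tailPow n s p (fun _ => a) R ≤ ENNReal.ofReal (C * R ^ (-(s * p)) * a ^ (p - 1)) := by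
  have hn0 : (0 : ℝ) < n := by positivity
  obtain ⟨C, hC, h⟩ := exists_lintegral_compl_ball_norm_rpow (n := n) (a := (n : ℝ) + s * p)
    (by have : 0 < s * p := by positivity
        linarith)
  refine ⟨C, hC, fun a R ha hR => ?_⟩
  have h := h 0 R hR
  simp only [zero_sub, norm_neg] at h
  rw [show (n : ℝ) - (n + s * p) = -(s * p) by ring] at h
  rw [tailPow]
  simp_rw [ENNReal.ofReal_mul (p := a ^ (p - 1)) (Real.rpow_nonneg ha _)]
  rw [lintegral_const_mul' _ _ ENNReal.ofReal_ne_top, mul_comm (C * _),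
    ENNReal.ofReal_mul (by positivity)]
  gcongr

/-- For `0 < h`: `a ^ q' ≤ h ^ q' + h ^ (q' - q) a ^ q`. -/
lemma rpow_le_rpow_add {a h q q' : ℝ} (ha : 0 ≤ a) (hh : 0 < h) (hq' : 0 < q') (hq : q' ≤ q) :
    a ^ q' ≤ h ^ q' + h ^ (q' - q) * a ^ q := by
  rcases le_total a h with hah | hah
  · calc a ^ q' ≤ h ^ q' := by gcongr
      _ ≤ _ := le_add_of_nonneg_right (by positivity)
  · have ha' : 0 < a := hh.trans_le hah
    calc a ^ q' = a ^ (q' - q) * a ^ q := by rw [← Real.rpow_add ha']; congr 1; ring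
      _ ≤ h ^ (q' - q) * a ^ q := by
          have := Real.rpow_le_rpow_of_nonpos hh hah (by linarith : q' - q ≤ 0)
          gcongr
      _ ≤ _ := le_add_of_nonneg_left (by positivity)

lemma ballPow_exponent_le {h q q' R : ℝ} (hf : ∀ x, 0 ≤ f x) (hh : 0 < h) (hq' : 0 < q')
    (hq : q' ≤ q) :
    ballPow n q' f R ≤ ENNReal.ofReal (h ^ q') * volume (ball (0 : Rn n) R) +
      ENNReal.ofReal (h ^ (q' - q)) * ballPow n q f R := by
  rw [ballPow, ballPow, ← setLIntegral_const, ← lintegral_const_mul' _ _ ENNReal.ofReal_ne_top,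
    ← lintegral_add_left (by fun_prop)]
  refine lintegral_mono fun x => ?_
  have := hf x
  rw [← ENNReal.ofReal_mul (by positivity), ← ENNReal.ofReal_add (by positivity) (by positivity)]
  exact ENNReal.ofReal_le_ofReal (rpow_le_rpow_add (hf x) hh hq' hq)

lemma tailPow_le_ballPow_add (hs : 0 < s) (hp : 1 < p) (hf : ∀ x, 0 ≤ f x) {r R : ℝ} (hr : 0 < r) :
    tailPow n s p f r ≤ ENNReal.ofReal (r ^ (-((n : ℝ) + s * p))) * ballPow n (p - 1) f R +
      tailPow n s p f R := by
  have hQ : 0 ≤ (n : ℝ) + s * p := by positivity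
  have hsub : (ball (0 : Rn n) r)ᶜ ⊆ (ball 0 r)ᶜ ∩ ball 0 R ∪ (ball 0 R)ᶜ := by
    intro x hx
    by_cases h : x ∈ ball (0 : Rn n) R
    · exact Or.inl ⟨hx, h⟩
    · exact Or.inr h
  rw [tailPow, tailPow, ballPow]
  refine (lintegral_mono_set hsub).trans ((lintegral_union_le _ _ _).trans ?_)
  gcongr
  rw [← lintegral_const_mul' _ _ ENNReal.ofReal_ne_top]
  refine (setLIntegral_mono' (measurableSet_ball.compl.inter measurableSet_ball) fun x hx => ?_).trans
    (lintegral_mono_set inter_subset_right)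
  have hx : r ≤ ‖x‖ := by simpa using hx.1
  have := hf x
  rw [← ENNReal.ofReal_mul (by positivity)]
  refine ENNReal.ofReal_le_ofReal ?_
  rw [mul_comm]
  have := Real.rpow_le_rpow_of_nonpos hr hx (by linarith : -((n : ℝ) + s * p) ≤ 0)
  gcongr

end Powers

section Half

variable {n : ℕ} {s p τ γ C : ℝ}

lemma ballPow_rescale {q m σ : ℝ} {H G : Rn n → ℝ} (hm : 0 < m) (hσ : 0 < σ) (hG : ∀ x, 0 ≤ G x)
    (h : ∀ x, H x = G (σ • x) / m) (R : ℝ) :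
    ballPow n q H R = ENNReal.ofReal (m ^ (-q) * (σ ^ n)⁻¹) * ballPow n q G (σ * R) := by
  have e : H = fun x => m⁻¹ * G (σ • x) := funext fun x => by rw [h, div_eq_inv_mul]
  rw [e, ballPow_const_mul (f := fun x => G (σ • x)) (fun x => hG _) (by positivity),
    ballPow_comp_smul q G hσ, ← mul_assoc, ← ENNReal.ofReal_mul (by positivity),
    Real.inv_rpow hm.le, Real.rpow_neg hm.le]

lemma tailPow_rescale {m σ : ℝ} {H G : Rn n → ℝ} (hm : 0 < m) (hσ : 0 < σ) (hG : ∀ x, 0 ≤ G x)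
    (h : ∀ x, H x = G (σ • x) / m) (R : ℝ) :
    tailPow n s p H R =
      ENNReal.ofReal (m ^ (-(p - 1)) * σ ^ (s * p)) * tailPow n s p G (σ * R) := by
  have e : H = fun x => m⁻¹ * G (σ • x) := funext fun x => by rw [h, div_eq_inv_mul]
  rw [e, tailPow_const_mul (f := fun x => G (σ • x)) (fun x => hG _) (by positivity),
    tailPow_comp_smul G hσ, ← mul_assoc, ← ENNReal.ofReal_mul (by positivity),
    Real.inv_rpow hm.le, Real.rpow_neg hm.le]

lemma exists_tailPow_shift_le (he : Exponents n s p τ γ) {a r : ℝ} (ha : 0 ≤ a) (hr : 0 < r) :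
    ∃ M ≥ 0, ∀ V : Rn n → ℝ, Measurable V → ballPow n γ (fun x => max (V x) 0) 1 ≤ 1 →
      tailPow n s p (fun x => max (V x) 0) 1 ≤ 1 →
      tailPow n s p (fun x => max (V x + a) 0) r ≤ ENNReal.ofReal M := by
  have hγ0 := he.γ_pos
  have hp := he.hp
  have hs := he.hs
  have hpγ : p - 1 ≤ γ := (sub_one_le_qStar p).trans he.hqγ
  obtain ⟨c, hc, hconst⟩ := exists_tailPow_const he.hn hs hp
  set X : ℝ≥0∞ := ENNReal.ofReal (r ^ (-((n : ℝ) + s * p))) *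
    (ENNReal.ofReal (1 ^ (p - 1)) * volume (ball (0 : Rn n) 1) + ENNReal.ofReal (1 ^ (p - 1 - γ)) *
      (ENNReal.ofReal (2 ^ γ) * (1 + ENNReal.ofReal (a ^ γ) * volume (ball (0 : Rn n) 1)))) +
    ENNReal.ofReal (2 ^ (p - 1)) * (1 + ENNReal.ofReal (c * 1 ^ (-(s * p)) * a ^ (p - 1))) with hX
  have hXt : X ≠ ⊤ := by
    have hv : volume (ball (0 : Rn n) 1) ≠ ⊤ := measure_ball_lt_top.ne
    have o : ∀ t, ENNReal.ofReal t ≠ ⊤ := fun t => ENNReal.ofReal_ne_top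
    simp only [hX, ne_eq, ENNReal.add_eq_top, ENNReal.mul_eq_top, o, hv, ENNReal.one_ne_top,
      and_false, false_and, or_false, not_false_eq_true]
  refine ⟨X.toReal, ENNReal.toReal_nonneg, fun V hV hb ht => ?_⟩
  rw [ENNReal.ofReal_toReal hXt]
  have hle : ∀ x, max (V x + a) 0 ≤ max (V x) 0 + a := fun x =>
    max_le (by have := le_max_left (V x) 0; linarith) (by positivity)
  have h0 : ∀ x, 0 ≤ max (V x + a) 0 := fun x => le_max_right _ _
  have h0' : ∀ x, 0 ≤ max (V x) 0 := fun x => le_max_right _ _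
  refine (tailPow_le_ballPow_add hs hp h0 (R := 1) hr).trans ?_
  refine add_le_add (mul_le_mul' le_rfl ?_) ?_
  · refine (ballPow_exponent_le h0 one_pos (by linarith) hpγ).trans ?_
    refine add_le_add le_rfl (mul_le_mul' le_rfl ?_)
    refine (ballPow_le_add hγ0.le (g := fun x => max (V x) 0) (h := fun _ => a) (by fun_prop) h0 h0'
      (fun _ => ha) hle).trans ?_
    rw [ballPow_const]
    exact mul_le_mul' le_rfl (add_le_add hb le_rfl)
  · refine (tailPow_le_add hp (g := fun x => max (V x) 0) (h := fun _ => a) (by fun_prop) h0 h0'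
      (fun _ => ha) hle).trans ?_
    exact mul_le_mul' le_rfl (add_le_add ht (hconst a 1 ha one_pos))

lemma exists_half_energy_le (he : Exponents n s p τ γ) (hC : 0 < C) :
    ∃ E > 0, ∀ V : Rn n → ℝ, Measurable V → Cacc n s p τ γ C V 0 1 1 →
      ballPow n γ (fun x => max (V x) 0) 1 ≤ 1 → tailPow n s p (fun x => max (V x) 0) 1 ≤ 1 →
      truncEnergy n s p τ V (-1) 1 (1 / 2) ≤ ENNReal.ofReal E := by
  have hγ0 := he.γ_pos
  have hp := he.hp
  have hs := he.hs
  obtain ⟨M, hM, htail⟩ := exists_tailPow_shift_le he zero_le_one (one_half_pos (α := ℝ))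
  have hv : volume (ball (0 : Rn n) 1) ≠ ⊤ := measure_ball_lt_top.ne
  have o : ∀ t, ENNReal.ofReal t ≠ ⊤ := fun t => ENNReal.ofReal_ne_top
  set X : ℝ≥0∞ := ENNReal.ofReal (C * 2 ^ (s * p) *
      (1 - 1 / 2 : ℝ) ^ (-((n : ℝ) + s * p + p))) * (ENNReal.ofReal (1 ^ (p - 1)) *
        (ENNReal.ofReal (2 ^ γ) * (1 + ENNReal.ofReal (2 ^ γ) * volume (ball (0 : Rn n) 1))) +
        volume (ball (0 : Rn n) 1) * ENNReal.ofReal M + 1) with hX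
  have hXt : X ≠ ⊤ := by
    simp only [hX, ne_eq, ENNReal.add_eq_top, ENNReal.mul_eq_top, o, hv, ENNReal.one_ne_top,
      and_false, false_and, or_false, not_false_eq_true]
  refine ⟨X.toReal + 1, by positivity, fun V hV h hb ht => ?_⟩
  refine le_trans ?_ (ENNReal.ofReal_le_ofReal (le_add_of_nonneg_right zero_le_one))
  rw [ENNReal.ofReal_toReal hXt]
  refine (h.energy_le (k := -1) hC hs hp one_pos le_rfl (by norm_num) le_rfl).trans ?_
  refine mul_le_mul' le_rfl (add_le_add (add_le_add (mul_le_mul' le_rfl ?_) (mul_le_mul' ?_ ?_)) le_rfl)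
  · have h0' : ∀ x, 0 ≤ max (V x) 0 := fun x => le_max_right _ _
    refine le_trans ?_ ((ballPow_le_add (R := 1) hγ0.le (f := fun x => max (V x) 0 + 2)
      (g := fun x => max (V x) 0) (h := fun _ => 2) (by fun_prop)
      (fun x => by have := h0' x; linarith) h0' (fun _ => by norm_num) fun x => le_rfl).trans ?_)
    · rw [ballPow]
      refine le_trans ?_ (lintegral_mono_set (inter_subset_left (t := {x | -1 < V x})))
      refine setLIntegral_mono' (measurableSet_ball.inter (measurableSet_lt measurable_const hV))
        fun x hx => ENNReal.ofReal_le_ofReal ?_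
      have hx : -1 < V x := hx.2
      have := le_max_left (V x) 0
      exact Real.rpow_le_rpow (by linarith) (by linarith) hγ0.le
    · rw [ballPow_const]
      exact mul_le_mul' le_rfl (add_le_add hb le_rfl)
  · exact measure_mono inter_subset_left
  · have := htail V hV hb ht
    simpa only [sub_neg_eq_add, tailPow] using this

lemma half_level_le (hs : 0 < s) (hp : 1 < p) (hτ : 1 < τ) {V : Rn n → ℝ} (hV : Measurable V)
    {L : ℝ} (hL : 1 ≤ L) (h : ENNReal.ofReal ((volume (ball (0 : Rn n) 1)).toReal / 2) ≤
      volume (ball (0 : Rn n) 1 ∩ {x | V x ≤ -L})) :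
    ENNReal.ofReal ((L / 2) ^ (p - 1) * Tt τ (1 / 2) * 2 ^ (-((n : ℝ) + s * p)) *
      ((volume (ball (0 : Rn n) 1)).toReal / 2)) * volume (ball (0 : Rn n) (1 / 2) ∩ {x | -(1 / 2) < V x})
      ≤ truncEnergy n s p τ V (-1) 1 (1 / 2) := by
  have hT := Tt_nonneg hτ (1 / 2)
  have hQ : 0 ≤ (n : ℝ) + s * p := by positivity
  have hm : MeasurableSet {x | -(1 / 2) < V x} := measurableSet_lt measurable_const hV
  have hm2 : MeasurableSet {x | V x ≤ -L} := measurableSet_le hV measurable_const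
  rw [← setLIntegral_const, truncEnergy]
  refine (setLIntegral_mono' (measurableSet_ball.inter hm) fun x hx => ?_).trans
    (lintegral_mono_set inter_subset_left)
  rw [ENNReal.ofReal_mul (by positivity)]
  refine (mul_le_mul' le_rfl h).trans ?_
  rw [← setLIntegral_const]
  refine (setLIntegral_mono' (measurableSet_ball.inter hm2) fun y hy => ?_).trans
    (setLIntegral_le_lintegral _ _)
  have hx1 : ‖x‖ < 1 / 2 := by simpa using hx.1
  have hx2 : -(1 / 2) < V x := hx.2
  have hy1 : ‖y‖ < 1 := by simpa using hy.1
  have hy2 : V y ≤ -L := hy.2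
  have hxy : x - y ≠ 0 := by
    intro e
    rw [sub_eq_zero.1 e] at hx2
    linarith
  have hd0 : 0 < ‖x - y‖ := norm_pos_iff.2 hxy
  have hd : ‖x - y‖ ≤ 2 := (norm_sub_le _ _).trans (by linarith)
  refine ENNReal.ofReal_le_ofReal ?_
  rw [Tt_of_nonpos (t := (V y - -1) / 1) (by linarith), sub_zero]
  have h1 : (L / 2) ^ (p - 1) ≤ max (V x - V y) 0 ^ (p - 1) :=
    Real.rpow_le_rpow (by linarith) (le_max_of_le_left (by linarith)) (by linarith)
  have hT' := Tt_nonneg hτ ((V x - -1) / 1)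
  have h2 : Tt τ (1 / 2) ≤ Tt τ ((V x - -1) / 1) := Tt_mono hτ (by linarith)
  have h3 : (2 : ℝ) ^ (-((n : ℝ) + s * p)) ≤ ‖x - y‖ ^ (-((n : ℝ) + s * p)) :=
    Real.rpow_le_rpow_of_nonpos hd0 hd (by linarith)
  gcongr

lemma Tt_half_pos (hτ : 1 < τ) : 0 < Tt τ (1 / 2) := by
  have : (1 + max (1 / 2 : ℝ) 0) ^ (1 - τ) < 1 :=
    Real.rpow_lt_one_of_one_lt_of_neg (by norm_num) (by linarith)
  unfold Tt
  linarith

lemma ballPow_half_shift_le {V : Rn n → ℝ} (hV : Measurable V) (hγ : 0 < γ) :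
    ballPow n γ (fun x => max (V x + 1 / 2) 0) (1 / 2) ≤
      volume (ball (0 : Rn n) (1 / 2) ∩ {x | -(1 / 2) < V x}) +
        ENNReal.ofReal (2 ^ γ) * ballPow n γ (fun x => max (V x) 0) 1 := by
  have hm : MeasurableSet {x | -(1 / 2) < V x} := measurableSet_lt measurable_const hV
  have e : volume (ball (0 : Rn n) (1 / 2) ∩ {x | -(1 / 2) < V x}) =
      ∫⁻ x in ball (0 : Rn n) (1 / 2), ({x | -(1 / 2) < V x}.indicator 1) x := by
    rw [lintegral_indicator_one hm, Measure.restrict_apply hm, inter_comm]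
  refine le_trans ?_ (add_le_add le_rfl (mul_le_mul' le_rfl
    (lintegral_mono_set (ball_subset_ball (by norm_num : (1 / 2 : ℝ) ≤ 1)))))
  rw [e, ← lintegral_const_mul _ (by fun_prop), ← lintegral_add_right _ (by fun_prop), ballPow]
  refine lintegral_mono fun x => ?_
  by_cases hx : -(1 / 2) < V x
  · rw [indicator_of_mem (by exact hx), Pi.one_apply, ← ENNReal.ofReal_one,
      ← ENNReal.ofReal_mul (by positivity), ← ENNReal.ofReal_add zero_le_one (by positivity)]
    refine ENNReal.ofReal_le_ofReal ?_
    refine (rpow_le_of_le_add (b := max (V x) 0) (c := 1 / 2) (le_max_right _ _) (le_max_right _ _)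
      (by norm_num) (max_le ?_ (by positivity)) hγ.le).trans (le_of_eq ?_)
    · have := le_max_left (V x) 0
      linarith
    · rw [mul_add, ← Real.mul_rpow (x := 2) (y := 1 / 2) (by norm_num) (by norm_num)]
      norm_num [add_comm]
  · rw [max_eq_right (by linarith), Real.zero_rpow hγ.ne', ENNReal.ofReal_zero]
    exact zero_le

lemma exists_half (he : Exponents n s p τ γ) (hC : 0 < C) :
    ∃ L ≥ 1, ∀ ε' > 0, ∃ ε > 0, ∃ δ > 0, ∀ V : Rn n → ℝ, Measurable V →
      Cacc n s p τ γ C V 0 1 (ENNReal.ofReal δ) →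
      ballPow n γ (fun x => max (V x) 0) 1 ≤ ENNReal.ofReal ε →
      tailPow n s p (fun x => max (V x) 0) 1 ≤ 1 →
      ENNReal.ofReal ((volume (ball (0 : Rn n) 1)).toReal / 2) ≤
        volume (ball (0 : Rn n) 1 ∩ {x | V x ≤ -L}) →
      ballPow n γ (fun x => max (V x + 1 / 4) 0) (1 / 4) ≤ ENNReal.ofReal ε' := by
  have hγ0 := he.γ_pos
  have hp := he.hp
  have hs := he.hs
  have hω := volume_ball_toReal_pos n
  set ω := (volume (ball (0 : Rn n) 1)).toReal with hω_def
  obtain ⟨E, hE, hen⟩ := exists_half_energy_le he hC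
  obtain ⟨M, hM, htail⟩ := exists_tailPow_shift_le he (one_half_pos (α := ℝ)).le
    (by norm_num : (0 : ℝ) < 1 / 4)
  set M₁ : ℝ := (1 / 4) ^ (-(p - 1)) * (1 / 2) ^ (s * p) * M with hM₁
  have hM₁0 : 0 ≤ M₁ := by positivity
  obtain ⟨ν, hν, hdg⟩ := exists_degiorgi he hC hM₁0
  set A : ℝ := (1 / 4) ^ (-γ) * ((1 / 2 : ℝ) ^ n)⁻¹ with hA
  have hA0 : 0 < A := by positivity
  have hA1 : 1 ≤ A := by
    refine one_le_mul_of_one_le_of_one_le ?_ ?_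
    · exact Real.one_le_rpow_of_pos_of_le_one_of_nonpos (by norm_num) (by norm_num) (by linarith)
    · exact (one_le_inv₀ (by positivity)).2 (pow_le_one₀ (by norm_num) (by norm_num))
  set c₀ := Tt τ (1 / 2) * 2 ^ (-((n : ℝ) + s * p)) * (ω / 2) with hc₀
  have hc₀0 : 0 < c₀ := by have := Tt_half_pos he.hτ; positivity
  set Y := 2 * A * E / (ν * c₀) with hY
  have hY0 : 0 < Y := by positivity
  set L := 2 * Y ^ (1 / (p - 1)) + 1 with hLdef
  have hL : 1 ≤ L := by have : 0 ≤ Y ^ (1 / (p - 1)) := by positivity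
                        linarith
  have hLY : Y ≤ (L / 2) ^ (p - 1) := by
    calc Y = (Y ^ (1 / (p - 1))) ^ (p - 1) := by
          rw [← Real.rpow_mul hY0.le, one_div_mul_cancel (by linarith), Real.rpow_one]
      _ ≤ _ := by
          have : 0 < p - 1 := by linarith
          gcongr
          linarith
  refine ⟨L, hL, fun ε' hε' => ?_⟩
  obtain ⟨δ, hδ, hdg⟩ := hdg ε' hε'
  set a : ℝ := ((1 / 4 : ℝ) ^ (p - 1) * (1 / 2 : ℝ) ^ ((n : ℝ) - s * p))⁻¹ with ha
  have ha0 : 0 < a := by positivity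
  refine ⟨min 1 (ν / (2 * A * 2 ^ γ)), by positivity, min 1 (δ / a), by positivity,
    fun V hV h hb ht hlev => ?_⟩
  have hb1 : ballPow n γ (fun x => max (V x) 0) 1 ≤ 1 :=
    hb.trans (by rw [← ENNReal.ofReal_one]; exact ENNReal.ofReal_le_ofReal (min_le_left _ _))
  have h1 : Cacc n s p τ γ C V 0 1 1 :=
    h.mono (by rw [← ENNReal.ofReal_one]; exact ENNReal.ofReal_le_ofReal (min_le_left _ _))
  set v := volume (ball (0 : Rn n) (1 / 2) ∩ {x | -(1 / 2) < V x}) with hv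
  have hvle : v ≤ ENNReal.ofReal (ν / (2 * A)) := by
    have hh := (half_level_le hs hp he.hτ hV hL hlev).trans (hen V hV h1 hb1 ht)
    rw [mul_assoc (_ * _), mul_assoc ((L / 2) ^ _), ← mul_assoc (Tt _ _), ← hc₀] at hh
    have hpos : 0 < (L / 2) ^ (p - 1) * c₀ := by positivity
    rw [mul_comm, ← ENNReal.le_div_iff_mul_le (Or.inl (by simpa using hpos))
      (Or.inl ENNReal.ofReal_ne_top), ← ENNReal.ofReal_div_of_pos hpos] at hh
    refine hh.trans (ENNReal.ofReal_le_ofReal ?_)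
    calc E / ((L / 2) ^ (p - 1) * c₀) ≤ E / (Y * c₀) := by gcongr
      _ = ν / (2 * A) := by rw [hY]; field_simp
  set W : Rn n → ℝ := fun x => (V (0 + (1 / 2 : ℝ) • x) - -(1 / 2)) / (1 / 4) with hW
  have hWm : Measurable W := by rw [hW]; fun_prop
  have hWc : Cacc n s p τ γ C W 0 1 (ENNReal.ofReal δ) := by
    refine (h.rescale hV (by norm_num : (0 : ℝ) < 1 / 2) (by norm_num) (by norm_num : (0 : ℝ) < 1 / 4)
      (-(1 / 2))).mono ?_
    rw [← ENNReal.ofReal_mul ha0.le]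
    refine ENNReal.ofReal_le_ofReal ?_
    calc a * min 1 (δ / a) ≤ a * (δ / a) := by gcongr; exact min_le_right _ _
      _ = δ := by field_simp
  have hmax : ∀ y b : ℝ, max ((y - -(1 / 2)) / (1 / 4) - b) 0 = max (y + 1 / 2 - b / 4) 0 / (1 / 4) := by
    intro y b
    rw [← max_div_div_right (by norm_num : (0 : ℝ) ≤ 1 / 4), zero_div]
    congr 1
    ring
  have hWb : ∫⁻ x in ball 0 1, ENNReal.ofReal (max (W x) 0 ^ γ) ≤ ENNReal.ofReal ν := by
    have := ballPow_rescale (q := γ) (H := fun x => max (W x) 0) (G := fun x => max (V x + 1 / 2) 0)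
      (by norm_num : (0 : ℝ) < 1 / 4) (by norm_num : (0 : ℝ) < 1 / 2) (fun x => le_max_right _ _)
      (fun x => by simpa [hW] using hmax (V ((1 / 2 : ℝ) • x)) 0) 1
    refine this.le.trans ?_
    rw [← hA, mul_one]
    calc _ ≤ ENNReal.ofReal A * (ENNReal.ofReal (ν / (2 * A)) +
          ENNReal.ofReal (2 ^ γ) * ENNReal.ofReal (ν / (2 * A * 2 ^ γ))) := by
          refine mul_le_mul' le_rfl ((ballPow_half_shift_le hV hγ0).trans ?_)
          refine add_le_add hvle (mul_le_mul' le_rfl (hb.trans ?_))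
          exact ENNReal.ofReal_le_ofReal (min_le_right _ _)
      _ = _ := by
          rw [← ENNReal.ofReal_mul (by positivity), ← ENNReal.ofReal_add (by positivity)
            (by positivity), ← ENNReal.ofReal_mul hA0.le]
          congr 1
          field_simp
          norm_num
  have hWt : ∫⁻ y in (ball 0 (1 / 2))ᶜ,
      ENNReal.ofReal (max (W y) 0 ^ (p - 1) * ‖y‖ ^ (-((n : ℝ) + s * p))) ≤ ENNReal.ofReal M₁ := by
    have := tailPow_rescale (s := s) (p := p) (H := fun x => max (W x) 0)
      (G := fun x => max (V x + 1 / 2) 0)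
      (by norm_num : (0 : ℝ) < 1 / 4) (by norm_num : (0 : ℝ) < 1 / 2) (fun x => le_max_right _ _)
      (fun x => by simpa [hW] using hmax (V ((1 / 2 : ℝ) • x)) 0) (1 / 2)
    refine this.le.trans ?_
    rw [hM₁, ENNReal.ofReal_mul (q := M) (by positivity)]
    refine mul_le_mul' le_rfl ?_
    rw [show (1 / 2 * (1 / 2) : ℝ) = 1 / 4 by norm_num]
    exact htail V hV hb1 ht
  have hend := hdg W hWm hWc hWb hWt
  have := ballPow_rescale (q := γ) (H := fun x => max (W x - 1) 0)
    (G := fun x => max (V x + 1 / 4) 0)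
    (by norm_num : (0 : ℝ) < 1 / 4) (by norm_num : (0 : ℝ) < 1 / 2) (fun x => le_max_right _ _)
    (fun x => by
      have := hmax (V ((1 / 2 : ℝ) • x)) 1
      simp only [hW, zero_add]
      rw [this]; norm_num [add_sub_assoc]) (1 / 2)
  rw [ballPow, ← hA] at this
  rw [this] at hend
  rw [show (1 / 2 * (1 / 2) : ℝ) = 1 / 4 by norm_num] at hend
  have hA1' : 1 ≤ ENNReal.ofReal A := by
    rw [← ENNReal.ofReal_one]
    exact ENNReal.ofReal_le_ofReal hA1
  exact (le_mul_of_one_le_left' hA1').trans hend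

end Half

section Shrink

variable {n : ℕ} {s p τ γ C : ℝ}

/-- Both `u` and `-u` satisfy the Caccioppoli inequality on the unit ball. -/
structure Good (n : ℕ) (s p τ γ C : ℝ) (u : Rn n → ℝ) (δ : ℝ) : Prop where
  meas : Measurable u
  sub : Cacc n s p τ γ C u 0 1 (ENNReal.ofReal δ)
  sup : Cacc n s p τ γ C (fun x => -u x) 0 1 (ENNReal.ofReal δ)
  fin : ballPow n γ (fun x => |u x|) 1 < ⊤

lemma Good.neg {u : Rn n → ℝ} {δ : ℝ} (h : Good n s p τ γ C u δ) :
    Good n s p τ γ C (fun x => -u x) δ :=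
  ⟨h.meas.neg, h.sup, by simpa using h.sub, by simpa using h.fin⟩

lemma Good.mono {u : Rn n → ℝ} {δ δ' : ℝ} (h : Good n s p τ γ C u δ) (hδ : δ ≤ δ') :
    Good n s p τ γ C u δ' :=
  ⟨h.meas, h.sub.mono (ENNReal.ofReal_le_ofReal hδ), h.sup.mono (ENNReal.ofReal_le_ofReal hδ),
    h.fin⟩

lemma Good.rescale (hγ : 0 < γ) {u : Rn n → ℝ} {δ : ℝ} (h : Good n s p τ γ C u δ)
    {σ m : ℝ} (hσ : 0 < σ) (hσ1 : σ ≤ 1) (hm : 0 < m) (c : ℝ) :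
    Good n s p τ γ C (fun x => (u (σ • x) - c) / m)
      ((m ^ (p - 1) * σ ^ ((n : ℝ) - s * p))⁻¹ * δ) := by
  have hu := h.meas
  refine ⟨by fun_prop, ?_, ?_, ?_⟩
  · have := h.sub.rescale hu hσ hσ1 hm c
    rw [← ENNReal.ofReal_mul (by positivity)] at this
    simpa using this
  · have := h.sup.rescale hu.neg hσ hσ1 hm (-c)
    rw [← ENNReal.ofReal_mul (by positivity)] at this
    convert this using 2 with x
    rw [zero_add, ← neg_div]
    congr 1
    ring
  · rw [ballPow_rescale (q := γ) (G := fun x => |u x - c|) hm hσ (fun x => abs_nonneg _)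
      (fun x => by rw [abs_div, abs_of_pos hm])]
    refine ENNReal.mul_lt_top ENNReal.ofReal_lt_top ?_
    refine (ballPow_mono hγ.le (R := 1) (g := fun x => |u x - c|) (fun x => abs_nonneg _)
      (fun x => le_rfl) (by linarith)).trans_lt ?_
    refine (ballPow_le_add hγ.le (g := fun x => |u x|) (h := fun _ => |c|) (by fun_prop)
      (fun x => abs_nonneg _) (fun x => abs_nonneg _) (fun x => abs_nonneg _)
      (fun x => abs_sub _ _)).trans_lt ?_
    rw [ballPow_const]
    exact ENNReal.mul_lt_top ENNReal.ofReal_lt_top (ENNReal.add_lt_top.2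
      ⟨h.fin, ENNReal.mul_lt_top ENNReal.ofReal_lt_top measure_ball_lt_top⟩)

/-- `|v| ≤ 1` up to small errors in the unit ball and in the tail. -/
def Stage (n : ℕ) (s p γ : ℝ) (v : Rn n → ℝ) (ε κ : ℝ) : Prop :=
  ballPow n γ (fun x => max (|v x| - 1) 0) 1 ≤ ENNReal.ofReal ε ∧
    tailPow n s p (fun x => max (|v x| - 1) 0) 1 ≤ ENNReal.ofReal κ

lemma exists_rpow_eq {q Y : ℝ} (hq : 0 < q) (hY : 0 < Y) : ∃ h > 0, h ^ q = Y :=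
  ⟨Y ^ (1 / q), by positivity, by
    rw [← Real.rpow_mul hY.le, one_div_mul_cancel hq.ne', Real.rpow_one]⟩

lemma exists_shrink_tail (he : Exponents n s p τ γ) {κ : ℝ} (hκ : 0 < κ) :
    ∃ θ > 0, ∃ σ : ℝ, 0 < σ ∧ σ ≤ 1 / 4 ∧ ∃ ε > 0, ∀ a G : Rn n → ℝ, Measurable a → (∀ x, 0 ≤ a x) →
      (∀ x, 0 ≤ G x) → (∀ x, G x ≤ a x + 2 * θ) → ballPow n γ a 1 ≤ ENNReal.ofReal ε →
      tailPow n s p a 1 ≤ ENNReal.ofReal κ →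
      tailPow n s p G σ ≤ ENNReal.ofReal (2 ^ (-(p - 1)) * σ ^ (-(s * p)) * κ) := by
  have hγ0 := he.γ_pos
  have hp := he.hp
  have hs := he.hs
  have hp1 : 0 < p - 1 := by linarith
  have hpγ : p - 1 ≤ γ := (sub_one_le_qStar p).trans he.hqγ
  have hω := volume_ball_toReal_pos n
  set ω := (volume (ball (0 : Rn n) 1)).toReal with hω_def
  obtain ⟨c, hc, hconst⟩ := exists_tailPow_const he.hn hs hp
  set σ : ℝ := (1 / 4) ^ (1 / s) with hσ
  have hσ0 : 0 < σ := by positivity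
  have hσ4 : σ ≤ 1 / 4 := by
    have : 1 ≤ 1 / s := (one_le_div hs).2 he.hs1.le
    exact (Real.rpow_le_rpow_of_exponent_ge (by norm_num) (by norm_num) this).trans_eq
      (Real.rpow_one _)
  have hσp : σ ^ (-(s * p)) = 4 ^ p := by
    rw [hσ, ← Real.rpow_mul (by norm_num), one_div, Real.inv_rpow (by norm_num),
      ← Real.rpow_neg (by norm_num)]
    congr 1
    field_simp
  set T : ℝ := 4 ^ (-(p - 1)) * σ ^ (-(s * p)) * κ with hT
  have hT0 : 0 < T := by positivity
  have hTκ : κ = T / 4 := by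
    have : (4 : ℝ) ^ (-(p - 1)) * 4 ^ p = 4 := by
      rw [← Real.rpow_add (by norm_num)]; norm_num
    rw [hT, hσp, this]; ring
  set Q := (n : ℝ) + s * p with hQ
  obtain ⟨h, hh, hhT⟩ := exists_rpow_eq hp1 (by positivity : 0 < T * σ ^ Q / (4 * ω))
  obtain ⟨t, ht, htT⟩ := exists_rpow_eq hp1 (by positivity : 0 < T * σ ^ (s * p) / (4 * c))
  refine ⟨t / 2, by positivity, σ, hσ0, hσ4, T * σ ^ Q / (4 * h ^ (p - 1 - γ)), by positivity,
    fun a G ha ha0 hG0 hGa hab hat => ?_⟩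
  have hσQ : σ ^ (-Q) * σ ^ Q = 1 := by rw [← Real.rpow_add hσ0]; simp
  have hσs : σ ^ (-(s * p)) * σ ^ (s * p) = 1 := by rw [← Real.rpow_add hσ0]; simp
  have ht2 : 2 * (t / 2) = t := by ring
  rw [ht2] at hGa
  refine (tailPow_le_add hp ha hG0 ha0 (fun _ => ht.le) hGa).trans ?_
  have e1 : tailPow n s p a σ ≤ ENNReal.ofReal (3 * T / 4) := by
    refine (tailPow_le_ballPow_add hs hp ha0 hσ0 (R := 1)).trans ?_
    calc _ ≤ ENNReal.ofReal (σ ^ (-Q)) * (ENNReal.ofReal (h ^ (p - 1)) * ENNReal.ofReal ω +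
          ENNReal.ofReal (h ^ (p - 1 - γ)) * ENNReal.ofReal (T * σ ^ Q / (4 * h ^ (p - 1 - γ)))) +
          ENNReal.ofReal κ := by
          refine add_le_add (mul_le_mul' le_rfl ?_) hat
          refine (ballPow_exponent_le ha0 hh hp1 hpγ).trans ?_
          exact add_le_add (mul_le_mul' le_rfl (volume_ball_le_one_ofReal le_rfl))
            (mul_le_mul' le_rfl hab)
      _ = _ := by
          rw [← ENNReal.ofReal_mul (by positivity), ← ENNReal.ofReal_mul (by positivity),
            ← ENNReal.ofReal_add (by positivity) (by positivity),
            ← ENNReal.ofReal_mul (by positivity),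
            ← ENNReal.ofReal_add (by positivity) (by positivity)]
          congr 1
          have e2 : h ^ (p - 1 - γ) * (T * σ ^ Q / (4 * h ^ (p - 1 - γ))) = T * σ ^ Q / 4 := by
            field_simp
          have e3 : T * σ ^ Q / (4 * ω) * ω = T * σ ^ Q / 4 := by field_simp
          rw [e2, hhT, e3, hTκ]
          linear_combination (T / 2) * hσQ
  have e2 : tailPow n s p (fun _ : Rn n => t) σ ≤ ENNReal.ofReal (T / 4) := by
    refine (hconst t σ ht.le hσ0).trans (ENNReal.ofReal_le_ofReal (le_of_eq ?_))
    have e3 : c * (T * σ ^ (s * p) / (4 * c)) = T * σ ^ (s * p) / 4 := by field_simp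
    rw [htT]
    linear_combination σ ^ (-(s * p)) * e3 + T / 4 * hσs
  refine (mul_le_mul' le_rfl (add_le_add e1 e2)).trans ?_
  rw [← ENNReal.ofReal_add (by positivity) (by positivity), ← ENNReal.ofReal_mul (by positivity)]
  refine ENNReal.ofReal_le_ofReal (le_of_eq ?_)
  have : (2 : ℝ) ^ (p - 1) * 4 ^ (-(p - 1)) = 2 ^ (-(p - 1)) := by
    rw [show (4 : ℝ) = 2 * 2 by norm_num, Real.mul_rpow (by norm_num) (by norm_num), ← mul_assoc,
      ← Real.rpow_add (by norm_num)]
    norm_num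
  rw [hT]
  linear_combination (σ ^ (-(s * p)) * κ) * this

lemma exists_shrink_nonpos (he : Exponents n s p τ γ) (hC : 0 < C) :
    ∃ κ : ℝ, 0 < κ ∧ ∃ θ : ℝ, 0 < θ ∧ θ ≤ 1 / 2 ∧ ∃ σ : ℝ, 0 < σ ∧ σ ≤ 1 / 4 ∧ ∀ ε' > 0, ∃ ε > 0, ∃ δ > 0, ∀ v : Rn n → ℝ,
      Good n s p τ γ C v δ → Stage n s p γ v ε κ →
      ENNReal.ofReal ((volume (ball (0 : Rn n) 1)).toReal / 2) ≤
        volume (ball (0 : Rn n) 1 ∩ {x | v x ≤ 0}) →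
      Stage n s p γ (fun x => (v (σ • x) + θ) / (1 - θ)) ε' κ := by
  have hγ0 := he.γ_pos
  have hp := he.hp
  have hs := he.hs
  obtain ⟨L, hL, hhalf⟩ := exists_half he hC
  have hL0 : 0 < L := by linarith
  set t := L⁻¹ with ht
  have ht0 : 0 < t := by positivity
  have ht1 : t ≤ 1 := inv_le_one_of_one_le₀ hL
  have hκ : 0 < t ^ (p - 1) := by positivity
  obtain ⟨θ₀, hθ₀, σ, hσ, hσ4, ε₀, hε₀, htail⟩ := exists_shrink_tail he hκ
  set θ := min θ₀ (t / 8) with hθ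
  have hθ0 : 0 < θ := by positivity
  have hθt : θ ≤ t / 8 := min_le_right _ _
  have hθ₀' : θ ≤ θ₀ := min_le_left _ _
  refine ⟨_, hκ, θ, hθ0, by linarith, σ, hσ, hσ4, fun ε' hε' => ?_⟩
  set lam := 1 - θ with hlam
  have hlam2 : 1 / 2 ≤ lam := by linarith
  have hlam0 : 0 < lam := by linarith
  set A := lam ^ (-γ) * (σ ^ n)⁻¹ * 2 ^ γ with hA
  have hA0 : 0 < A := by positivity
  obtain ⟨εh, hεh, δ, hδ, hhalf⟩ := hhalf (ε' / (2 * A)) (by positivity)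
  refine ⟨min (ε' / (2 * A)) (min ε₀ (εh * t ^ γ)), by positivity, δ * t ^ (p - 1), by positivity,
    fun v hv hst hlev => ?_⟩
  have hvm := hv.meas
  obtain ⟨hsb, hst⟩ := hst
  set a : Rn n → ℝ := fun x => max (|v x| - 1) 0 with ha
  have ham : Measurable a := by fun_prop
  have ha0 : ∀ x, 0 ≤ a x := fun x => le_max_right _ _
  have hav : ∀ x, max (v x - 1) 0 ≤ a x := fun x =>
    max_le_max_right _ (by have := le_abs_self (v x); linarith)
  set V : Rn n → ℝ := fun x => (v (0 + (1 : ℝ) • x) - 1) / t with hV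
  have hVm : Measurable V := by fun_prop
  have hVc : Cacc n s p τ γ C V 0 1 (ENNReal.ofReal δ) := by
    refine (hv.sub.rescale hvm one_pos le_rfl ht0 1).mono ?_
    rw [← ENNReal.ofReal_mul (by positivity)]
    refine ENNReal.ofReal_le_ofReal (le_of_eq ?_)
    rw [Real.one_rpow]
    field_simp
  have hVmax : ∀ x b, max (V x + b) 0 = max (v x - (1 - t * b)) 0 / t := by
    intro x b
    simp only [hV, one_smul, zero_add]
    rw [← max_div_div_right ht0.le, zero_div]
    congr 1
    field_simp
    ring
  have hVmax0 : ∀ x, max (V x) 0 = max (v ((1 : ℝ) • x) - 1) 0 / t := fun x => by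
    simpa using hVmax x 0
  have hVb : ballPow n γ (fun x => max (V x) 0) 1 ≤ ENNReal.ofReal εh := by
    rw [ballPow_rescale (G := fun x => max (v x - 1) 0) ht0 one_pos (fun x => le_max_right _ _)
      hVmax0]
    calc _ ≤ ENNReal.ofReal (t ^ (-γ) * (1 ^ n)⁻¹) * ENNReal.ofReal (εh * t ^ γ) := by
          refine mul_le_mul' le_rfl ((ballPow_mono hγ0.le (fun x => le_max_right _ _) hav
            (by norm_num)).trans (hsb.trans (ENNReal.ofReal_le_ofReal ?_)))
          exact (min_le_right _ _).trans (min_le_right _ _)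
      _ = _ := by
          rw [← ENNReal.ofReal_mul (by positivity)]
          congr 1
          rw [Real.rpow_neg ht0.le, one_pow]
          field_simp
  have hVt : tailPow n s p (fun x => max (V x) 0) 1 ≤ 1 := by
    rw [tailPow_rescale (G := fun x => max (v x - 1) 0) ht0 one_pos (fun x => le_max_right _ _)
      hVmax0]
    calc _ ≤ ENNReal.ofReal (t ^ (-(p - 1)) * 1 ^ (s * p)) * ENNReal.ofReal (t ^ (p - 1)) :=
          mul_le_mul' le_rfl ((tailPow_mono hp (fun x => le_max_right _ _) hav
            (by norm_num)).trans hst)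
      _ = _ := by
          rw [← ENNReal.ofReal_mul (by positivity), Real.one_rpow, mul_one, ← Real.rpow_add ht0]
          simp
  have hVlev : {x | v x ≤ 0} ⊆ {x | V x ≤ -L} := by
    intro x hx
    have hx : v x ≤ 0 := hx
    show V x ≤ -L
    simp only [hV, one_smul, zero_add, ht, div_inv_eq_mul]
    nlinarith
  have hend := hhalf V hVm hVc hVb hVt (hlev.trans (measure_mono (inter_subset_inter_right _ hVlev)))
  set b : Rn n → ℝ := fun x => max (v x - (1 - t / 4)) 0 with hb
  have hb0 : ∀ x, 0 ≤ b x := fun x => le_max_right _ _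
  have hbm : Measurable b := by fun_prop
  have hbb : ballPow n γ b (1 / 4) ≤ ENNReal.ofReal (ε' / (2 * A)) := by
    refine le_trans ?_ hend
    refine ballPow_mono hγ0.le hb0 (fun x => ?_) le_rfl
    rw [hVmax, mul_one_div]
    exact le_div_self (le_max_right _ _) ht0 ht1
  set G : Rn n → ℝ := fun x => max (|v x + θ| - lam) 0 with hG
  have hG0 : ∀ x, 0 ≤ G x := fun x => le_max_right _ _
  have hGb : ∀ x, G x ≤ b x + a x := by
    intro x
    have := ha0 x
    have := hb0 x
    have h1 : v x - (1 - t / 4) ≤ b x := le_max_left _ _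
    have h2 : |v x| - 1 ≤ a x := le_max_left _ _
    have h3 := neg_abs_le (v x)
    refine max_le ?_ (by linarith)
    rw [sub_le_iff_le_add]
    exact abs_le.2 ⟨by linarith, by linarith⟩
  have hGa : ∀ x, G x ≤ a x + 2 * θ₀ := by
    intro x
    have := ha0 x
    have h2 : |v x| - 1 ≤ a x := le_max_left _ _
    refine max_le ?_ (by linarith)
    have := abs_add_le (v x) θ
    rw [abs_of_pos hθ0] at this
    linarith
  have hH : ∀ x, max (|(v (σ • x) + θ) / lam| - 1) 0 = G (σ • x) / lam := by
    intro x
    rw [hG, ← max_div_div_right hlam0.le, zero_div, abs_div, abs_of_pos hlam0]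
    congr 1
    field_simp
  refine ⟨?_, ?_⟩
  · rw [ballPow_rescale hlam0 hσ hG0 hH, mul_one]
    calc _ ≤ ENNReal.ofReal (lam ^ (-γ) * (σ ^ n)⁻¹) * (ENNReal.ofReal (2 ^ γ) *
          (ENNReal.ofReal (ε' / (2 * A)) + ENNReal.ofReal (ε' / (2 * A)))) := by
          refine mul_le_mul' le_rfl ((ballPow_le_add hγ0.le hbm hG0 hb0 ha0 hGb).trans
            (mul_le_mul' le_rfl (add_le_add ?_ ?_)))
          · exact (lintegral_mono_set (ball_subset_ball hσ4)).trans hbb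
          · refine (lintegral_mono_set (ball_subset_ball (by linarith))).trans (hsb.trans ?_)
            exact ENNReal.ofReal_le_ofReal (min_le_left _ _)
      _ = ENNReal.ofReal ε' := by
          rw [← ENNReal.ofReal_add (by positivity) (by positivity),
            ← ENNReal.ofReal_mul (by positivity), ← ENNReal.ofReal_mul (by positivity)]
          congr 1
          rw [← mul_assoc, ← hA]
          field_simp
          norm_num
  · rw [tailPow_rescale hlam0 hσ hG0 hH, mul_one]
    refine (mul_le_mul' le_rfl (htail a G ham ha0 hG0 hGa (hsb.trans (ENNReal.ofReal_le_ofReal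
      ((min_le_right _ _).trans (min_le_left _ _)))) hst)).trans ?_
    rw [← ENNReal.ofReal_mul (by positivity)]
    refine ENNReal.ofReal_le_ofReal ?_
    have e1 : σ ^ (s * p) * σ ^ (-(s * p)) = 1 := by rw [← Real.rpow_add hσ]; simp
    have e2 : lam ^ (-(p - 1)) * 2 ^ (-(p - 1)) ≤ 1 := by
      rw [← Real.mul_rpow hlam0.le (by norm_num)]
      exact Real.rpow_le_one_of_one_le_of_nonpos (by linarith) (by linarith)
    calc _ = lam ^ (-(p - 1)) * 2 ^ (-(p - 1)) * (σ ^ (s * p) * σ ^ (-(s * p))) * t ^ (p - 1) := by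
          ring
      _ ≤ 1 * 1 * t ^ (p - 1) := by rw [e1]; gcongr
      _ = _ := by ring

/-- Oscillation reduction: `v` is close to a constant up to a factor smaller than one. -/
lemma exists_shrink (he : Exponents n s p τ γ) (hC : 0 < C) :
    ∃ κ : ℝ, 0 < κ ∧ ∃ θ : ℝ, 0 < θ ∧ θ ≤ 1 / 2 ∧ ∃ σ : ℝ, 0 < σ ∧ σ ≤ 1 / 4 ∧ ∀ ε' > 0, ∃ ε > 0, ∃ δ > 0, ∀ v : Rn n → ℝ,
      Good n s p τ γ C v δ → Stage n s p γ v ε κ →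
      ∃ c, |c| ≤ 1 ∧ Stage n s p γ (fun x => (v (σ • x) - c) / (1 - θ)) ε' κ := by
  obtain ⟨κ, hκ, θ, hθ, hθ2, σ, hσ, hσ4, H⟩ := exists_shrink_nonpos he hC
  refine ⟨κ, hκ, θ, hθ, hθ2, σ, hσ, hσ4, fun ε' hε' => ?_⟩
  obtain ⟨ε, hε, δ, hδ, H⟩ := H ε' hε'
  refine ⟨ε, hε, δ, hδ, fun v hv hst => ?_⟩
  have hvm := hv.meas
  by_cases hlev : ENNReal.ofReal ((volume (ball (0 : Rn n) 1)).toReal / 2) ≤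
      volume (ball (0 : Rn n) 1 ∩ {x | v x ≤ 0})
  · refine ⟨-θ, by rw [abs_neg, abs_of_pos hθ]; linarith, ?_⟩
    simpa only [sub_neg_eq_add] using H v hv hst hlev
  · refine ⟨θ, by rw [abs_of_pos hθ]; linarith, ?_⟩
    have := H (fun x => -v x) hv.neg (by simpa only [Stage, abs_neg] using hst) ?_
    · have e : ∀ x, |(v (σ • x) - θ) / (1 - θ)| = |(-v (σ • x) + θ) / (1 - θ)| := fun x => by
        rw [← abs_neg, ← neg_div]
        congr 2
        ring
      simpa only [Stage, e] using this
    · have hsub : ball (0 : Rn n) 1 ⊆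
          (ball (0 : Rn n) 1 ∩ {x | v x ≤ 0}) ∪ (ball (0 : Rn n) 1 ∩ {x | -v x ≤ 0}) := by
        intro x hx
        rcases le_total (v x) 0 with h | h
        · exact Or.inl ⟨hx, h⟩
        · exact Or.inr ⟨hx, by simpa using h⟩
      by_contra hcon
      have h1 := (measure_mono hsub).trans (measure_union_le (μ := volume) _ _)
      have h2 := h1.trans_lt (ENNReal.add_lt_add (not_le.1 hlev) (not_le.1 hcon))
      rw [← ENNReal.ofReal_add (by positivity) (by positivity), add_halves,
        ENNReal.ofReal_toReal measure_ball_lt_top.ne] at h2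
      exact lt_irrefl _ h2

end Shrink

section Decay

variable {n : ℕ} {s p τ γ C : ℝ}

lemma exists_sup_bound (he : Exponents n s p τ γ) (hC : 0 < C) {M : ℝ} (hM : 0 < M) :
    ∃ m₀ : ℝ, 0 < m₀ ∧ ∀ m ≥ m₀, ∀ ε > 0, ∃ δ > 0, ∀ u : Rn n → ℝ, Measurable u →
      Cacc n s p τ γ C u 0 1 (ENNReal.ofReal δ) → ballPow n γ (fun x => max (u x) 0) 1 < ⊤ →
      ballPow n (qStar p) (fun x => max (u x) 0) 1 ≤ 1 →
      tailPow n s p (fun x => max (u x) 0) (1 / 4) ≤ ENNReal.ofReal M →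
      ballPow n γ (fun x => max (u x - m) 0) (1 / 4) ≤ ENNReal.ofReal ε := by
  have hγ0 := he.γ_pos
  have hp := he.hp
  have hs := he.hs
  obtain ⟨B, hB, hrh⟩ := exists_reverse_holder he hC hM.le
  obtain ⟨ν, hν, hdg⟩ := exists_degiorgi he hC zero_le_one
  obtain ⟨m₁, hm₁, e₁⟩ := exists_rpow_eq (by linarith : 0 < p - 1) hM
  obtain ⟨m₂, hm₂, e₂⟩ := exists_rpow_eq hγ0 (by positivity : 0 < ((1 / 2 : ℝ) ^ n)⁻¹ * B / ν)
  refine ⟨max m₁ m₂, by positivity, fun m hm ε hε => ?_⟩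
  have hm1 : m₁ ≤ m := (le_max_left _ _).trans hm
  have hm2 : m₂ ≤ m := (le_max_right _ _).trans hm
  have hm0 : 0 < m := hm₁.trans_le hm1
  set K : ℝ := m ^ (-γ) * ((1 / 2 : ℝ) ^ n)⁻¹ with hK
  have hK0 : 0 < K := by positivity
  obtain ⟨δ, hδ, hdg⟩ := hdg (K * ε) (by positivity)
  set a : ℝ := (m ^ (p - 1) * (1 / 2 : ℝ) ^ ((n : ℝ) - s * p))⁻¹ with ha
  have ha0 : 0 < a := by positivity
  refine ⟨min 1 (δ / a), by positivity, fun u hu h hfin hq ht => ?_⟩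
  have hpos : ∀ x, 0 ≤ max (u x) 0 := fun x => le_max_right _ _
  have ht2 : tailPow n s p (fun x => max (u x) 0) (1 / 2) ≤ ENNReal.ofReal M :=
    (tailPow_mono hp hpos (fun x => le_rfl) (by norm_num)).trans ht
  have hrh : ballPow n γ (fun x => max (u x) 0) (1 / 2) ≤ ENNReal.ofReal B := by
    refine hrh u hu (h.mono ?_) hfin hq ht2
    rw [← ENNReal.ofReal_one]
    exact ENNReal.ofReal_le_ofReal (min_le_left _ _)
  set W : Rn n → ℝ := fun x => (u (0 + (1 / 2 : ℝ) • x) - 0) / m with hW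
  have hWm : Measurable W := by fun_prop
  have hWc : Cacc n s p τ γ C W 0 1 (ENNReal.ofReal δ) := by
    refine (h.rescale hu (by norm_num : (0 : ℝ) < 1 / 2) (by norm_num) hm0 0).mono ?_
    rw [← ENNReal.ofReal_mul ha0.le]
    refine ENNReal.ofReal_le_ofReal ?_
    calc a * min 1 (δ / a) ≤ a * (δ / a) := by gcongr; exact min_le_right _ _
      _ = δ := by field_simp
  have hWe : ∀ x, max (W x) 0 = max (u ((1 / 2 : ℝ) • x)) 0 / m := fun x => by
    rw [← max_div_div_right hm0.le, zero_div]
    simp only [hW, zero_add, sub_zero]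
  have hWe1 : ∀ x, max (W x - 1) 0 = max (u ((1 / 2 : ℝ) • x) - m) 0 / m := fun x => by
    rw [← max_div_div_right hm0.le, zero_div, sub_div, div_self hm0.ne']
    simp only [hW, zero_add, sub_zero]
  have hWb : ballPow n γ (fun x => max (W x) 0) 1 ≤ ENNReal.ofReal ν := by
    rw [ballPow_rescale (G := fun x => max (u x) 0) hm0 (by norm_num) hpos hWe, mul_one]
    refine (mul_le_mul' le_rfl hrh).trans ?_
    rw [← ENNReal.ofReal_mul (by positivity)]
    refine ENNReal.ofReal_le_ofReal ?_
    rw [Real.rpow_neg hm0.le, mul_assoc, inv_mul_le_iff₀ (by positivity), ← div_le_iff₀ hν, ← e₂]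
    gcongr
  have hWt : tailPow n s p (fun x => max (W x) 0) (1 / 2) ≤ ENNReal.ofReal 1 := by
    rw [tailPow_rescale (G := fun x => max (u x) 0) hm0 (by norm_num : (0 : ℝ) < 1 / 2) hpos hWe,
      show (1 / 2 * (1 / 2) : ℝ) = 1 / 4 by norm_num]
    refine (mul_le_mul' le_rfl ht).trans ?_
    rw [← ENNReal.ofReal_mul (by positivity)]
    refine ENNReal.ofReal_le_ofReal ?_
    have h1 : M ≤ m ^ (p - 1) := by
      rw [← e₁]
      have : 0 < p - 1 := by linarith
      gcongr
    have h2 : (1 / 2 : ℝ) ^ (s * p) ≤ 1 :=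
      Real.rpow_le_one (by norm_num) (by norm_num) (by positivity)
    rw [Real.rpow_neg hm0.le, mul_assoc, inv_mul_le_iff₀ (by positivity), mul_one]
    nlinarith
  have hend := hdg W hWm hWc hWb hWt
  have e := ballPow_rescale (q := γ) (G := fun x => max (u x - m) 0) hm0
    (by norm_num : (0 : ℝ) < 1 / 2) (fun x => le_max_right _ _) hWe1 (1 / 2)
  rw [ballPow] at e
  rw [e, ← hK, show (1 / 2 * (1 / 2) : ℝ) = 1 / 4 by norm_num, ENNReal.ofReal_mul hK0.le] at hend
  exact (ENNReal.mul_le_mul_iff_right (by simpa using hK0) ENNReal.ofReal_ne_top).1 hend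

/-- At some fixed smaller scale `u` is within `m` of a constant, up to arbitrarily small errors. -/
def CloseAt (n : ℕ) (s p τ γ C κ m : ℝ) : Prop :=
  ∀ ε : ℝ, 0 < ε → ∃ δ : ℝ, 0 < δ ∧ ∃ σ : ℝ, 0 < σ ∧ σ ≤ 1 / 4 ∧ ∃ A : ℝ, 0 ≤ A ∧
    ∀ u : Rn n → ℝ, Good n s p τ γ C u δ → ballPow n (qStar p) (fun x => |u x|) 1 ≤ 1 →
      tailPow n s p (fun x => |u x|) 1 ≤ 1 →
      ∃ c, |c| ≤ A ∧ Stage n s p γ (fun x => (u (σ • x) - c) / m) ε κ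

lemma tailPow_quarter_le (hs : 0 < s) (hp : 1 < p) {u : Rn n → ℝ}
    (hb : ballPow n (qStar p) (fun x => |u x|) 1 ≤ 1) (ht : tailPow n s p (fun x => |u x|) 1 ≤ 1) :
    tailPow n s p (fun x => |u x|) (1 / 4) ≤ ENNReal.ofReal
      ((1 / 4) ^ (-((n : ℝ) + s * p)) * ((volume (ball (0 : Rn n) 1)).toReal + 1) + 1) := by
  have h0 : ∀ x, 0 ≤ |u x| := fun x => abs_nonneg _
  refine (tailPow_le_ballPow_add hs hp h0 (by norm_num : (0 : ℝ) < 1 / 4) (R := 1)).trans ?_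
  rw [ENNReal.ofReal_add (by positivity) zero_le_one, ENNReal.ofReal_mul (by positivity),
    ENNReal.ofReal_add (by positivity) zero_le_one, ENNReal.ofReal_one]
  refine add_le_add (mul_le_mul' le_rfl ?_) ht
  refine (ballPow_exponent_le h0 one_pos (by linarith) (sub_one_le_qStar p)).trans ?_
  simp only [Real.one_rpow, ENNReal.ofReal_one, one_mul]
  exact add_le_add (volume_ball_le_one_ofReal le_rfl) hb

lemma exists_closeAt (he : Exponents n s p τ γ) (hC : 0 < C) {κ : ℝ} (hκ : 0 < κ) :
    ∃ m : ℝ, 0 < m ∧ CloseAt n s p τ γ C κ m := by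
  have hγ0 := he.γ_pos
  have hp := he.hp
  have hs := he.hs
  set M : ℝ := (1 / 4) ^ (-((n : ℝ) + s * p)) * ((volume (ball (0 : Rn n) 1)).toReal + 1) + 1
    with hM
  have hM0 : 0 < M := by positivity
  obtain ⟨m₀, hm₀, hsup⟩ := exists_sup_bound he hC hM0
  obtain ⟨m₁, hm₁, e₁⟩ := exists_rpow_eq (by linarith : 0 < p - 1) (by positivity : 0 < M / κ)
  set m := max m₀ m₁ with hm
  have hm0 : 0 < m := by positivity
  refine ⟨m, hm0, fun ε hε => ?_⟩
  set K : ℝ := m ^ (-γ) * ((1 / 4 : ℝ) ^ n)⁻¹ * 2 ^ γ with hK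
  have hK0 : 0 < K := by positivity
  obtain ⟨δ, hδ, hsup⟩ := hsup m (le_max_left _ _) (ε / (2 * K)) (by positivity)
  refine ⟨δ, hδ, 1 / 4, by norm_num, le_rfl, 0, le_rfl, fun u hu hb ht => ⟨0, by simp, ?_⟩⟩
  have hum := hu.meas
  have hT := tailPow_quarter_le hs hp hb ht
  rw [← hM] at hT
  have h0 : ∀ x, 0 ≤ |u x| := fun x => abs_nonneg _
  have side : ∀ w : Rn n → ℝ, Measurable w → (∀ x, |w x| = |u x|) →
      Cacc n s p τ γ C w 0 1 (ENNReal.ofReal δ) →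
      ballPow n γ (fun x => max (w x - m) 0) (1 / 4) ≤ ENNReal.ofReal (ε / (2 * K)) := by
    intro w hw hwu hc
    have hle : ∀ x, max (w x) 0 ≤ |u x| := fun x => by
      rw [← hwu]; exact max_le (le_abs_self _) (abs_nonneg _)
    have hw0 : ∀ x, 0 ≤ max (w x) 0 := fun x => le_max_right _ _
    exact hsup w hw hc ((ballPow_mono hγ0.le hw0 hle le_rfl).trans_lt hu.fin)
      ((ballPow_mono (by have := one_le_qStar p; linarith) hw0 hle le_rfl).trans hb)
      ((tailPow_mono hp hw0 hle le_rfl).trans hT)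
  have s1 := side u hum (fun x => rfl) hu.sub
  have s2 := side (fun x => -u x) hum.neg (fun x => abs_neg _) hu.sup
  set G : Rn n → ℝ := fun x => max (|u x| - m) 0 with hG
  have hG0 : ∀ x, 0 ≤ G x := fun x => le_max_right _ _
  have hH : ∀ x, max (|(u ((1 / 4 : ℝ) • x) - 0) / m| - 1) 0 = G ((1 / 4 : ℝ) • x) / m := fun x => by
    simp only [hG]
    rw [← max_div_div_right hm0.le, zero_div, sub_zero, abs_div, abs_of_pos hm0, sub_div _ _ m,
      div_self hm0.ne']
  refine ⟨?_, ?_⟩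
  · rw [ballPow_rescale hm0 (by norm_num) hG0 hH, mul_one]
    refine (mul_le_mul' le_rfl (ballPow_le_add hγ0.le (g := fun x => max (u x - m) 0)
      (h := fun x => max (-u x - m) 0) (by fun_prop) hG0 (fun x => le_max_right _ _)
      (fun x => le_max_right _ _) fun x => ?_)).trans
      ((mul_le_mul' le_rfl (mul_le_mul' le_rfl (add_le_add s1 s2))).trans ?_)
    · have h1 := le_max_left (u x - m) 0
      have h2 := le_max_left (-u x - m) 0
      have h3 := le_max_right (u x - m) 0
      have h4 := le_max_right (-u x - m) 0
      refine max_le ?_ (by linarith)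
      rcases abs_cases (u x) with h | h <;> linarith
    · rw [← ENNReal.ofReal_add (by positivity) (by positivity),
        ← ENNReal.ofReal_mul (by positivity), ← ENNReal.ofReal_mul (by positivity), ← mul_assoc,
        ← hK]
      refine ENNReal.ofReal_le_ofReal (le_of_eq ?_)
      field_simp
      norm_num
  · rw [tailPow_rescale hm0 (by norm_num) hG0 hH, mul_one]
    refine (mul_le_mul' le_rfl ((tailPow_mono hp hG0 (fun x => max_le (by linarith) (h0 x))
      le_rfl).trans hT)).trans ?_
    rw [← ENNReal.ofReal_mul (by positivity)]
    refine ENNReal.ofReal_le_ofReal ?_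
    have h1 : M / κ ≤ m ^ (p - 1) := by
      rw [← e₁]
      have : 0 < p - 1 := by linarith
      gcongr
      exact le_max_right _ _
    have h2 : (1 / 4 : ℝ) ^ (s * p) ≤ 1 :=
      Real.rpow_le_one (by norm_num) (by norm_num) (by positivity)
    rw [div_le_iff₀ hκ] at h1
    rw [Real.rpow_neg hm0.le, mul_assoc, inv_mul_le_iff₀ (by positivity)]
    nlinarith

lemma exists_closeAt_small (he : Exponents n s p τ γ) (hC : 0 < C) :
    ∃ κ : ℝ, 0 < κ ∧ ∀ η : ℝ, 0 < η → ∃ m : ℝ, 0 < m ∧ m ≤ η ∧ CloseAt n s p τ γ C κ m := by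
  have hγ0 := he.γ_pos
  obtain ⟨κ, hκ, θ, hθ, hθ2, σ, hσ, hσ4, hshrink⟩ := exists_shrink he hC
  obtain ⟨m, hm, hbase⟩ := exists_closeAt he hC hκ
  set lam := 1 - θ with hlam
  have hlam0 : 0 < lam := by linarith
  have step : ∀ m : ℝ, 0 < m → CloseAt n s p τ γ C κ m → CloseAt n s p τ γ C κ (lam * m) := by
    intro m hm hP ε' hε'
    obtain ⟨ε, hε, δ, hδ, hshrink⟩ := hshrink ε' hε'
    obtain ⟨δ₁, hδ₁, σ₁, hσ₁, hσ₁4, A, hA, hP⟩ := hP ε hε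
    have ha : 0 < m ^ (p - 1) * σ₁ ^ ((n : ℝ) - s * p) := by positivity
    refine ⟨min δ₁ (m ^ (p - 1) * σ₁ ^ ((n : ℝ) - s * p) * δ), by positivity, σ₁ * σ, by positivity,
      by nlinarith, A + m, by positivity, fun u hu hb ht => ?_⟩
    obtain ⟨c, hc, hst⟩ := hP u (hu.mono (min_le_left _ _)) hb ht
    have hv := (hu.rescale hγ0 hσ₁ (by linarith) hm c).mono (δ' := δ) (by
      rw [inv_mul_le_iff₀ ha]; exact min_le_right _ _)
    obtain ⟨c', hc', hst'⟩ := hshrink _ hv hst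
    refine ⟨c + m * c', ?_, ?_⟩
    · refine (abs_add_le _ _).trans (add_le_add hc ?_)
      rw [abs_mul, abs_of_pos hm]
      nlinarith
    · convert hst' using 2 with x
      rw [smul_smul]
      field_simp
      ring
  have hpow : ∀ k : ℕ, CloseAt n s p τ γ C κ (lam ^ k * m) := by
    intro k
    induction k with
    | zero => simpa using hbase
    | succ k ih =>
      rw [pow_succ', mul_assoc]
      exact step _ (by positivity) ih
  refine ⟨κ, hκ, fun η hη => ?_⟩
  obtain ⟨k, hk⟩ := exists_pow_lt_of_lt_one (div_pos hη hm) (by linarith : lam < 1)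
  exact ⟨lam ^ k * m, by positivity, ((lt_div_iff₀ hm).1 hk).le, hpow k⟩

/-- Decay of the excess of an almost-solution on the unit ball. -/
lemma exists_decay (he : Exponents n s p τ γ) (hC : 0 < C) :
    ∃ σ : ℝ, 0 < σ ∧ σ ≤ 1 / 4 ∧ ∃ δ : ℝ, 0 < δ ∧ ∃ A : ℝ, 0 ≤ A ∧ ∀ u : Rn n → ℝ,
      Good n s p τ γ C u δ → ballPow n (qStar p) (fun x => |u x|) 1 ≤ 1 →
      tailPow n s p (fun x => |u x|) 1 ≤ 1 →
      ∃ c, |c| ≤ A ∧ ballPow n (qStar p) (fun x => |(u (σ • x) - c) / (1 / 2)|) 1 ≤ 1 ∧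
        tailPow n s p (fun x => |(u (σ • x) - c) / (1 / 2)|) 1 ≤ 1 := by
  have hγ0 := he.γ_pos
  have hp := he.hp
  have hs := he.hs
  have hq := one_le_qStar p
  have hω := volume_ball_toReal_pos n
  set ω := (volume (ball (0 : Rn n) 1)).toReal with hω_def
  obtain ⟨Cc, hCc, hconst⟩ := exists_tailPow_const he.hn hs hp
  obtain ⟨κ, hκ, hsmall⟩ := exists_closeAt_small he hC
  obtain ⟨h₁, hh₁, e₁⟩ := exists_rpow_eq (by linarith : 0 < qStar p)
    (by positivity : 0 < (2 ^ qStar p * (2 * ω + 1))⁻¹)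
  obtain ⟨h₂, hh₂, e₂⟩ := exists_rpow_eq (by linarith : 0 < p - 1)
    (by positivity : 0 < (2 ^ (p - 1) * (κ + Cc))⁻¹)
  obtain ⟨m, hm, hmη, hP⟩ := hsmall (min h₁ h₂ / 2) (by positivity)
  obtain ⟨δ, hδ, σ, hσ, hσ4, A, hA, hP⟩ := hP 1 one_pos
  refine ⟨σ, hσ, hσ4, δ, hδ, A, hA, fun u hu hb ht => ?_⟩
  obtain ⟨c, hc, hsb, hst⟩ := hP u hu hb ht
  have hum := hu.meas
  refine ⟨c, hc, ?_⟩
  set w : Rn n → ℝ := fun x => (u (σ • x) - c) / m with hw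
  have hwm : Measurable w := by fun_prop
  have hw0 : ∀ x, 0 ≤ |w x| := fun x => abs_nonneg _
  have ha0 : ∀ x, 0 ≤ max (|w x| - 1) 0 := fun x => le_max_right _ _
  have hwa : ∀ x, |w x| ≤ max (|w x| - 1) 0 + 1 := fun x => by
    have := le_max_left (|w x| - 1) 0
    linarith
  have e : ∀ x, |(u (σ • x) - c) / (1 / 2)| = 2 * m * |w x| := fun x => by
    simp only [hw]
    rw [abs_div, abs_div _ m, abs_of_pos hm, abs_of_pos (by norm_num : (0 : ℝ) < 1 / 2)]
    field_simp
  have hm1 : 2 * m ≤ h₁ := by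
    have := hmη.trans (div_le_div_of_nonneg_right (min_le_left h₁ h₂) zero_le_two)
    linarith
  have hm2 : 2 * m ≤ h₂ := by
    have := hmη.trans (div_le_div_of_nonneg_right (min_le_right h₁ h₂) zero_le_two)
    linarith
  simp only [e]
  rw [ballPow_const_mul hw0 (by positivity), tailPow_const_mul hw0 (by positivity)]
  refine ⟨?_, ?_⟩
  · have h1 : ballPow n (qStar p) (fun x => |w x|) 1 ≤
        ENNReal.ofReal (2 ^ qStar p * (2 * ω + 1)) := by
      refine (ballPow_le_add (by linarith) (g := fun x => max (|w x| - 1) 0) (h := fun _ => 1)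
        (by fun_prop) hw0 ha0 (fun _ => zero_le_one) hwa).trans ?_
      rw [ENNReal.ofReal_mul (by positivity)]
      refine mul_le_mul' le_rfl ?_
      rw [ballPow_const, show 2 * ω + 1 = (ω + 1) + ω by ring,
        ENNReal.ofReal_add (by positivity) hω.le, ENNReal.ofReal_add hω.le zero_le_one]
      refine add_le_add ((ballPow_exponent_le ha0 one_pos (by linarith) he.hqγ).trans ?_) ?_
      · simp only [Real.one_rpow, ENNReal.ofReal_one, one_mul]
        rw [ENNReal.ofReal_one] at hsb
        exact add_le_add (volume_ball_le_one_ofReal le_rfl) hsb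
      · simp only [Real.one_rpow, ENNReal.ofReal_one, one_mul]
        exact volume_ball_le_one_ofReal le_rfl
    refine (mul_le_mul' (ENNReal.ofReal_le_ofReal (Real.rpow_le_rpow (by positivity) hm1
      (by linarith))) h1).trans ?_
    rw [e₁, ← ENNReal.ofReal_mul (by positivity), inv_mul_cancel₀ (by positivity),
      ENNReal.ofReal_one]
  · have h1 : tailPow n s p (fun x => |w x|) 1 ≤ ENNReal.ofReal (2 ^ (p - 1) * (κ + Cc)) := by
      refine (tailPow_le_add hp (g := fun x => max (|w x| - 1) 0) (h := fun _ => 1)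
        (by fun_prop) hw0 ha0 (fun _ => zero_le_one) hwa).trans ?_
      rw [ENNReal.ofReal_mul (by positivity), ENNReal.ofReal_add hκ.le hCc.le]
      refine mul_le_mul' le_rfl (add_le_add hst ?_)
      simpa using hconst 1 1 zero_le_one one_pos
    refine (mul_le_mul' (ENNReal.ofReal_le_ofReal (Real.rpow_le_rpow (by positivity) hm2
      (by linarith))) h1).trans ?_
    rw [e₂, ← ENNReal.ofReal_mul (by positivity), inv_mul_cancel₀ (by positivity),
      ENNReal.ofReal_one]

end Decay

section Excess

variable {n : ℕ} {s p τ γ C : ℝ}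

/-- The excess of `v` from the constant `c` at scale `r` is at most `m`. -/
def ExcessLE (n : ℕ) (s p : ℝ) (v : Rn n → ℝ) (c r m : ℝ) : Prop :=
  ballPow n (qStar p) (fun x => |(v (r • x) - c) / m|) 1 ≤ 1 ∧
    tailPow n s p (fun x => |(v (r • x) - c) / m|) 1 ≤ 1

lemma ExcessLE.mono (hp : 1 < p) {v : Rn n → ℝ} {c r m m' : ℝ} (h : ExcessLE n s p v c r m)
    (hm : 0 < m) (hm' : m ≤ m') : ExcessLE n s p v c r m' := by
  have hle : ∀ x : Rn n, |(v (r • x) - c) / m'| ≤ |(v (r • x) - c) / m| := fun x => by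
    rw [abs_div, abs_div _ m, abs_of_pos hm, abs_of_pos (hm.trans_le hm')]
    gcongr
  have hq := one_le_qStar p
  exact ⟨(ballPow_mono (by linarith) (fun x => abs_nonneg _) hle le_rfl).trans h.1,
    (tailPow_mono hp (fun x => abs_nonneg _) hle le_rfl).trans h.2⟩

lemma add_rpow_le_of_eighth {a b q : ℝ} (ha : 0 ≤ a) (hb : 0 ≤ b) (hq : 0 ≤ q) :
    (a + b) ^ q ≤ (9 / 8) ^ q * a ^ q + 9 ^ q * b ^ q := by
  rcases le_total (8 * b) a with h | h
  · calc (a + b) ^ q ≤ (9 / 8 * a) ^ q := by gcongr; linarith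
      _ = (9 / 8) ^ q * a ^ q := Real.mul_rpow (by norm_num) ha
      _ ≤ _ := le_add_of_nonneg_right (by positivity)
  · calc (a + b) ^ q ≤ (9 * b) ^ q := by gcongr; linarith
      _ = 9 ^ q * b ^ q := Real.mul_rpow (by norm_num) hb
      _ ≤ _ := le_add_of_nonneg_left (by positivity)

lemma exists_lintegral_rpow_close {q m : ℝ} (hq : 0 < q) (hm : 0 < m) :
    ∃ ε : ℝ, 0 < ε ∧ ∀ (ρ : Measure (Rn n)) (k f a b : Rn n → ℝ), Measurable a → Measurable k →
      (∀ x, 0 ≤ k x) → (∀ x, 0 ≤ f x) → (∀ x, 0 ≤ a x) → (∀ x, 0 ≤ b x) →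
      (∀ x, f x ≤ 4 / 5 * (a x + m⁻¹ * b x)) →
      ∫⁻ x, ENNReal.ofReal (a x ^ q * k x) ∂ρ ≤ 1 →
      ∫⁻ x, ENNReal.ofReal (b x ^ q * k x) ∂ρ ≤ ENNReal.ofReal ε →
      ∫⁻ x, ENNReal.ofReal (f x ^ q * k x) ∂ρ ≤ 1 := by
  have h1 : (4 / 5 : ℝ) ^ q * (9 / 8) ^ q < 1 := by
    rw [← Real.mul_rpow (by norm_num) (by norm_num)]
    exact Real.rpow_lt_one (by norm_num) (by norm_num) hq
  set X : ℝ := (4 / 5 : ℝ) ^ q * (9 / 8) ^ q with hX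
  set Y : ℝ := (4 / 5 : ℝ) ^ q * 9 ^ q * (m⁻¹) ^ q with hY
  have hX0 : 0 < X := by positivity
  have hY0 : 0 < Y := by positivity
  refine ⟨(1 - X) / Y, div_pos (by linarith) hY0, ?_⟩
  intro ρ k f a b ha hk hk0 hf0 ha0 hb0 hle h1 h2
  have hpt : ∀ x, f x ^ q * k x ≤ X * (a x ^ q * k x) + Y * (b x ^ q * k x) := fun x => by
    have hb := hb0 x
    have ha := ha0 x
    have hf := hf0 x
    have hk := hk0 x
    have : f x ^ q ≤ X * a x ^ q + Y * b x ^ q := by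
      calc f x ^ q ≤ (4 / 5 * (a x + m⁻¹ * b x)) ^ q := by gcongr; exact hle x
        _ = (4 / 5) ^ q * (a x + m⁻¹ * b x) ^ q := Real.mul_rpow (by norm_num) (by positivity)
        _ ≤ (4 / 5) ^ q * ((9 / 8) ^ q * a x ^ q + 9 ^ q * (m⁻¹ * b x) ^ q) := by
            gcongr
            exact add_rpow_le_of_eighth ha (by positivity) hq.le
        _ = _ := by rw [Real.mul_rpow (by positivity) hb]; ring
    calc f x ^ q * k x ≤ (X * a x ^ q + Y * b x ^ q) * k x := by gcongr
      _ = _ := by ring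
  calc ∫⁻ x, ENNReal.ofReal (f x ^ q * k x) ∂ρ
      ≤ ∫⁻ x, (ENNReal.ofReal X * ENNReal.ofReal (a x ^ q * k x) +
          ENNReal.ofReal Y * ENNReal.ofReal (b x ^ q * k x)) ∂ρ := by
        refine lintegral_mono fun x => ?_
        have hb := hb0 x
        have ha := ha0 x
        have hk := hk0 x
        rw [← ENNReal.ofReal_mul hX0.le, ← ENNReal.ofReal_mul hY0.le,
          ← ENNReal.ofReal_add (by positivity) (by positivity)]
        exact ENNReal.ofReal_le_ofReal (hpt x)
    _ = ENNReal.ofReal X * ∫⁻ x, ENNReal.ofReal (a x ^ q * k x) ∂ρ +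
          ENNReal.ofReal Y * ∫⁻ x, ENNReal.ofReal (b x ^ q * k x) ∂ρ := by
        rw [lintegral_add_left (by fun_prop), lintegral_const_mul' _ _ ENNReal.ofReal_ne_top,
          lintegral_const_mul' _ _ ENNReal.ofReal_ne_top]
    _ ≤ ENNReal.ofReal X * 1 + ENNReal.ofReal Y * ENNReal.ofReal ((1 - X) / Y) :=
        add_le_add (mul_le_mul' le_rfl h1) (mul_le_mul' le_rfl h2)
    _ = 1 := by
        rw [mul_one, ← ENNReal.ofReal_mul hY0.le, ← ENNReal.ofReal_add hX0.le
          (by rw [mul_div_cancel₀ _ hY0.ne']; linarith), mul_div_cancel₀ _ hY0.ne']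
        simp

/-- The excess is stable under small perturbations. -/
lemma exists_excessLE_of_close (hp : 1 < p) {m : ℝ} (hm : 0 < m) :
    ∃ ε : ℝ, 0 < ε ∧ ∀ (v w : Rn n → ℝ) (c r : ℝ), Measurable v → ExcessLE n s p v c r m →
      ballPow n (qStar p) (fun x => |w (r • x) - v (r • x)|) 1 ≤ ENNReal.ofReal ε →
      tailPow n s p (fun x => |w (r • x) - v (r • x)|) 1 ≤ ENNReal.ofReal ε →
      ExcessLE n s p w c r (5 / 4 * m) := by
  have hq := one_le_qStar p
  obtain ⟨ε₁, hε₁, h₁⟩ := exists_lintegral_rpow_close (n := n) (by linarith : 0 < qStar p) hm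
  obtain ⟨ε₂, hε₂, h₂⟩ := exists_lintegral_rpow_close (n := n) (by linarith : 0 < p - 1) hm
  refine ⟨min ε₁ ε₂, by positivity, fun v w c r hv hE hb ht => ?_⟩
  have hle : ∀ x : Rn n, |(w (r • x) - c) / (5 / 4 * m)| ≤
      4 / 5 * (|(v (r • x) - c) / m| + m⁻¹ * |w (r • x) - v (r • x)|) := fun x => by
    rw [abs_div, abs_div _ m, abs_of_pos hm, abs_of_pos (by positivity : 0 < 5 / 4 * m)]
    have := abs_add_le (v (r • x) - c) (w (r • x) - v (r • x))
    rw [show v (r • x) - c + (w (r • x) - v (r • x)) = w (r • x) - c by ring] at this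
    calc |w (r • x) - c| / (5 / 4 * m)
        ≤ (|v (r • x) - c| + |w (r • x) - v (r • x)|) / (5 / 4 * m) := by gcongr
      _ = _ := by field_simp
  refine ⟨?_, ?_⟩
  · have := h₁ (volume.restrict (ball 0 1)) (fun _ => 1)
      (fun x => |(w (r • x) - c) / (5 / 4 * m)|) (fun x => |(v (r • x) - c) / m|)
      (fun x => |w (r • x) - v (r • x)|) (by fun_prop) measurable_const (fun _ => zero_le_one)
      (fun x => abs_nonneg _) (fun x => abs_nonneg _) (fun x => abs_nonneg _) hle
    simp only [mul_one] at this
    exact this hE.1 (hb.trans (ENNReal.ofReal_le_ofReal (min_le_left _ _)))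
  · exact h₂ (volume.restrict (ball 0 1)ᶜ) (fun x => ‖x‖ ^ (-((n : ℝ) + s * p)))
      (fun x => |(w (r • x) - c) / (5 / 4 * m)|) (fun x => |(v (r • x) - c) / m|)
      (fun x => |w (r • x) - v (r • x)|) (by fun_prop) (by fun_prop) (fun _ => by positivity)
      (fun x => abs_nonneg _) (fun x => abs_nonneg _) (fun x => abs_nonneg _) hle hE.2
      (ht.trans (ENNReal.ofReal_le_ofReal (min_le_right _ _)))

/-- Excess decay for weak solutions. -/
lemma exists_weakSol_decay {Λ : ℝ} (hn : 2 ≤ n) (hs : 0 < s) (hs1 : s < 1)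
    (hp : 2 - s / (n : ℝ) < p) (hΛ : 1 ≤ Λ) :
    ∃ σ : ℝ, 0 < σ ∧ σ ≤ 1 / 4 ∧ ∃ δ : ℝ, 0 < δ ∧ ∃ A : ℝ, 0 ≤ A ∧
      ∀ (Φ : ℝ → ℝ) (K : Rn n → Rn n → ℝ) (Ω : Set (Rn n)) (u f : Rn n → ℝ) (x₀ : Rn n)
        (r m c : ℝ), KernelBounds n Λ s p K → PhiBounds Λ p Φ → Measurable u →
        memWsp n s p univ u → Continuous f → HasCompactSupport f →
        (∀ φ, IsTestFun n Ω φ → nonlocalForm n Φ K u φ = ∫ x, φ x * f x) →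
        0 < r → 0 < m → ball x₀ r ⊆ Ω →
        ∫⁻ x in ball x₀ r, ENNReal.ofReal |f x| ≤
          ENNReal.ofReal (δ * (m ^ (p - 1) * r ^ ((n : ℝ) - s * p))) →
        ExcessLE n s p (fun x => u (x₀ + x)) c r m →
        ∃ c', |c' - c| ≤ A * m ∧ ExcessLE n s p (fun x => u (x₀ + x)) c' (σ * r) (m / 2) := by
  obtain ⟨τ, γ, he⟩ := exists_exponents hn hs hs1 hp
  have hγ0 := he.γ_pos
  obtain ⟨C, hC, hcacc⟩ := exists_caccioppoli he.hn hs hs1 he.hp he.hτ he.hτγ hΛ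
  obtain ⟨σ, hσ, hσ4, δ, hδ, A, hA, hdec⟩ := exists_decay he hC
  refine ⟨σ, hσ, hσ4, δ, hδ, A, hA, ?_⟩
  intro Φ K Ω u f x₀ r m c hK hΦ hu hW hf hfc hform hr hm hball hδf hE
  have key : ∀ I : ℝ≥0∞, I ≤ ENNReal.ofReal (δ * (m ^ (p - 1) * r ^ ((n : ℝ) - s * p))) →
      ENNReal.ofReal (m ^ (p - 1) * r ^ ((n : ℝ) - s * p))⁻¹ * I ≤ ENNReal.ofReal δ := by
    intro I hI
    refine (mul_le_mul' le_rfl hI).trans (le_of_eq ?_)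
    rw [← ENNReal.ofReal_mul (by positivity)]
    congr 1
    field_simp
  have hsub := hcacc Φ K Ω u f x₀ r hK hΦ hu hW.2.2 hf hfc hform hball
  have hsup := hcacc _ K Ω (fun x => -u x) (fun x => -f x) x₀ r hK hΦ.neg hu.neg
    (by
      convert hW.2.2 using 1
      simp only [gagliardo]
      refine lintegral_congr fun x => lintegral_congr fun y => ?_
      rw [neg_sub_neg, abs_sub_comm])
    hf.neg (by simpa [Function.comp_def] using hfc.comp_left (g := fun t : ℝ => -t) (by simp))
    (fun φ hφ => by
      have := hform φ hφ
      simp only [nonlocalForm] at this ⊢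
      simp only [neg_sub_neg, neg_mul, integral_neg, mul_neg, neg_sub]
      rw [← this])
    hball
  set w : Rn n → ℝ := fun x => (u (x₀ + r • x) - c) / m with hw
  have hg : Good n s p τ γ C w δ := by
    refine ⟨by fun_prop, (hsub.rescale hu hr le_rfl hm c).mono (key _ hδf), ?_, ?_⟩
    · have := (hsup.rescale hu.neg hr le_rfl hm (-c)).mono (key _ (by simpa using hδf))
      convert this using 2 with x
      simp only [hw]
      rw [← neg_div]
      congr 1
      ring
    · have h1 : ballPow n p (fun x => |u (x₀ + x)|) r < ⊤ := by
        have h := lintegral_ball_affine (fun x => ENNReal.ofReal (|u x| ^ p)) x₀ one_pos r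
        simp only [one_mul, one_smul, one_pow, ENNReal.ofReal_one] at h
        rw [ballPow, ← h]
        refine lt_of_le_of_lt (setLIntegral_le_lintegral _ _) ?_
        simpa using hW.2.1
      have hball : ∀ q : ℝ, volume (ball (0 : Rn n) q) < ⊤ := fun q => measure_ball_lt_top
      rw [ballPow_rescale (q := γ) (G := fun x => |u (x₀ + x) - c|) hm hr (fun x => abs_nonneg _)
        (fun x => by simp only [hw]; rw [abs_div, abs_of_pos hm])]
      refine ENNReal.mul_lt_top ENNReal.ofReal_lt_top ?_
      refine (ballPow_le_add hγ0.le (g := fun x => |u (x₀ + x)|) (h := fun _ => |c|) (by fun_prop)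
        (fun x => abs_nonneg _) (fun x => abs_nonneg _) (fun x => abs_nonneg _)
        (fun x => abs_sub _ _)).trans_lt ?_
      rw [ballPow_const, mul_one]
      refine ENNReal.mul_lt_top ENNReal.ofReal_lt_top (ENNReal.add_lt_top.2
        ⟨?_, ENNReal.mul_lt_top ENNReal.ofReal_lt_top (hball _)⟩)
      refine (ballPow_exponent_le (fun x => abs_nonneg _) one_pos hγ0 he.hγp).trans_lt ?_
      exact ENNReal.add_lt_top.2 ⟨ENNReal.mul_lt_top ENNReal.ofReal_lt_top (hball _),
        ENNReal.mul_lt_top ENNReal.ofReal_lt_top h1⟩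
  obtain ⟨c₁, hc₁, h₁, h₂⟩ := hdec w hg hE.1 hE.2
  have e : ∀ x : Rn n, (w (σ • x) - c₁) / (1 / 2) =
      (u (x₀ + (σ * r) • x) - (c + m * c₁)) / (m / 2) := fun x => by
    simp only [hw]
    rw [smul_smul, mul_comm r σ]
    field_simp
    ring
  simp only [e] at h₁ h₂
  refine ⟨c + m * c₁, ?_, h₁, h₂⟩
  rw [add_sub_cancel_left, abs_mul, abs_of_pos hm, mul_comm]
  gcongr

end Excess

section Limit

variable {n : ℕ} {s p : ℝ}

/-- The excess decay passes to limits of approximating sequences. -/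
lemma exists_decay_of_approx (hp : 1 < p) {σ δ A r₀ : ℝ} (hσ : 0 < σ) (hδ : 0 < δ)
    {v : Rn n → ℝ} {V : ℕ → Rn n → ℝ} {N : ℝ → ℝ≥0∞} {N' : ℕ → ℝ → ℝ≥0∞} (hv : Measurable v)
    (hVm : ∀ j, Measurable (V j))
    (hV : ∀ j r m c, 0 < r → r ≤ r₀ → 0 < m →
      N' j r ≤ ENNReal.ofReal (δ * (m ^ (p - 1) * r ^ ((n : ℝ) - s * p))) →
      ExcessLE n s p (V j) c r m →
      ∃ c', |c' - c| ≤ A * m ∧ ExcessLE n s p (V j) c' (σ * r) (m / 2))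
    (hN : ∀ r, 0 < r → limsup (fun j => N' j r) atTop ≤ N r)
    (hb : ∀ R, 0 < R →
      Tendsto (fun j => ballPow n (qStar p) (fun x => |V j x - v x|) R) atTop (𝓝 0))
    (ht : ∀ R, 0 < R → Tendsto (fun j => tailPow n s p (fun x => |V j x - v x|) R) atTop (𝓝 0))
    {r m c : ℝ} (hr : 0 < r) (hr₀ : r ≤ r₀) (hm : 0 < m)
    (hNr : N r < ENNReal.ofReal (δ * (m ^ (p - 1) * r ^ ((n : ℝ) - s * p))))
    (hE : ExcessLE n s p v c r m) :
    ∃ c', |c' - c| ≤ A * (5 / 4 * m) ∧ ExcessLE n s p v c' (σ * r) (25 / 32 * m) := by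
  obtain ⟨ε₁, hε₁, h₁⟩ := exists_excessLE_of_close (n := n) (s := s) hp hm
  obtain ⟨ε₂, hε₂, h₂⟩ := exists_excessLE_of_close (n := n) (s := s) hp
    (by positivity : 0 < 5 / 4 * m / 2)
  have hb' : ∀ R : ℝ, 0 < R → Tendsto (fun j =>
      ballPow n (qStar p) (fun x => |V j (R • x) - v (R • x)|) 1) atTop (𝓝 0) := fun R hR => by
    have h := ENNReal.Tendsto.const_mul (a := ENNReal.ofReal (R ^ n)⁻¹) (hb R hR)
      (Or.inr ENNReal.ofReal_ne_top)
    rw [mul_zero] at h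
    refine h.congr fun j => ?_
    rw [ballPow_comp_smul (qStar p) (fun x => |V j x - v x|) hR, mul_one]
  have ht' : ∀ R : ℝ, 0 < R → Tendsto (fun j =>
      tailPow n s p (fun x => |V j (R • x) - v (R • x)|) 1) atTop (𝓝 0) := fun R hR => by
    have h := ENNReal.Tendsto.const_mul (a := ENNReal.ofReal (R ^ (s * p))) (ht R hR)
      (Or.inr ENNReal.ofReal_ne_top)
    rw [mul_zero] at h
    refine h.congr fun j => ?_
    rw [tailPow_comp_smul (fun x => |V j x - v x|) hR, mul_one]
  have ev1 := (hb' r hr).eventually_le_const (ENNReal.ofReal_pos.2 hε₁)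
  have ev2 := (ht' r hr).eventually_le_const (ENNReal.ofReal_pos.2 hε₁)
  have ev3 := (hb' (σ * r) (by positivity)).eventually_le_const (ENNReal.ofReal_pos.2 hε₂)
  have ev4 := (ht' (σ * r) (by positivity)).eventually_le_const (ENNReal.ofReal_pos.2 hε₂)
  have ev5 := eventually_lt_of_limsup_lt ((hN r hr).trans_lt hNr)
  obtain ⟨j, j1, j2, j3, j4, j5⟩ := (ev1.and (ev2.and (ev3.and (ev4.and ev5)))).exists
  have hEj := h₁ v (V j) c r hv hE j1 j2
  have hp1 : 0 < p - 1 := by linarith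
  obtain ⟨c', hc', hE'⟩ := hV j r (5 / 4 * m) c hr hr₀ (by positivity)
    (j5.le.trans (ENNReal.ofReal_le_ofReal (by gcongr; linarith))) hEj
  refine ⟨c', hc', ?_⟩
  have := h₂ (V j) v c' (σ * r) (hVm j) hE' (by simpa only [abs_sub_comm] using j3)
    (by simpa only [abs_sub_comm] using j4)
  rwa [show 5 / 4 * (5 / 4 * m / 2) = 25 / 32 * m by ring] at this

lemma ballAvg_sub_le {v : Rn n → ℝ} (hv : Measurable v) {σ c r ρ m : ℝ} (hσ : 0 < σ)
    (hr : 0 < r) (hm : 0 < m) (hρ : ρ ≤ r) (hσρ : σ * r ≤ ρ) (hE : ExcessLE n s p v c r m) :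
    |ballAvg n v 0 ρ - c| ≤ (((volume (ball (0 : Rn n) 1)).toReal + 1) /
      (σ ^ n * (volume (ball (0 : Rn n) 1)).toReal)) * m := by
  have hω := volume_ball_toReal_pos n
  set ω := (volume (ball (0 : Rn n) 1)).toReal with hω_def
  have hρ0 : 0 < ρ := lt_of_lt_of_le (by positivity) hσρ
  have hq := one_le_qStar p
  have h1 : ballPow n 1 (fun x => |v x - c|) r ≤ ENNReal.ofReal (m * r ^ n * (ω + 1)) := by
    have h := ballPow_rescale (n := n) (q := 1) (H := fun x => |(v (r • x) - c) / m|)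
      (G := fun x => |v x - c|) hm hr (fun x => abs_nonneg _)
      (fun x => by rw [abs_div, abs_of_pos hm]) 1
    have h2 : ballPow n 1 (fun x => |(v (r • x) - c) / m|) 1 ≤ ENNReal.ofReal (ω + 1) := by
      refine (ballPow_exponent_le (fun x => abs_nonneg _) one_pos one_pos hq).trans ?_
      simp only [Real.one_rpow, ENNReal.ofReal_one, one_mul]
      rw [ENNReal.ofReal_add hω.le zero_le_one, ENNReal.ofReal_one]
      refine add_le_add (le_of_eq ?_) hE.1
      rw [hω_def, ENNReal.ofReal_toReal measure_ball_lt_top.ne]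
    rw [h, mul_one] at h2
    calc ballPow n 1 (fun x => |v x - c|) r
        = ENNReal.ofReal (m * r ^ n) * (ENNReal.ofReal (m ^ (-1 : ℝ) * (r ^ n)⁻¹) *
            ballPow n 1 (fun x => |v x - c|) r) := by
          rw [← mul_assoc, ← ENNReal.ofReal_mul (by positivity), Real.rpow_neg_one,
            show m * r ^ n * (m⁻¹ * (r ^ n)⁻¹) = 1 by field_simp, ENNReal.ofReal_one, one_mul]
      _ ≤ ENNReal.ofReal (m * r ^ n) * ENNReal.ofReal (ω + 1) := mul_le_mul' le_rfl h2
      _ = _ := by rw [← ENNReal.ofReal_mul (by positivity)]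
  have h2 : ∫⁻ x in ball (0 : Rn n) ρ, ‖v x - c‖ₑ ≤ ENNReal.ofReal (m * r ^ n * (ω + 1)) := by
    refine le_trans ?_ h1
    refine le_trans (lintegral_mono_set (ball_subset_ball hρ)) (le_of_eq ?_)
    refine lintegral_congr fun x => ?_
    rw [Real.rpow_one, Real.enorm_eq_ofReal_abs]
  have hint : IntegrableOn (fun x => v x - c) (ball (0 : Rn n) ρ) :=
    ⟨by fun_prop, h2.trans_lt ENNReal.ofReal_lt_top⟩
  have hvol : volume.real (ball (0 : Rn n) ρ) = ρ ^ n * ω := by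
    rw [measureReal_def, volume_ball_eq 0 hρ0, ENNReal.toReal_ofReal (by positivity)]
  have hintv : IntegrableOn v (ball (0 : Rn n) ρ) := by
    have := hint.add (integrableOn_const (C := c) (s := ball (0 : Rn n) ρ)
      measure_ball_lt_top.ne)
    simpa [Pi.add_def] using this
  have h3 : ballAvg n v 0 ρ - c = (ρ ^ n * ω)⁻¹ * ∫ x in ball (0 : Rn n) ρ, (v x - c) := by
    rw [integral_sub hintv (integrableOn_const measure_ball_lt_top.ne), setIntegral_const, ballAvg,
      setAverage_eq, hvol]
    simp only [smul_eq_mul]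
    field_simp
  have h4 : |∫ x in ball (0 : Rn n) ρ, (v x - c)| ≤ m * r ^ n * (ω + 1) := by
    have := (enorm_integral_le_lintegral_enorm (μ := volume.restrict (ball (0 : Rn n) ρ))
      (fun x => v x - c)).trans h2
    rwa [Real.enorm_eq_ofReal_abs,
      ENNReal.ofReal_le_ofReal_iff (by positivity)] at this
  rw [h3, abs_mul, abs_of_pos (by positivity)]
  calc (ρ ^ n * ω)⁻¹ * |∫ x in ball (0 : Rn n) ρ, (v x - c)|
      ≤ ((σ * r) ^ n * ω)⁻¹ * (m * r ^ n * (ω + 1)) := by gcongr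
    _ = _ := by rw [mul_pow]; field_simp

/-- Iterating the excess decay along a geometric sequence of radii. -/
lemma exists_tendsto_ballAvg (hp : 1 < p) {v : Rn n → ℝ} (hv : Measurable v)
    {σ θ B r : ℝ} {a : ℕ → ℝ} (hσ : 0 < σ) (hσ1 : σ < 1) (hθ : 0 < θ) (hθ1 : θ < 1) (hB : 0 ≤ B)
    (hr : 0 < r) (ha0 : 0 < a 0) (ha : ∀ i, 0 ≤ a i) (has : Summable a)
    (h0 : ExcessLE n s p v 0 r (a 0))
    (hstep : ∀ i m c, 0 < m → a i ≤ m → ExcessLE n s p v c (σ ^ i * r) m →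
      ∃ c', |c' - c| ≤ B * m ∧ ExcessLE n s p v c' (σ ^ (i + 1) * r) (θ * m)) :
    ∃ L : ℝ, Tendsto (fun ρ => ballAvg n v 0 ρ) (𝓝[>] (0 : ℝ)) (𝓝 L) ∧
      |L| ≤ B / (1 - θ) * ∑' i, a i := by
  let M : ℕ → ℝ := fun i => Nat.rec (a 0) (fun i m => θ * m + a (i + 1)) i
  have hM0 : M 0 = a 0 := rfl
  have hMs : ∀ i, M (i + 1) = θ * M i + a (i + 1) := fun i => rfl
  have hMpos : ∀ i, 0 < M i := by
    intro i
    induction i with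
    | zero => exact ha0
    | succ i ih => rw [hMs]; have := ha (i + 1); positivity
  have hMa : ∀ i, a i ≤ M i := by
    intro i
    cases i with
    | zero => exact le_rfl
    | succ i => rw [hMs]; have := hMpos i; nlinarith
  have hex : ∀ i c, ∃ c', ExcessLE n s p v c (σ ^ i * r) (M i) →
      |c' - c| ≤ B * M i ∧ ExcessLE n s p v c' (σ ^ (i + 1) * r) (M (i + 1)) := by
    intro i c
    by_cases h : ExcessLE n s p v c (σ ^ i * r) (M i)
    · obtain ⟨c', h1, h2⟩ := hstep i (M i) c (hMpos i) (hMa i) h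
      refine ⟨c', fun _ => ⟨h1, h2.mono hp (mul_pos hθ (hMpos i)) ?_⟩⟩
      rw [hMs]
      linarith [ha (i + 1)]
    · exact ⟨0, fun h' => absurd h' h⟩
  choose F hF using hex
  let c : ℕ → ℝ := fun i => Nat.rec 0 (fun i c => F i c) i
  have hc0 : c 0 = 0 := rfl
  have hcs : ∀ i, c (i + 1) = F i (c i) := fun i => rfl
  have hcE : ∀ i, ExcessLE n s p v (c i) (σ ^ i * r) (M i) := by
    intro i
    induction i with
    | zero => simpa [hc0, hM0] using h0
    | succ i ih => rw [hcs]; exact (hF i (c i) ih).2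
  have hcd : ∀ i, dist (c i) (c (i + 1)) ≤ B * M i := fun i => by
    rw [dist_comm, Real.dist_eq, hcs]
    exact (hF i (c i) (hcE i)).1
  have hsum : ∀ N, (1 - θ) * ∑ i ∈ Finset.range N, M i + M N =
      ∑ i ∈ Finset.range (N + 1), a i := by
    intro N
    induction N with
    | zero => simp [hM0]
    | succ N ih => rw [Finset.sum_range_succ _ (N + 1), ← ih, Finset.sum_range_succ, hMs]; ring
  have hθ' : 0 < 1 - θ := by linarith
  have hle : ∀ N, ∑ i ∈ Finset.range N, M i ≤ (∑' i, a i) / (1 - θ) := fun N => by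
    rw [le_div_iff₀ hθ', mul_comm]
    have h1 := hsum N
    have h2 := has.sum_le_tsum (Finset.range (N + 1)) fun i _ => ha i
    have h3 := hMpos N
    linarith
  have hMsum : Summable M := summable_of_sum_range_le (fun i => (hMpos i).le) hle
  have hBM : Summable fun i => B * M i := hMsum.mul_left B
  obtain ⟨L, hL⟩ := cauchySeq_tendsto_of_complete (cauchySeq_of_dist_le_of_summable _ hcd hBM)
  refine ⟨L, ?_, ?_⟩
  · set C₁ := (((volume (ball (0 : Rn n) 1)).toReal + 1) /
      (σ ^ n * (volume (ball (0 : Rn n) 1)).toReal)) with hC₁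
    have hlim : Tendsto (fun i => C₁ * M i + |c i - L|) atTop (𝓝 0) := by
      have h1 := hMsum.tendsto_atTop_zero.const_mul C₁
      have h2 := (hL.sub_const L).abs
      simpa using h1.add h2
    rw [Metric.tendsto_nhds]
    intro ε hε
    obtain ⟨I, hI⟩ := eventually_atTop.1 (hlim.eventually_lt_const hε)
    filter_upwards [Ioo_mem_nhdsGT (by positivity : 0 < σ ^ I * r)] with ρ hρ
    have hx0 : 0 < ρ / r := div_pos hρ.1 hr
    have hxI : ρ / r < σ ^ I := (div_lt_iff₀ hr).2 hρ.2
    obtain ⟨i, hi1, hi2⟩ := exists_nat_pow_near_of_lt_one hx0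
      (hxI.le.trans (pow_le_one₀ hσ.le hσ1.le)) hσ hσ1
    have hiI : I ≤ i := by
      have := (pow_lt_pow_iff_right_of_lt_one₀ hσ hσ1).1 (hi1.trans hxI)
      omega
    rw [lt_div_iff₀ hr] at hi1
    rw [div_le_iff₀ hr] at hi2
    have h1 := ballAvg_sub_le hv hσ (by positivity) (hMpos i) hi2
      (by rw [← mul_assoc, ← pow_succ']; exact hi1.le) (hcE i)
    rw [Real.dist_eq]
    have h2 := abs_sub_le (ballAvg n v 0 ρ) (c i) L
    have h3 := hI i hiI
    linarith
  · have h1 := dist_le_tsum_of_dist_le_of_tendsto₀ _ hcd hBM hL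
    rw [hc0, dist_zero_left, Real.norm_eq_abs, tsum_mul_left] at h1
    have h2 := Real.tsum_le_of_sum_range_le (fun i => (hMpos i).le) hle
    calc |L| ≤ B * ∑' i, M i := h1
      _ ≤ B * ((∑' i, a i) / (1 - θ)) := by gcongr
      _ = _ := by ring

end Limit

section Wolff

variable {n : ℕ} {s p : ℝ}

/-- A dyadic sum is controlled by the Wolff potential. -/
lemma exists_tsum_le_wolff (hp : 1 < p) : ∃ κ : ℝ, 0 < κ ∧
    ∀ (ν : Measure (Rn n)) (x₀ : Rn n) (σ r : ℝ), 0 < σ → σ ≤ 1 / 4 → 0 < r →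
      ∑' i : ℕ, (ν (closedBall x₀ (σ ^ i * (r / 2))) /
        ENNReal.ofReal ((σ ^ i * (r / 2)) ^ ((n : ℝ) - s * p))) ^ (1 / (p - 1)) ≤
      ENNReal.ofReal κ * wolff n s p ν x₀ r := by
  have hp1 : 0 < 1 / (p - 1) := by
    have : 0 < p - 1 := by linarith
    positivity
  set e : ℝ := (n : ℝ) - s * p with he
  refine ⟨2 * ((2 : ℝ) ^ |e|) ^ (1 / (p - 1)), by positivity, ?_⟩
  set κ : ℝ := 2 * ((2 : ℝ) ^ |e|) ^ (1 / (p - 1)) with hκ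
  intro ν x₀ σ r hσ hσ4 hr
  set R : ℕ → ℝ := fun i => σ ^ i * (r / 2) with hR
  have hR0 : ∀ i, 0 < R i := fun i => by positivity
  have hR2 : ∀ i j, i < j → 2 * R j ≤ R i := by
    intro i j hij
    have h1 : σ ^ j ≤ σ ^ (i + 1) := pow_le_pow_of_le_one hσ.le (by linarith) hij
    have h2 : 0 < σ ^ i := by positivity
    rw [pow_succ] at h1
    calc 2 * R j = σ ^ j * r := by simp only [hR]; ring
      _ ≤ σ ^ i * (1 / 4) * r := by gcongr; exact h1.trans (by gcongr)
      _ ≤ σ ^ i * (1 / 2) * r := by gcongr; norm_num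
      _ = R i := by simp only [hR]; ring
  set G : ℝ → ℝ≥0∞ := fun ρ => (ν (ball x₀ ρ) / ENNReal.ofReal (ρ ^ e)) ^ (1 / (p - 1)) /
      ENNReal.ofReal ρ with hG
  have key : ∀ i, (ν (closedBall x₀ (R i)) / ENNReal.ofReal (R i ^ e)) ^ (1 / (p - 1)) ≤
      ENNReal.ofReal κ * ∫⁻ ρ in Ioc (R i) (2 * R i), G ρ := by
    intro i
    have hRi := hR0 i
    set N := ν (closedBall x₀ (R i)) with hN
    have hlow : ∀ ρ ∈ Ioc (R i) (2 * R i),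
        (N / ENNReal.ofReal (2 ^ |e| * R i ^ e)) ^ (1 / (p - 1)) / ENNReal.ofReal (2 * R i) ≤
          G ρ := by
      intro ρ hρ
      have hρ0 : 0 < ρ := hRi.trans hρ.1
      refine ENNReal.div_le_div (ENNReal.rpow_le_rpow (ENNReal.div_le_div
        (measure_mono (closedBall_subset_ball hρ.1)) (ENNReal.ofReal_le_ofReal ?_)) hp1.le)
        (ENNReal.ofReal_le_ofReal hρ.2)
      have h1 : 1 ≤ ρ / R i := (one_le_div hRi).2 hρ.1.le
      have h2 : ρ / R i ≤ 2 := (div_le_iff₀ hRi).2 hρ.2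
      have h3 : (ρ / R i) ^ e ≤ 2 ^ |e| :=
        (Real.rpow_le_rpow_of_exponent_le h1 (le_abs_self e)).trans
          (Real.rpow_le_rpow (by positivity) h2 (abs_nonneg e))
      rwa [Real.div_rpow hρ0.le hRi.le, div_le_iff₀ (by positivity)] at h3
    have hint : (N / ENNReal.ofReal (2 ^ |e| * R i ^ e)) ^ (1 / (p - 1)) /
        ENNReal.ofReal (2 * R i) * ENNReal.ofReal (R i) ≤
          ∫⁻ ρ in Ioc (R i) (2 * R i), G ρ := by
      refine le_trans (le_of_eq ?_) (setLIntegral_mono' measurableSet_Ioc hlow)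
      rw [setLIntegral_const, Real.volume_Ioc]
      congr 2
      ring
    refine le_trans (le_of_eq ?_) (mul_le_mul' le_rfl hint)
    have h2e : (0 : ℝ) < 2 ^ |e| := by positivity
    rw [hκ, ENNReal.ofReal_mul zero_le_two, ENNReal.ofReal_mul (p := 2 ^ |e|) h2e.le,
      ENNReal.ofReal_mul (p := 2) (q := R i) zero_le_two,
      ← ENNReal.ofReal_rpow_of_pos h2e]
    have a0 : ENNReal.ofReal (2 ^ |e|) ≠ 0 := (ENNReal.ofReal_pos.2 h2e).ne'
    have b0 : ENNReal.ofReal (R i) ≠ 0 := (ENNReal.ofReal_pos.2 hRi).ne'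
    have c0 : ENNReal.ofReal 2 ≠ 0 := (ENNReal.ofReal_pos.2 zero_lt_two).ne'
    have d1 : N / ENNReal.ofReal (R i ^ e) =
        ENNReal.ofReal (2 ^ |e|) * (N / (ENNReal.ofReal (2 ^ |e|) * ENNReal.ofReal (R i ^ e))) := by
      rw [← mul_div_assoc, ENNReal.mul_div_mul_left _ _ a0 ENNReal.ofReal_ne_top]
    rw [d1, ENNReal.mul_rpow_of_nonneg _ _ hp1.le]
    set X := (N / (ENNReal.ofReal (2 ^ |e|) * ENNReal.ofReal (R i ^ e))) ^ (1 / (p - 1))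
    set Y := ENNReal.ofReal (2 ^ |e|) ^ (1 / (p - 1))
    have d2 : ENNReal.ofReal 2 * (X / (ENNReal.ofReal 2 * ENNReal.ofReal (R i)) *
        ENNReal.ofReal (R i)) = X := by
      rw [mul_comm (X / _), ← mul_assoc, ENNReal.mul_div_cancel (mul_ne_zero c0 b0)
        (ENNReal.mul_ne_top ENNReal.ofReal_ne_top ENNReal.ofReal_ne_top)]
    rw [mul_comm (ENNReal.ofReal 2) Y, mul_assoc, d2]
  refine (ENNReal.tsum_le_tsum key).trans ?_
  rw [ENNReal.tsum_mul_left]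
  refine mul_le_mul' le_rfl ?_
  have hdisj : Pairwise (Function.onFun Disjoint fun i => Ioc (R i) (2 * R i)) := by
    intro i j hij
    wlog h : i < j generalizing i j
    · exact (this hij.symm (lt_of_le_of_ne (not_lt.1 h) hij.symm)).symm
    · refine Set.disjoint_left.2 fun ρ h1 h2 => ?_
      have := hR2 i j h
      linarith [h1.1, h2.2]
  rw [← lintegral_iUnion (fun i => measurableSet_Ioc) hdisj]
  refine lintegral_mono_set (iUnion_subset fun i ρ hρ => ⟨(hR0 i).trans hρ.1, hρ.2.trans ?_⟩)
  have : σ ^ i ≤ 1 := pow_le_one₀ hσ.le (by linarith)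
  simp only [hR]
  nlinarith

/-- Initial excess bound in terms of the average and the tail. -/
lemma exists_excessLE_initial (hs : 0 < s) (hp : 1 < p) : ∃ C₂ : ℝ, 0 < C₂ ∧
    ∀ (v : Rn n → ℝ) (r m : ℝ), 0 < m →
      ballPow n (qStar p) (fun x => |v (r • x) / m|) 1 ≤ volume (ball (0 : Rn n) 1) →
      tailPow n s p (fun x => |v (r • x) / m|) 1 ≤ 1 →
      ExcessLE n s p v 0 (r / 2) (C₂ * m) := by
  have hq := one_le_qStar p
  have hω := volume_ball_toReal_pos n
  set ω := (volume (ball (0 : Rn n) 1)).toReal with hω_def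
  have hωv : volume (ball (0 : Rn n) 1) = ENNReal.ofReal ω :=
    (ENNReal.ofReal_toReal measure_ball_lt_top.ne).symm
  obtain ⟨h₁, hh₁, e₁⟩ := exists_rpow_eq (by linarith : 0 < qStar p)
    (by positivity : 0 < ((1 / 2 : ℝ) ^ n)⁻¹ * ω)
  obtain ⟨h₂, hh₂, e₂⟩ := exists_rpow_eq (by linarith : 0 < p - 1)
    (by positivity : 0 < (1 / 2 : ℝ) ^ (s * p) *
      ((1 / 2 : ℝ) ^ (-((n : ℝ) + s * p)) * (ω + ω) + 1))
  refine ⟨max h₁ h₂, by positivity, fun v r m hm hb ht => ?_⟩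
  set w : Rn n → ℝ := fun x => |v (r • x) / m| with hw
  have hw0 : ∀ x, 0 ≤ w x := fun x => abs_nonneg _
  have hC : 0 < max h₁ h₂ := by positivity
  have e : ∀ x : Rn n, |(v ((r / 2) • x) - 0) / (max h₁ h₂ * m)| =
      w ((1 / 2 : ℝ) • x) / max h₁ h₂ := fun x => by
    simp only [hw]
    rw [sub_zero, smul_smul, mul_one_div, mul_comm, ← div_div, abs_div _ (max h₁ h₂),
      abs_of_pos hC]
  rw [hωv] at hb
  have hb' : ballPow n (p - 1) w 1 ≤ ENNReal.ofReal (ω + ω) := by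
    refine (ballPow_exponent_le hw0 one_pos (by linarith) (sub_one_le_qStar p)).trans ?_
    simp only [Real.one_rpow, ENNReal.ofReal_one, one_mul]
    rw [ENNReal.ofReal_add hω.le hω.le, hωv]
    exact add_le_add le_rfl hb
  refine ⟨?_, ?_⟩
  · rw [ballPow_rescale hC (by norm_num : (0 : ℝ) < 1 / 2) hw0 e, mul_one]
    refine (mul_le_mul' le_rfl ((ballPow_mono (R := 1) (by linarith) hw0 (fun x => le_rfl)
      (by norm_num)).trans hb)).trans ?_
    rw [← ENNReal.ofReal_mul (by positivity), ENNReal.ofReal_le_one, mul_assoc, ← e₁,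
      Real.rpow_neg hC.le, inv_mul_le_one₀ (by positivity)]
    gcongr
    exact le_max_left _ _
  · rw [tailPow_rescale hC (by norm_num : (0 : ℝ) < 1 / 2) hw0 e, mul_one]
    refine (mul_le_mul' le_rfl ((tailPow_le_ballPow_add hs hp hw0 (R := 1) (by norm_num)).trans
      (add_le_add (mul_le_mul' le_rfl hb') ht))).trans ?_
    rw [← ENNReal.ofReal_mul (by positivity), ← ENNReal.ofReal_one,
      ← ENNReal.ofReal_add (by positivity) zero_le_one, ← ENNReal.ofReal_mul (by positivity)]
    refine ENNReal.ofReal_le_ofReal ?_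
    rw [mul_assoc, ← e₂, Real.rpow_neg hC.le, inv_mul_le_one₀ (by positivity)]
    have : 0 < p - 1 := by linarith
    gcongr
    exact le_max_right _ _

end Wolff

section Assembly

variable {n : ℕ} {s p : ℝ}

lemma lintegral_ball_rpow_eq_ballPow (u : Rn n → ℝ) (q : ℝ) (x₀ : Rn n) (r : ℝ) :
    ∫⁻ x in ball x₀ r, ENNReal.ofReal (|u x| ^ q) = ballPow n q (fun x => |u (x₀ + x)|) r := by
  have h := lintegral_ball_affine (fun x => ENNReal.ofReal (|u x| ^ q)) x₀ one_pos r
  simp only [one_mul, one_smul, one_pow, ENNReal.ofReal_one] at h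
  exact h

lemma tailFn_eq_tailPow (u : Rn n → ℝ) (x₀ : Rn n) (r : ℝ) :
    tailFn n s p u x₀ r =
      (ENNReal.ofReal (r ^ (s * p)) * tailPow n s p (fun x => |u (x₀ + x)|) r) ^ (1 / (p - 1)) := by
  have h := lintegral_compl_ball_affine
    (fun x => ENNReal.ofReal (|u x| ^ (p - 1) / ‖x - x₀‖ ^ ((n : ℝ) + s * p))) x₀ one_pos r
  simp only [one_mul, one_smul, one_pow, ENNReal.ofReal_one, add_sub_cancel_left] at h
  rw [tailFn, h, tailPow]
  congr 2
  refine lintegral_congr fun x => ?_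
  rw [Real.rpow_neg (norm_nonneg _), div_eq_mul_inv]

/-- Convergence of the tails from convergence in balls and of one tail. -/
lemma tendsto_tailPow (hs : 0 < s) (hp : 1 < p) {w : ℕ → Rn n → ℝ} (hw0 : ∀ j x, 0 ≤ w j x)
    {R r : ℝ} (hr : 0 < r) (hb : Tendsto (fun j => ballPow n (qStar p) (w j) R) atTop (𝓝 0))
    (ht : Tendsto (fun j => tailPow n s p (w j) R) atTop (𝓝 0)) :
    Tendsto (fun j => tailPow n s p (w j) r) atTop (𝓝 0) := by
  have hp1 : 0 < p - 1 := by linarith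
  have hvol : volume (ball (0 : Rn n) R) ≠ ⊤ := measure_ball_lt_top.ne
  have hb' : Tendsto (fun j => ballPow n (p - 1) (w j) R) atTop (𝓝 0) := by
    refine ENNReal.tendsto_nhds_zero.2 fun ε hε => ?_
    have hε2 : 0 < ε / 2 := ENNReal.half_pos hε.ne'
    have h1 : Tendsto (fun h : ℝ => ENNReal.ofReal (h ^ (p - 1)) * volume (ball (0 : Rn n) R))
        (𝓝[>] 0) (𝓝 0) := by
      have h1 : Tendsto (fun h : ℝ => ENNReal.ofReal (h ^ (p - 1))) (𝓝 0) (𝓝 0) := by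
        have := (ENNReal.continuous_ofReal.tendsto _).comp
          ((Real.continuousAt_rpow_const 0 (p - 1) (Or.inr hp1.le)).tendsto)
        simpa [Function.comp_def, Real.zero_rpow hp1.ne'] using this
      have := ENNReal.Tendsto.mul_const h1 (Or.inr hvol)
      rw [zero_mul] at this
      exact this.mono_left nhdsWithin_le_nhds
    obtain ⟨h, hh, hh0⟩ := ((h1.eventually_le_const hε2).and self_mem_nhdsWithin).exists
    have h2 := ENNReal.Tendsto.const_mul (a := ENNReal.ofReal (h ^ (p - 1 - qStar p))) hb
      (Or.inr ENNReal.ofReal_ne_top)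
    rw [mul_zero] at h2
    filter_upwards [h2.eventually_le_const hε2] with j hj
    refine (ballPow_exponent_le (hw0 j) hh0 hp1 (sub_one_le_qStar p)).trans ?_
    exact (add_le_add hh hj).trans (ENNReal.add_halves ε).le
  have h3 := (ENNReal.Tendsto.const_mul (a := ENNReal.ofReal (r ^ (-((n : ℝ) + s * p)))) hb'
      (Or.inr ENNReal.ofReal_ne_top)).add ht
  rw [mul_zero, add_zero] at h3
  exact tendsto_of_tendsto_of_tendsto_of_le_of_le tendsto_const_nhds h3 (fun j => zero_le)
    fun j => tailPow_le_ballPow_add hs hp (hw0 j) hr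

lemma tailPow_lt_top_of_lintegral_rpow (hn : 2 ≤ n) (hs : 0 < s) (hp : 1 < p) {f : Rn n → ℝ}
    (hf0 : ∀ x, 0 ≤ f x) (hf : ∫⁻ x, ENNReal.ofReal (f x ^ p) < ⊤) {r : ℝ}
    (hr : 0 < r) : tailPow n s p f r < ⊤ := by
  have hp1 : 0 < p - 1 := by linarith
  obtain ⟨C, hC, hconst⟩ := exists_tailPow_const hn hs hp
  have h1 : tailPow n s p f r ≤ tailPow n s p (fun _ => 1) r +
      ENNReal.ofReal (r ^ (-((n : ℝ) + s * p))) * ∫⁻ x, ENNReal.ofReal (f x ^ p) := by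
    rw [tailPow, tailPow]
    refine le_trans ?_ (add_le_add le_rfl (mul_le_mul' le_rfl
      (setLIntegral_le_lintegral (ball (0 : Rn n) r)ᶜ _)))
    rw [← lintegral_const_mul' _ _ ENNReal.ofReal_ne_top, ← lintegral_add_left (by fun_prop)]
    refine setLIntegral_mono' measurableSet_ball.compl fun x hx => ?_
    have hx' : r ≤ ‖x‖ := by simpa using hx
    have hfx := hf0 x
    have hk : ‖x‖ ^ (-((n : ℝ) + s * p)) ≤ r ^ (-((n : ℝ) + s * p)) :=
      Real.rpow_le_rpow_of_nonpos hr hx' (by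
        have : 0 < s * p := by positivity
        have : (0 : ℝ) ≤ n := by positivity
        linarith)
    have h2 := rpow_le_rpow_add hfx one_pos hp1 (by linarith : p - 1 ≤ p)
    rw [Real.one_rpow, Real.one_rpow, one_mul] at h2
    rw [← ENNReal.ofReal_mul (by positivity), ← ENNReal.ofReal_add (by positivity) (by positivity),
      Real.one_rpow, one_mul]
    refine ENNReal.ofReal_le_ofReal ?_
    calc f x ^ (p - 1) * ‖x‖ ^ (-((n : ℝ) + s * p))
        ≤ (1 + f x ^ p) * ‖x‖ ^ (-((n : ℝ) + s * p)) := by gcongr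
      _ = ‖x‖ ^ (-((n : ℝ) + s * p)) + ‖x‖ ^ (-((n : ℝ) + s * p)) * f x ^ p := by ring
      _ ≤ _ := by gcongr
  exact h1.trans_lt (ENNReal.add_lt_top.2 ⟨(hconst 1 r zero_le_one hr).trans_lt
    ENNReal.ofReal_lt_top, ENNReal.mul_lt_top ENNReal.ofReal_lt_top hf⟩)

/-- `u` is approximated near `x₀` by the energy solutions `U j` with data `f j`, whose masses are
controlled by `ν`. -/
structure Approximable (n : ℕ) (Φ : ℝ → ℝ) (K : Rn n → Rn n → ℝ) (s p : ℝ) (Ω : Set (Rn n))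
    (ν : Measure (Rn n)) (x₀ : Rn n) (u : Rn n → ℝ) (U f : ℕ → Rn n → ℝ) : Prop where
  meas : Measurable u
  measU : ∀ j, Measurable (U j)
  mem : ∀ j, memWsp n s p univ (U j)
  cont : ∀ j, Continuous (f j)
  supp : ∀ j, HasCompactSupport (f j)
  weak : ∀ j φ, IsTestFun n Ω φ → nonlocalForm n Φ K (U j) φ = ∫ x, φ x * f j x
  mass : ∀ r, 0 < r →
    limsup (fun j => ∫⁻ x in ball x₀ r, ENNReal.ofReal |f j x|) atTop ≤ ν (closedBall x₀ r)
  conv : ∀ R, 0 < R → Tendsto (fun j =>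
    ballPow n (qStar p) (fun x => |U j (x₀ + x) - u (x₀ + x)|) R) atTop (𝓝 0)
  convTail : ∀ R, 0 < R → Tendsto (fun j =>
    tailPow n s p (fun x => |U j (x₀ + x) - u (x₀ + x)|) R) atTop (𝓝 0)

section

variable {Φ : ℝ → ℝ} {K : Rn n → Rn n → ℝ} {Ω : Set (Rn n)} {ν : Measure (Rn n)} {x₀ : Rn n}
  {u : Rn n → ℝ} {U f : ℕ → Rn n → ℝ}

lemma Approximable.lintegral_rpow_lt_top (h : Approximable n Φ K s p Ω ν x₀ u U f) (j : ℕ) :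
    ∫⁻ x, ENNReal.ofReal (|U j (x₀ + x)| ^ p) < ⊤ := by
  rw [lintegral_add_left_eq_self (fun x => ENNReal.ofReal (|U j x| ^ p)) x₀]
  simpa using (h.mem j).2.1

lemma Approximable.ballPow_lt_top (hqp : qStar p ≤ p) (h : Approximable n Φ K s p Ω ν x₀ u U f)
    {r : ℝ} (hr : 0 < r) : ballPow n (qStar p) (fun x => |u (x₀ + x)|) r < ⊤ := by
  have hq := one_le_qStar p
  have hu := h.meas
  obtain ⟨j, hj⟩ := ((h.conv r hr).eventually_le_const zero_lt_one).exists
  have hUj := h.measU j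
  refine (ballPow_le_add (by linarith) (g := fun x => |U j (x₀ + x) - u (x₀ + x)|)
    (h := fun x => |U j (x₀ + x)|) (by fun_prop) (fun x => abs_nonneg _) (fun x => abs_nonneg _)
    (fun x => abs_nonneg _) fun x => ?_).trans_lt ?_
  · have := abs_sub_abs_le_abs_sub (u (x₀ + x)) (U j (x₀ + x))
    rw [abs_sub_comm] at this
    linarith
  · refine ENNReal.mul_lt_top ENNReal.ofReal_lt_top (ENNReal.add_lt_top.2
      ⟨hj.trans_lt ENNReal.one_lt_top, ?_⟩)
    refine (ballPow_exponent_le (fun x => abs_nonneg _) one_pos (by linarith) hqp).trans_lt ?_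
    exact ENNReal.add_lt_top.2 ⟨ENNReal.mul_lt_top ENNReal.ofReal_lt_top measure_ball_lt_top,
      ENNReal.mul_lt_top ENNReal.ofReal_lt_top
        ((setLIntegral_le_lintegral _ _).trans_lt (h.lintegral_rpow_lt_top j))⟩

lemma Approximable.tailPow_lt_top (hn : 2 ≤ n) (hs : 0 < s) (hp : 1 < p)
    (h : Approximable n Φ K s p Ω ν x₀ u U f)
    {r : ℝ} (hr : 0 < r) : tailPow n s p (fun x => |u (x₀ + x)|) r < ⊤ := by
  have hu := h.meas
  obtain ⟨j, hj⟩ := ((h.convTail r hr).eventually_le_const zero_lt_one).exists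
  have hUj := h.measU j
  refine (tailPow_le_add hp (g := fun x => |U j (x₀ + x) - u (x₀ + x)|)
    (h := fun x => |U j (x₀ + x)|) (by fun_prop) (fun x => abs_nonneg _) (fun x => abs_nonneg _)
    (fun x => abs_nonneg _) fun x => ?_).trans_lt ?_
  · have := abs_sub_abs_le_abs_sub (u (x₀ + x)) (U j (x₀ + x))
    rw [abs_sub_comm] at this
    linarith
  · exact ENNReal.mul_lt_top ENNReal.ofReal_lt_top (ENNReal.add_lt_top.2
      ⟨hj.trans_lt ENNReal.one_lt_top, tailPow_lt_top_of_lintegral_rpow hn hs hp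
        (fun x => abs_nonneg _) (h.lintegral_rpow_lt_top j) hr⟩)

lemma ballAvg_eq_ballAvg_translate (u : Rn n → ℝ) (x₀ : Rn n) (ρ : ℝ) :
    ballAvg n u x₀ ρ = ballAvg n (fun x => u (x₀ + x)) 0 ρ := by
  have h := (measurePreserving_add_left (volume : Measure (Rn n)) x₀).setIntegral_preimage_emb
    (MeasurableEquiv.addLeft x₀).measurableEmbedding u (ball x₀ ρ)
  have hpre : (fun x => x₀ + x) ⁻¹' ball x₀ ρ = ball (0 : Rn n) ρ := by
    ext x
    simp
  rw [hpre] at h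
  rw [ballAvg, ballAvg, setAverage_eq, setAverage_eq, h, measureReal_def, measureReal_def,
    Measure.addHaar_ball_center]

/-- Scale-invariant bounds by the average and the tail. -/
lemma rescaled_le_of_avg_tail (hp : 1 < p) {r m : ℝ} (hr : 0 < r) (hm : 0 < m)
    (hE : ((volume (ball x₀ r))⁻¹ * ∫⁻ x in ball x₀ r, ENNReal.ofReal (|u x| ^ qStar p)) ^
      (1 / qStar p) ≤ ENNReal.ofReal m) (hT : tailFn n s p u x₀ r ≤ ENNReal.ofReal m) :
    ballPow n (qStar p) (fun x => |u (x₀ + r • x) / m|) 1 ≤ volume (ball (0 : Rn n) 1) ∧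
      tailPow n s p (fun x => |u (x₀ + r • x) / m|) 1 ≤ 1 := by
  have hq := one_le_qStar p
  have hq0 : 0 < qStar p := by linarith
  have hp1 : 0 < p - 1 := by linarith
  rw [ballPow_rescale (G := fun x => |u (x₀ + x)|) hm hr (fun x => abs_nonneg _)
    (fun x => by rw [abs_div, abs_of_pos hm]), tailPow_rescale (G := fun x => |u (x₀ + x)|) hm hr
    (fun x => abs_nonneg _) (fun x => by rw [abs_div, abs_of_pos hm]), mul_one]
  refine ⟨?_, ?_⟩
  · rw [lintegral_ball_rpow_eq_ballPow, one_div, ENNReal.rpow_inv_le_iff hq0,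
      ENNReal.ofReal_rpow_of_pos hm, volume_ball_eq x₀ hr,
      ENNReal.ofReal_mul (by positivity), ENNReal.ofReal_toReal measure_ball_lt_top.ne,
      ENNReal.inv_mul_le_iff (mul_ne_zero (ENNReal.ofReal_pos.2 (by positivity)).ne'
        (measure_ball_pos _ _ one_pos).ne')
      (ENNReal.mul_ne_top ENNReal.ofReal_ne_top measure_ball_lt_top.ne)] at hE
    refine (mul_le_mul' le_rfl hE).trans (le_of_eq ?_)
    rw [mul_comm _ (volume _), mul_assoc, mul_left_comm, ← ENNReal.ofReal_mul (by positivity),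
      ← ENNReal.ofReal_mul (by positivity), Real.rpow_neg hm.le,
      show (m ^ qStar p)⁻¹ * (r ^ n)⁻¹ * (r ^ n * m ^ qStar p) = 1 by field_simp,
      ENNReal.ofReal_one, mul_one]
  · rw [tailFn_eq_tailPow, one_div, ENNReal.rpow_inv_le_iff hp1, ENNReal.ofReal_rpow_of_pos hm] at hT
    rw [ENNReal.ofReal_mul (by positivity), mul_assoc]
    refine (mul_le_mul' le_rfl hT).trans (le_of_eq ?_)
    rw [← ENNReal.ofReal_mul (by positivity), Real.rpow_neg hm.le,
      inv_mul_cancel₀ (by positivity), ENNReal.ofReal_one]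

end

end Assembly

section Main

/-- The potential upper bound for approximable functions. -/
lemma exists_potential_bound {n : ℕ} {s p Λ : ℝ} (hn : 2 ≤ n) (hs : 0 < s) (hs1 : s < 1)
    (hp : 2 - s / (n : ℝ) < p) (hΛ : 1 ≤ Λ) : ∃ c : ℝ, 0 < c ∧
      ∀ (Φ : ℝ → ℝ) (K : Rn n → Rn n → ℝ) (Ω : Set (Rn n)) (ν : Measure (Rn n)) (x₀ : Rn n)
        (u : Rn n → ℝ) (U f : ℕ → Rn n → ℝ) (r : ℝ),
        KernelBounds n Λ s p K → PhiBounds Λ p Φ → Approximable n Φ K s p Ω ν x₀ u U f →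
        0 < r → ball x₀ r ⊆ Ω → wolff n s p ν x₀ r < ⊤ →
        ∃ L : ℝ, Tendsto (fun ρ => ballAvg n u x₀ ρ) (𝓝[>] (0 : ℝ)) (𝓝 L) ∧
          ENNReal.ofReal |L| ≤ ENNReal.ofReal c * wolff n s p ν x₀ r +
            ENNReal.ofReal c * ((volume (ball x₀ r))⁻¹ *
              ∫⁻ x in ball x₀ r, ENNReal.ofReal (|u x| ^ qStar p)) ^ (1 / qStar p) +
            ENNReal.ofReal c * tailFn n s p u x₀ r := by
  obtain ⟨τ, γ, he⟩ := exists_exponents hn hs hs1 hp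
  have hp1 := he.hp
  have hpos : 0 < p - 1 := by linarith
  have hq := one_le_qStar p
  obtain ⟨σ, hσ, hσ4, δ, hδ, A, hA, hdec⟩ := exists_weakSol_decay hn hs hs1 hp hΛ
  obtain ⟨κ, hκ, hwolff⟩ := exists_tsum_le_wolff (n := n) (s := s) hp1
  obtain ⟨C₂, hC₂, hinit⟩ := exists_excessLE_initial (n := n) hs hp1
  obtain ⟨C₀, hC₀, hC₀e⟩ := exists_rpow_eq hpos (by positivity : 0 < 2 / δ)
  set D : ℝ := A * (5 / 4) / (1 - 25 / 32) * (C₂ + C₀ * κ) + 1 with hD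
  have hD0 : 0 < D := by
    have : (0 : ℝ) < 1 - 25 / 32 := by norm_num
    positivity
  refine ⟨D, hD0, ?_⟩
  intro Φ K Ω ν x₀ u U f r hK hΦ hap hr hball hW
  have hu := hap.meas
  set v : Rn n → ℝ := fun x => u (x₀ + x) with hv
  have hvm : Measurable v := by fun_prop
  set R : ℕ → ℝ := fun i => σ ^ i * (r / 2) with hR
  have hR0 : ∀ i, 0 < R i := fun i => by positivity
  have hRr : ∀ i, R i ≤ r := fun i => by
    have : σ ^ i ≤ 1 := pow_le_one₀ hσ.le (by linarith)
    simp only [hR]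
    nlinarith
  set W : ℕ → ℝ≥0∞ := fun i => (ν (closedBall x₀ (R i)) /
    ENNReal.ofReal (R i ^ ((n : ℝ) - s * p))) ^ (1 / (p - 1)) with hWdef
  have hWsum : ∑' i, W i ≤ ENNReal.ofReal κ * wolff n s p ν x₀ r := hwolff ν x₀ σ r hσ hσ4 hr
  have hWtop : ∑' i, W i ≠ ⊤ :=
    (hWsum.trans_lt (ENNReal.mul_lt_top ENNReal.ofReal_lt_top hW)).ne
  have hWi : ∀ i, W i ≠ ⊤ := ENNReal.ne_top_of_tsum_ne_top hWtop
  set E := ((volume (ball x₀ r))⁻¹ *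
    ∫⁻ x in ball x₀ r, ENNReal.ofReal (|u x| ^ qStar p)) ^ (1 / qStar p) with hE
  set T := tailFn n s p u x₀ r with hT
  have hEtop : E ≠ ⊤ := by
    refine ENNReal.rpow_ne_top_of_nonneg (by positivity) (ENNReal.mul_ne_top
      (ENNReal.inv_ne_top.2 (measure_ball_pos _ _ hr).ne') ?_)
    rw [lintegral_ball_rpow_eq_ballPow]
    exact (hap.ballPow_lt_top (he.hqγ.trans he.hγp) hr).ne
  have hTtop : T ≠ ⊤ := by
    rw [hT, tailFn_eq_tailPow]
    exact ENNReal.rpow_ne_top_of_nonneg (by positivity) (ENNReal.mul_ne_top ENNReal.ofReal_ne_top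
      (hap.tailPow_lt_top hn hs hp1 hr).ne)
  have hdecay : ∀ {ρ m c : ℝ}, 0 < ρ → ρ ≤ r → 0 < m →
      ν (closedBall x₀ ρ) < ENNReal.ofReal (δ * (m ^ (p - 1) * ρ ^ ((n : ℝ) - s * p))) →
      ExcessLE n s p v c ρ m →
      ∃ c', |c' - c| ≤ A * (5 / 4 * m) ∧ ExcessLE n s p v c' (σ * ρ) (25 / 32 * m) :=
    exists_decay_of_approx hp1 hσ hδ (V := fun j x => U j (x₀ + x))
      (N := fun ρ => ν (closedBall x₀ ρ))
      (N' := fun j ρ => ∫⁻ x in ball x₀ ρ, ENNReal.ofReal |f j x|) hvm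
      (fun j => by have := hap.measU j; fun_prop)
      (fun j ρ m c hρ hρr hm hN hex => hdec Φ K Ω (U j) (f j) x₀ ρ m c hK hΦ (hap.measU j)
        (hap.mem j) (hap.cont j) (hap.supp j) (hap.weak j) hρ hm
        ((ball_subset_ball hρr).trans hball) hN hex)
      hap.mass hap.conv hap.convTail
  have key : ∀ η : ℝ, 0 < η → ∃ L : ℝ, Tendsto (fun ρ => ballAvg n u x₀ ρ) (𝓝[>] (0 : ℝ)) (𝓝 L) ∧
      |L| ≤ D * (E.toReal + T.toReal + (wolff n s p ν x₀ r).toReal + η) := by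
    intro η hη
    set m := E.toReal + T.toReal + η with hm
    have hET : 0 ≤ E.toReal := ENNReal.toReal_nonneg
    have hTT : 0 ≤ T.toReal := ENNReal.toReal_nonneg
    have hm0 : 0 < m := by positivity
    obtain ⟨i1, i2⟩ := rescaled_le_of_avg_tail (u := u) (x₀ := x₀) hp1 hr hm0
      (by
        rw [← hE, ← ENNReal.ofReal_toReal hEtop]
        exact ENNReal.ofReal_le_ofReal (by linarith))
      (by
        rw [← hT, ← ENNReal.ofReal_toReal hTtop]
        exact ENNReal.ofReal_le_ofReal (by linarith))
    have hinit' := hinit v r m hm0 i1 i2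
    set a : ℕ → ℝ := fun i => (if i = 0 then C₂ * m else 0) + C₀ * (W i).toReal with ha
    have hWr : ∀ i, 0 ≤ (W i).toReal := fun i => ENNReal.toReal_nonneg
    have ha0 : C₂ * m ≤ a 0 := by
      simp only [ha, if_true]
      have := hWr 0
      have : 0 ≤ C₀ * (W 0).toReal := by positivity
      linarith
    have haW : ∀ i, C₀ * (W i).toReal ≤ a i := fun i => by
      simp only [ha]
      split_ifs
      · have : 0 ≤ C₂ * m := by positivity
        linarith
      · linarith
    have hWs : Summable fun i => (W i).toReal := ENNReal.summable_toReal hWtop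
    have h1s : Summable fun i : ℕ => if i = 0 then C₂ * m else 0 :=
      (hasSum_ite_eq 0 (C₂ * m)).summable
    have has : Summable a := h1s.add (hWs.mul_left C₀)
    have hatsum : ∑' i, a i ≤ C₂ * m + C₀ * (κ * (wolff n s p ν x₀ r).toReal) := by
      rw [h1s.tsum_add (hWs.mul_left C₀), tsum_ite_eq, tsum_mul_left,
        ← ENNReal.tsum_toReal_eq hWi]
      have h := ENNReal.toReal_mono (ENNReal.mul_lt_top ENNReal.ofReal_lt_top hW).ne hWsum
      rw [ENNReal.toReal_mul, ENNReal.toReal_ofReal hκ.le] at h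
      gcongr
    obtain ⟨L, hL, hLb⟩ := exists_tendsto_ballAvg (s := s) (p := p) (v := v) (a := a)
      (θ := 25 / 32) (B := A * (5 / 4)) (r := r / 2) hp1 hvm hσ (by linarith) (by norm_num)
      (by norm_num) (by positivity) (by positivity) (lt_of_lt_of_le (by positivity) ha0)
      (fun i => le_trans (mul_nonneg hC₀.le (hWr i)) (haW i)) has
      (hinit'.mono hp1 (by positivity) ha0) (by
        intro i M c hM haM hex
        have hWM : W i ≤ ENNReal.ofReal (M / C₀) := by
          rw [← ENNReal.ofReal_toReal (hWi i)]
          refine ENNReal.ofReal_le_ofReal ?_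
          rw [le_div_iff₀ hC₀, mul_comm]
          exact (haW i).trans haM
        have hRe : 0 < R i ^ ((n : ℝ) - s * p) := Real.rpow_pos_of_pos (hR0 i) _
        have hN : ν (closedBall x₀ (R i)) <
            ENNReal.ofReal (δ * (M ^ (p - 1) * R i ^ ((n : ℝ) - s * p))) := by
          simp only [hWdef] at hWM
          rw [one_div, ENNReal.rpow_inv_le_iff hpos, ENNReal.ofReal_rpow_of_pos (by positivity),
            ENNReal.div_le_iff (ENNReal.ofReal_pos.2 hRe).ne' ENNReal.ofReal_ne_top,
            ← ENNReal.ofReal_mul (by positivity), Real.div_rpow hM.le hC₀.le, hC₀e] at hWM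
          refine hWM.trans_lt ((ENNReal.ofReal_lt_ofReal_iff (by positivity)).2 ?_)
          have : 0 < δ * (M ^ (p - 1) * R i ^ ((n : ℝ) - s * p)) := by positivity
          calc M ^ (p - 1) / (2 / δ) * R i ^ ((n : ℝ) - s * p)
              = δ * (M ^ (p - 1) * R i ^ ((n : ℝ) - s * p)) / 2 := by field_simp
            _ < _ := by linarith
        obtain ⟨c', hc', hex'⟩ := hdecay (hR0 i) (hRr i) hM hN hex
        refine ⟨c', by rwa [mul_assoc], ?_⟩
        rwa [hR, ← mul_assoc, ← pow_succ'] at hex')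
    refine ⟨L, ?_, hLb.trans ?_⟩
    · simpa only [ballAvg_eq_ballAvg_translate u x₀] using hL
    · set w := (wolff n s p ν x₀ r).toReal with hw
      have hw0 : 0 ≤ w := ENNReal.toReal_nonneg
      have hB : 0 ≤ A * (5 / 4) / (1 - 25 / 32) := by
        have : (0 : ℝ) < 1 - 25 / 32 := by norm_num
        positivity
      calc A * (5 / 4) / (1 - 25 / 32) * ∑' i, a i
          ≤ A * (5 / 4) / (1 - 25 / 32) * ((C₂ + C₀ * κ) * (m + w)) := by
            refine mul_le_mul_of_nonneg_left (hatsum.trans ?_) hB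
            have h1 : 0 ≤ C₂ * w := by positivity
            have h2 : 0 ≤ C₀ * κ * m := by positivity
            nlinarith
        _ ≤ D * (m + w) := by
            rw [← mul_assoc]
            refine mul_le_mul_of_nonneg_right ?_ (by positivity)
            linarith
        _ = _ := by rw [hm]; ring
  obtain ⟨L, hL, -⟩ := key 1 one_pos
  refine ⟨L, hL, ?_⟩
  have hLb : |L| ≤ D * (E.toReal + T.toReal + (wolff n s p ν x₀ r).toReal) := by
    refine le_of_forall_pos_le_add fun ε hε => ?_
    obtain ⟨L', hL', hb⟩ := key (ε / D) (by positivity)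
    rw [tendsto_nhds_unique hL hL']
    rwa [mul_add, mul_div_cancel₀ _ hD0.ne'] at hb
  refine (ENNReal.ofReal_le_ofReal hLb).trans (le_of_eq ?_)
  rw [ENNReal.ofReal_mul hD0.le, ENNReal.ofReal_add (p := E.toReal + T.toReal) (by positivity) (by positivity),
    ENNReal.ofReal_add (p := E.toReal) (by positivity) (by positivity), ENNReal.ofReal_toReal hEtop,
    ENNReal.ofReal_toReal hTtop, ENNReal.ofReal_toReal hW.ne]
  ring

end Main

section AeCongr

variable {n : ℕ} {s p : ℝ} {v w : Rn n → ℝ}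

lemma gagliardo_univ_congr_ae (h : v =ᵐ[volume] w) :
    gagliardo n s p univ v = gagliardo n s p univ w := by
  simp only [gagliardo, Measure.restrict_univ]
  refine lintegral_congr_ae ?_
  filter_upwards [h] with x hx
  refine lintegral_congr_ae ?_
  filter_upwards [h] with y hy
  rw [hx, hy]

lemma memWsp_univ_congr_ae (h : v =ᵐ[volume] w) (hv : memWsp n s p univ v) :
    memWsp n s p univ w := by
  refine ⟨?_, ?_, gagliardo_univ_congr_ae h ▸ hv.2.2⟩
  · have := hv.1
    rw [Measure.restrict_univ] at this ⊢
    exact this.congr h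
  · refine lt_of_eq_of_lt (lintegral_congr_ae ?_) hv.2.1
    rw [Measure.restrict_univ]
    filter_upwards [h] with x hx
    rw [hx]

lemma nonlocalForm_congr_ae {Φ : ℝ → ℝ} {K : Rn n → Rn n → ℝ} {φ : Rn n → ℝ}
    (h : v =ᵐ[volume] w) : nonlocalForm n Φ K v φ = nonlocalForm n Φ K w φ := by
  refine integral_congr_ae ?_
  filter_upwards [h] with x hx
  refine integral_congr_ae ?_
  filter_upwards [h] with y hy
  rw [hx, hy]

lemma tailFn_congr_ae {x₀ : Rn n} {r : ℝ} (h : ∀ᵐ x, x ∉ ball x₀ r → v x = w x) :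
    tailFn n s p v x₀ r = tailFn n s p w x₀ r := by
  rw [tailFn, tailFn]
  congr 2
  refine setLIntegral_congr_fun_ae measurableSet_ball.compl ?_
  filter_upwards [h] with x hx hxb
  rw [hx hxb]

lemma ballAvg_congr_ae (h : v =ᵐ[volume] w) (x₀ : Rn n) (r : ℝ) :
    ballAvg n v x₀ r = ballAvg n w x₀ r := by
  rw [ballAvg, ballAvg, setAverage_eq, setAverage_eq, integral_congr_ae (ae_restrict_of_ae h)]

lemma qStar_lt_qBar (hn : 2 ≤ n) (hs : 0 < s) (hs1 : s < 1) (hp : 2 - s / (n : ℝ) < p) :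
    qStar p < qBar n s p := by
  have hn' : (2 : ℝ) ≤ n := by exact_mod_cast hn
  have h1 : s / (n : ℝ) < 1 := (div_lt_one (by linarith)).2 (by linarith)
  have h2 : 2 * (n : ℝ) - s < n * p := by
    have := mul_lt_mul_of_pos_left hp (by linarith : (0 : ℝ) < n)
    rwa [mul_sub, mul_div_cancel₀ _ (by linarith), mul_comm] at this
  refine max_lt (lt_min ?_ (by linarith)) (lt_min ?_ (by linarith))
  · rw [lt_div_iff₀ (by linarith)]
    linarith
  · rw [lt_div_iff₀ (by linarith)]
    nlinarith

/-- A SOLA has a measurable representative which is approximable near any point. -/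
lemma IsSOLA.exists_approximable {Φ : ℝ → ℝ} {K : Rn n → Rn n → ℝ} {Ω : Set (Rn n)}
    {μ : SignedMeasure (Rn n)} {g u : Rn n → ℝ} (hn : 2 ≤ n) (hs : 0 < s) (hs1 : s < 1)
    (hp : 2 - s / (n : ℝ) < p) (hΩ : Bornology.IsBounded Ω) (h : IsSOLA n Φ K s p Ω μ g u)
    (x₀ : Rn n) : ∃ (w : Rn n → ℝ) (U f : ℕ → Rn n → ℝ), u =ᵐ[volume] w ∧
      Approximable n Φ K s p Ω μ.totalVariation x₀ w U f := by
  obtain ⟨-, -, hug, uj, μj, gj, hμj, -, hsol, hae, hconv, -, hmass, hg⟩ := h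
  have hq := one_le_qStar p
  have hqq := qStar_lt_qBar hn hs hs1 hp
  have hp1 : 1 < p := hq.trans_lt (hqq.trans_le (min_le_right _ _))
  have hpos : 0 < p - 1 := by linarith
  have hUm : ∀ j, AEMeasurable (uj j) := fun j => by
    have := (hsol j).1.1
    rwa [Measure.restrict_univ] at this
  have hum : AEMeasurable u := aemeasurable_of_tendsto_metrizable_ae atTop hUm hae
  have eu := hum.ae_eq_mk
  have eU := fun j => (hUm j).ae_eq_mk
  have hb : ∀ R, 0 < R → Tendsto (fun j => ballPow n (qStar p)
      (fun x => |(hUm j).mk (uj j) (x₀ + x) - hum.mk u (x₀ + x)|) R) atTop (𝓝 0) := by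
    intro R hR
    refine (hconv (qStar p) le_rfl hqq x₀ R hR).congr fun j => ?_
    rw [← lintegral_ball_rpow_eq_ballPow (fun x => (hUm j).mk (uj j) x - hum.mk u x)]
    refine lintegral_congr_ae (ae_restrict_of_ae ?_)
    filter_upwards [eu, eU j] with x h1 h2
    rw [h1, h2]
  refine ⟨hum.mk u, fun j => (hUm j).mk (uj j), μj, eu, ⟨hum.measurable_mk,
    fun j => (hUm j).measurable_mk, fun j => memWsp_univ_congr_ae (eU j) (hsol j).1,
    fun j => (hμj j).1.continuous, fun j => (hμj j).2,
    fun j φ hφ => (nonlocalForm_congr_ae (eU j)).symm.trans ((hsol j).2.2 φ hφ),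
    fun r hr => hmass x₀ r hr, hb, fun r hr => ?_⟩⟩
  obtain ⟨R, hR, hΩR⟩ : ∃ R : ℝ, 0 < R ∧ Ω ⊆ ball x₀ R := by
    obtain ⟨R, hR⟩ := hΩ.subset_ball x₀
    exact ⟨max R 1, by positivity, hR.trans (ball_subset_ball (le_max_left _ _))⟩
  refine tendsto_tailPow hs hp1 (fun j x => abs_nonneg _) hr (hb R hR) ?_
  have hX : 0 < R ^ (s * p) := by positivity
  have h1 := (ENNReal.continuous_rpow_const (y := p - 1)).tendsto 0 |>.comp (hg x₀ R hR).2
  rw [ENNReal.zero_rpow_of_pos hpos] at h1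
  have h2 := ENNReal.Tendsto.const_mul (a := ENNReal.ofReal (R ^ (s * p))⁻¹) h1
    (Or.inr ENNReal.ofReal_ne_top)
  rw [mul_zero] at h2
  refine h2.congr fun j => ?_
  have e : tailFn n s p (fun x => gj j x - g x) x₀ R =
      tailFn n s p (fun x => (hUm j).mk (uj j) x - hum.mk u x) x₀ R := by
    refine tailFn_congr_ae ?_
    filter_upwards [eu, eU j, hug, (hsol j).2.1] with x h1 h2 h3 h4 hx
    have hxΩ : x ∉ Ω := fun h => hx (hΩR h)
    rw [← h1, ← h2, h3 hxΩ, h4 hxΩ]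
  rw [Function.comp_apply, e, tailFn_eq_tailPow, ← ENNReal.rpow_mul,
    one_div_mul_cancel hpos.ne', ENNReal.rpow_one, ← mul_assoc,
    ← ENNReal.ofReal_mul (by positivity), inv_mul_cancel₀ hX.ne', ENNReal.ofReal_one, one_mul]

end AeCongr

/-- Theorem 1.2, Potential upper bound. -/
theorem potential_upper_bound
    (n : ℕ) (s p Λ : ℝ)
    (hn : 2 ≤ n) (hs : 0 < s) (hs1 : s < 1) (hp : 2 - s / (n : ℝ) < p) (hΛ : 1 ≤ Λ) :
    ∃ c : ℝ, 0 < c ∧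
      ∀ (Φ : ℝ → ℝ) (K : Rn n → Rn n → ℝ) (Ω : Set (Rn n))
        (μ : MeasureTheory.SignedMeasure (Rn n)) (g u : Rn n → ℝ) (x₀ : Rn n) (r : ℝ),
        KernelBounds n Λ s p K → PhiBounds Λ p Φ →
        IsOpen Ω → Bornology.IsBounded Ω → BoundaryDatum n s p g →
        IsSOLA n Φ K s p Ω μ g u →
        0 < r → ball x₀ r ⊆ Ω →
        wolff n s p μ.totalVariation x₀ r < ⊤ →
        ∃ L : ℝ,
          Tendsto (fun ρ => ballAvg n u x₀ ρ) (𝓝[>] (0 : ℝ)) (𝓝 L) ∧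
          ENNReal.ofReal |L| ≤
            ENNReal.ofReal c * wolff n s p μ.totalVariation x₀ r +
              ENNReal.ofReal c *
                ((volume (ball x₀ r))⁻¹ *
                    ∫⁻ x in ball x₀ r, ENNReal.ofReal (|u x| ^ qStar p)) ^ (1 / qStar p) +
              ENNReal.ofReal c * tailFn n s p u x₀ r := by
  obtain ⟨c, hc, h⟩ := exists_potential_bound hn hs hs1 hp hΛ
  refine ⟨c, hc, ?_⟩
  intro Φ K Ω μ g u x₀ r hK hΦ _ hΩ _ hsola hr hball hW
  obtain ⟨w, U, f, huw, hap⟩ := hsola.exists_approximable hn hs hs1 hp hΩ x₀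
  obtain ⟨L, hL, hLb⟩ := h Φ K Ω μ.totalVariation x₀ w U f r hK hΦ hap hr hball hW
  refine ⟨L, hL.congr fun ρ => (ballAvg_congr_ae huw x₀ ρ).symm, ?_⟩
  rw [tailFn_congr_ae (huw.mono fun x hx _ => hx), lintegral_congr_ae (ae_restrict_of_ae
    (huw.mono fun x hx => by rw [hx] :
      ∀ᵐ x, ENNReal.ofReal (|u x| ^ qStar p) = ENNReal.ofReal (|w x| ^ qStar p)))]
  exact hLb
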